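/- arXiv:0706.2807 — 3 statements merged into one kernel-verified Lean document; each statement's English description precedes it below -/
import Mathlib

section
/- As x → ∞, (log x) · ( ∏_{p ≤ x, p ≡ 1 (mod 5)} (1 − 1/p) )⁴ tends to ( 13√5 · π² · e^{−γ} / ( 150 · log((1 + √5)/2) ) ) · ∏_{p ≡ 1 (mod 5)} (1 − 1/p⁴) · ∏_{p ≡ 4 (mod 5)} ( (1 + p^{−2}) / (1 − p^{−2}) ), where both infinite products over primes in the indicated residue classes are absolutely convergent. Equivalently, C(5,1)⁴ = 13√5 π² e^{−γ} / (150 log((1+√5)/2)) · ∏_{p ≡ 1 (mod 5)} (1 − p^{−4}) · ∏_{p ≡ 4 (mod 5)} (1 + p^{−2})/(1 − p^{−2}). -/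
open Filter Topology Finset

/-- The logarithm of `⌊x⌋₊` is asymptotic to the logarithm of `x`. -/
theorem tendsto_log_natFloor_div_log :
    Tendsto (fun x : ℝ => Real.log ⌊x⌋₊ / Real.log x) atTop (𝓝 1) := by
  have h1 : Tendsto (fun x : ℝ => Real.log ((⌊x⌋₊ : ℝ) / x)) atTop (𝓝 0) := by
    simpa using (tendsto_nat_floor_div_atTop (R := ℝ)).log one_ne_zero
  have h2 : Tendsto (fun x : ℝ => Real.log ((⌊x⌋₊ : ℝ) / x) / Real.log x + 1) atTop (𝓝 (0 + 1)) :=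
    (h1.div_atTop Real.tendsto_log_atTop).add_const 1
  rw [zero_add] at h2
  refine h2.congr' ?_
  filter_upwards [eventually_gt_atTop 1] with x hx
  have hfl : (⌊x⌋₊ : ℝ) ≠ 0 := by
    simpa using (Nat.floor_pos.2 hx.le).ne'
  have hlog := Real.log_pos hx
  rw [Real.log_div hfl (by positivity)]
  field_simp
  ring

/-- `log log ⌊x⌋₊ - log log x` tends to zero. -/
theorem tendsto_log_log_natFloor_sub :
    Tendsto (fun x : ℝ => Real.log (Real.log ⌊x⌋₊) - Real.log (Real.log x)) atTop (𝓝 0) := by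
  have h := tendsto_log_natFloor_div_log.log one_ne_zero
  rw [Real.log_one] at h
  refine h.congr' ?_
  filter_upwards [eventually_ge_atTop 2] with x hx
  have hfl : (2 : ℝ) ≤ ⌊x⌋₊ := by exact_mod_cast Nat.le_floor hx
  exact Real.log_div (Real.log_pos (by linarith)).ne' (Real.log_pos (by linarith)).ne'

/-- The integral of `log u * exp (-u)` over the positive half-line is `-γ`. -/
theorem integral_log_mul_exp_neg :
    ∫ u in Set.Ioi (0 : ℝ), Real.log u * Real.exp (-u) = -Real.eulerMascheroniConstant := by
  have h1 := Complex.hasDerivAt_GammaIntegral (s := 1) (by simp)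
  have h2 : HasDerivAt Complex.GammaIntegral (-(Real.eulerMascheroniConstant : ℂ)) 1 := by
    refine Complex.hasDerivAt_Gamma_one.congr_of_eventuallyEq ?_
    have : ∀ᶠ s : ℂ in 𝓝 1, 0 < s.re :=
      (isOpen_lt continuous_const Complex.continuous_re).mem_nhds (by simp)
    filter_upwards [this] with s hs using (Complex.Gamma_eq_integral hs).symm
  have h3 := h1.unique h2
  have h4 : ∫ t : ℝ in Set.Ioi 0, ((t : ℂ) ^ ((1 : ℂ) - 1) * (Real.log t * Real.exp (-t)))
      = ∫ t : ℝ in Set.Ioi 0, ((Real.log t * Real.exp (-t) : ℝ) : ℂ) := by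
    simp
  rw [h4, integral_complex_ofReal] at h3
  exact_mod_cast h3

/-- `log u * exp (-u)` is integrable on the positive half-line. -/
theorem integrableOn_log_mul_exp_neg :
    MeasureTheory.IntegrableOn (fun u : ℝ => Real.log u * Real.exp (-u)) (Set.Ioi 0) := by
  by_contra h
  have h1 := integral_log_mul_exp_neg
  rw [MeasureTheory.integral_undef h] at h1
  linarith [Real.one_half_lt_eulerMascheroniConstant]

/-- The Laplace-type form of a Dirichlet series, in terms of the partial sums of its
coefficients. -/
theorem LSeries_eq_integral_exp {f : ℕ → ℂ} {r δ : ℝ} (hr : 0 ≤ r) (hδ : r < δ)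
    (hS : LSeriesSummable f δ)
    (hO : (fun n ↦ ∑ k ∈ Icc 1 n, f k) =O[atTop] fun n ↦ (n : ℝ) ^ r) :
    LSeries f δ =
      ∫ u in Set.Ioi (0 : ℝ), (∑ k ∈ Icc 1 ⌊Real.exp (u / δ)⌋₊, f k) * Real.exp (-u) := by
  have hδ0 : 0 < δ := hr.trans_lt hδ
  rw [LSeries_eq_mul_integral f hr (by simpa using hδ) hS hO]
  have himg : Set.Ioi (1 : ℝ) = (fun u : ℝ => Real.exp (u / δ)) '' Set.Ioi 0 := by
    ext t
    simp only [Set.mem_Ioi, Set.mem_image]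
    constructor
    · intro ht
      refine ⟨δ * Real.log t, mul_pos hδ0 (Real.log_pos ht), ?_⟩
      rw [mul_div_cancel_left₀ _ hδ0.ne', Real.exp_log (by linarith)]
    · rintro ⟨u, hu, rfl⟩
      exact Real.one_lt_exp_iff.2 (div_pos hu hδ0)
  rw [himg, MeasureTheory.integral_image_eq_integral_abs_deriv_smul measurableSet_Ioi
    (f' := fun u => Real.exp (u / δ) * (1 / δ)), ← MeasureTheory.integral_const_mul]
  · refine MeasureTheory.setIntegral_congr_fun measurableSet_Ioi fun u _ => ?_
    have hpow : ((Real.exp (u / δ) : ℝ) : ℂ) ^ (-((δ : ℂ) + 1))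
        = ((Real.exp (-u) * Real.exp (-(u / δ)) : ℝ) : ℂ) := by
      rw [show -((δ : ℂ) + 1) = ((-(δ + 1) : ℝ) : ℂ) by push_cast; ring,
        ← Complex.ofReal_cpow (Real.exp_pos _).le, ← Real.exp_mul, ← Real.exp_add]
      congr 2
      field_simp
      ring
    have hne : (Real.exp (u / δ) : ℂ) ≠ 0 := by exact_mod_cast (Real.exp_pos _).ne'
    have hδc : (δ : ℂ) ≠ 0 := by exact_mod_cast hδ0.ne'
    simp only [hpow]
    rw [abs_of_pos (by positivity), Complex.real_smul, Real.exp_neg (u / δ)]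
    push_cast
    push_cast at hne
    field_simp
  · intro u _
    exact ((hasDerivAt_id u).div_const δ).exp.hasDerivWithinAt
  · intro a _ b _ hab
    simpa [div_left_inj' hδ0.ne'] using hab

/-- If the partial sums of `f` are `κ log log n + c + o(1)`, then its Dirichlet series is
`-κ log δ + c - κ γ + o(1)` as `δ → 0⁺`. -/
theorem tendsto_LSeries_add_log {f : ℕ → ℂ} {κ : ℝ} {c : ℂ}
    (hS : ∀ δ : ℝ, 0 < δ → LSeriesSummable f δ)
    (h : Tendsto (fun n : ℕ => ∑ k ∈ Icc 1 n, f k - (κ * Real.log (Real.log n) : ℝ)) atTop (𝓝 c)) :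
    Tendsto (fun δ : ℝ => LSeries f δ + (κ * Real.log δ : ℝ)) (𝓝[>] 0)
      (𝓝 (c - (κ * Real.eulerMascheroniConstant : ℝ))) := by
  set F : ℕ → ℂ := fun n => ∑ k ∈ Icc 1 n, f k with hF
  have hexp : Tendsto (fun v : ℝ => F ⌊Real.exp v⌋₊ - (κ * Real.log v : ℝ)) atTop (𝓝 c) := by
    have h1 := h.comp (tendsto_nat_floor_atTop.comp Real.tendsto_exp_atTop)
    have h2 := (tendsto_log_log_natFloor_sub.comp Real.tendsto_exp_atTop).const_mul κ
    have h3 := h1.add ((Complex.continuous_ofReal.tendsto _).comp h2)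
    simp only [mul_zero, Complex.ofReal_zero, add_zero] at h3
    refine h3.congr fun v => ?_
    simp only [Function.comp_apply, Real.log_exp]
    push_cast
    ring
  have hO : ∀ r : ℝ, 0 < r → (fun n ↦ ∑ k ∈ Icc 1 n, f k) =O[atTop] fun n ↦ (n : ℝ) ^ r := by
    intro r hr
    have h1 : (fun n : ℕ => F n - (κ * Real.log (Real.log n) : ℝ)) =O[atTop]
        fun n => (n : ℝ) ^ r := by
      refine (h.isBigO_one ℝ).trans (Asymptotics.IsBigO.of_bound 1 ?_)
      filter_upwards [eventually_ge_atTop 1] with n hn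
      have : (1 : ℝ) ≤ (n : ℝ) ^ r := Real.one_le_rpow (by exact_mod_cast hn) hr.le
      simpa using this.trans (le_abs_self _)
    have h2 : (fun n : ℕ => ((κ * Real.log (Real.log n) : ℝ) : ℂ)) =O[atTop]
        fun n => (n : ℝ) ^ r := by
      have h3 : (fun x : ℝ => Real.log (Real.log x)) =o[atTop] Real.log :=
        Real.isLittleO_log_id_atTop.comp_tendsto Real.tendsto_log_atTop
      have h4 := (h3.isBigO.trans (isLittleO_log_rpow_atTop hr).isBigO).const_mul_left κ
      have h5 := h4.comp_tendsto tendsto_natCast_atTop_atTop (α := ℝ)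
      refine Asymptotics.IsBigO.trans (Asymptotics.IsBigO.of_bound 1 ?_) h5
      exact Eventually.of_forall fun n => by
        rw [Complex.norm_real, one_mul]
        rfl
    simpa using h1.add h2
  obtain ⟨V, hV0, C₁, hC₁⟩ : ∃ V : ℝ, 0 < V ∧ ∃ C₁ : ℝ, ∀ v, V ≤ v →
      ‖F ⌊Real.exp v⌋₊ - (κ * Real.log v : ℝ)‖ ≤ C₁ := by
    obtain ⟨C, hC⟩ := (hexp.isBigO_one ℝ).bound
    obtain ⟨V, hV⟩ := eventually_atTop.1 hC
    exact ⟨max V 1, by positivity, C, fun v hv => by simpa using hV v ((le_max_left _ _).trans hv)⟩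
  have hC₁0 : 0 ≤ C₁ := (norm_nonneg _).trans (hC₁ V le_rfl)
  set C₂ : ℝ := ∑ k ∈ Icc 1 ⌊Real.exp V⌋₊, ‖f k‖ with hC₂
  have hC₂0 : 0 ≤ C₂ := sum_nonneg fun _ _ => norm_nonneg _
  set C : ℝ := C₁ + C₂ + |κ| * |Real.log V| with hC
  have hbound : ∀ δ : ℝ, 0 < δ → δ < 1 → ∀ u : ℝ, 0 < u →
      ‖F ⌊Real.exp (u / δ)⌋₊ + (κ * Real.log δ : ℝ)‖ ≤ C + |κ| * |Real.log u| := by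
    intro δ hδ hδ1 u hu
    have hlog : Real.log (u / δ) = Real.log u - Real.log δ := Real.log_div hu.ne' hδ.ne'
    have hκV : 0 ≤ |κ| * |Real.log V| := by positivity
    rcases le_or_gt V (u / δ) with hv | hv
    · have e : F ⌊Real.exp (u / δ)⌋₊ + (κ * Real.log δ : ℝ)
          = (F ⌊Real.exp (u / δ)⌋₊ - (κ * Real.log (u / δ) : ℝ)) + (κ * Real.log u : ℝ) := by
        rw [hlog]; push_cast; ring
      rw [e]
      refine (norm_add_le _ _).trans ?_
      have h1 := hC₁ _ hv
      have h2 : ‖((κ * Real.log u : ℝ) : ℂ)‖ = |κ| * |Real.log u| := by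
        rw [Complex.norm_real, Real.norm_eq_abs, abs_mul]
      rw [h2]
      linarith
    · have h1 : ‖F ⌊Real.exp (u / δ)⌋₊‖ ≤ C₂ := by
        refine (norm_sum_le _ _).trans (sum_le_sum_of_subset_of_nonneg ?_ fun _ _ _ => norm_nonneg _)
        exact Icc_subset_Icc le_rfl (Nat.floor_mono (Real.exp_le_exp.2 hv.le))
      have h2 : |Real.log δ| ≤ |Real.log u| + |Real.log V| := by
        have h3 : Real.log δ < 0 := Real.log_neg hδ hδ1
        have h4 : Real.log (u / δ) ≤ Real.log V := Real.log_le_log (by positivity) hv.le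
        rw [abs_of_neg h3]
        linarith [neg_abs_le (Real.log u), le_abs_self (Real.log V)]
      have h3 : ‖((κ * Real.log δ : ℝ) : ℂ)‖ = |κ| * |Real.log δ| := by
        rw [Complex.norm_real, Real.norm_eq_abs, abs_mul]
      refine (norm_add_le _ _).trans ?_
      rw [h3]
      nlinarith [abs_nonneg κ]
  have hexpint : MeasureTheory.IntegrableOn (fun u : ℝ => Real.exp (-u)) (Set.Ioi 0) :=
    integrableOn_exp_neg_Ioi 0
  have hdom : MeasureTheory.IntegrableOn
      (fun u : ℝ => (C + |κ| * |Real.log u|) * Real.exp (-u)) (Set.Ioi 0) := by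
    have h1 := (hexpint.const_mul C).add (integrableOn_log_mul_exp_neg.norm.const_mul |κ|)
    refine h1.congr (Eventually.of_forall fun u => ?_)
    simp only [Pi.add_apply, Real.norm_eq_abs, abs_mul, abs_of_pos (Real.exp_pos (-u))]
    ring
  have hmeas : ∀ δ : ℝ, MeasureTheory.AEStronglyMeasurable
      (fun u : ℝ => (F ⌊Real.exp (u / δ)⌋₊ + (κ * Real.log δ : ℝ)) * (Real.exp (-u) : ℂ))
      (MeasureTheory.volume.restrict (Set.Ioi 0)) := by
    intro δ
    have h1 : Measurable fun u : ℝ => F ⌊Real.exp (u / δ)⌋₊ :=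
      (measurable_from_nat (f := F)).comp (Nat.measurable_floor.comp (by fun_prop))
    exact ((h1.add_const _).mul (by fun_prop)).aestronglyMeasurable
  have hnorm : ∀ δ : ℝ, 0 < δ → δ < 1 → ∀ u : ℝ, 0 < u →
      ‖(F ⌊Real.exp (u / δ)⌋₊ + (κ * Real.log δ : ℝ)) * (Real.exp (-u) : ℂ)‖
        ≤ (C + |κ| * |Real.log u|) * Real.exp (-u) := by
    intro δ hδ hδ1 u hu
    rw [norm_mul, Complex.norm_real, Real.norm_eq_abs, abs_of_pos (Real.exp_pos _)]
    exact mul_le_mul_of_nonneg_right (hbound δ hδ hδ1 u hu) (Real.exp_pos _).le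
  have hsmall : ∀ᶠ δ : ℝ in 𝓝[>] 0, 0 < δ ∧ δ < 1 := Ioo_mem_nhdsGT one_pos
  have hrepr : ∀ δ : ℝ, 0 < δ ∧ δ < 1 → LSeries f δ + (κ * Real.log δ : ℝ)
      = ∫ u in Set.Ioi (0 : ℝ),
        (F ⌊Real.exp (u / δ)⌋₊ + (κ * Real.log δ : ℝ)) * (Real.exp (-u) : ℂ) := by
    rintro δ ⟨hδ, hδ1⟩
    have h1 : MeasureTheory.IntegrableOn (fun u : ℝ =>
        (F ⌊Real.exp (u / δ)⌋₊ + (κ * Real.log δ : ℝ)) * (Real.exp (-u) : ℂ)) (Set.Ioi 0) := by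
      refine hdom.mono' (hmeas δ) ?_
      filter_upwards [MeasureTheory.ae_restrict_mem measurableSet_Ioi] with u hu
        using hnorm δ hδ hδ1 u hu
    have h2 : MeasureTheory.IntegrableOn (fun u : ℝ =>
        ((κ * Real.log δ : ℝ) : ℂ) * ((Real.exp (-u) : ℝ) : ℂ)) (Set.Ioi 0) :=
      hexpint.ofReal.const_mul _
    have h3 : ∫ u in Set.Ioi (0 : ℝ), ((κ * Real.log δ : ℝ) : ℂ) * ((Real.exp (-u) : ℝ) : ℂ)
        = (κ * Real.log δ : ℝ) := by
      rw [MeasureTheory.integral_const_mul, integral_complex_ofReal, integral_exp_neg_Ioi_zero]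
      simp
    have h4 := MeasureTheory.integral_sub h1 h2
    rw [h3] at h4
    rw [LSeries_eq_integral_exp (r := δ / 2) (by positivity) (by linarith) (hS δ hδ)
      (hO _ (by positivity)), ← eq_sub_iff_add_eq, ← h4]
    refine MeasureTheory.integral_congr_ae (Eventually.of_forall fun u => ?_)
    simp only [hF]
    ring
  have hlim : c - (κ * Real.eulerMascheroniConstant : ℝ)
      = ∫ u in Set.Ioi (0 : ℝ), (c + (κ * Real.log u : ℝ)) * (Real.exp (-u) : ℂ) := by
    have h1 : ∀ u : ℝ, (c + (κ * Real.log u : ℝ)) * (Real.exp (-u) : ℂ)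
        = c * (Real.exp (-u) : ℝ) + (κ : ℂ) * ((Real.log u * Real.exp (-u) : ℝ) : ℂ) := by
      intro u; push_cast; ring
    simp_rw [h1]
    rw [MeasureTheory.integral_add (hexpint.ofReal.const_mul _)
      (integrableOn_log_mul_exp_neg.ofReal.const_mul _), MeasureTheory.integral_const_mul,
      MeasureTheory.integral_const_mul, integral_complex_ofReal, integral_complex_ofReal,
      integral_log_mul_exp_neg, integral_exp_neg_Ioi_zero]
    push_cast
    ring
  rw [hlim]
  refine Tendsto.congr' (hsmall.mono fun δ hδ => (hrepr δ hδ).symm) ?_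
  refine MeasureTheory.tendsto_integral_filter_of_dominated_convergence _
    (Eventually.of_forall hmeas) ?_ hdom ?_
  · filter_upwards [hsmall] with δ hδ
    filter_upwards [MeasureTheory.ae_restrict_mem measurableSet_Ioi] with u hu
      using hnorm δ hδ.1 hδ.2 u hu
  · filter_upwards [MeasureTheory.ae_restrict_mem measurableSet_Ioi] with u hu
    have hu' : 0 < u := hu
    refine Tendsto.mul_const _ ?_
    have h1 : Tendsto (fun δ : ℝ => u / δ) (𝓝[>] 0) atTop := by
      simpa [div_eq_mul_inv] using tendsto_inv_nhdsGT_zero.const_mul_atTop hu'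
    refine ((hexp.comp h1).add_const ((κ * Real.log u : ℝ) : ℂ)).congr' ?_
    filter_upwards [self_mem_nhdsWithin] with δ hδ
    have hδ' : (0 : ℝ) < δ := hδ
    simp only [Function.comp_apply, Real.log_div hu'.ne' hδ'.ne']
    push_cast
    ring

/-- `∑ ((log n - log (n - 1)) / log n - (log log n - log log (n - 1)))` converges. -/
theorem summable_log_log_error :
    Summable fun i : ℕ => (Real.log ((i + 3 : ℕ) : ℝ) - Real.log ((i + 2 : ℕ) : ℝ)) /
        Real.log ((i + 3 : ℕ) : ℝ) -
      (Real.log (Real.log ((i + 3 : ℕ) : ℝ)) - Real.log (Real.log ((i + 2 : ℕ) : ℝ))) := by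
  have hsum : Summable fun i : ℕ => 2 * (1 / (((i + 2 : ℕ) : ℝ) ^ 2)) :=
    ((summable_nat_add_iff 2).2 (Real.summable_one_div_nat_pow.2 one_lt_two)).mul_left 2
  refine Summable.of_norm_bounded hsum fun i => ?_
  set x : ℝ := ((i + 2 : ℕ) : ℝ) with hx
  have hx2 : (2 : ℝ) ≤ x := by rw [hx]; exact_mod_cast Nat.le_add_left 2 i
  have hx3 : ((i + 3 : ℕ) : ℝ) = x + 1 := by rw [hx]; push_cast; ring
  rw [hx3]
  have h1 : 1 ≤ Real.log (x + 1) := by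
    rw [Real.le_log_iff_exp_le (by linarith)]
    linarith [Real.exp_one_lt_d9]
  have h2 : 0 < Real.log x := Real.log_pos (by linarith)
  have h3 : Real.log (x + 1) - Real.log x ≤ 1 / x := by
    rw [← Real.log_div (by linarith) (by linarith)]
    refine (Real.log_le_sub_one_of_pos (by positivity)).trans (le_of_eq ?_)
    field_simp
    ring
  have h4 : Real.log (x + 1) ≤ 2 * Real.log x := by
    rw [← Real.log_rpow (by linarith)]
    refine Real.log_le_log (by linarith) ?_
    norm_cast
    nlinarith
  have h5 : Real.log x ≤ Real.log (x + 1) := Real.log_le_log (by linarith) (by linarith)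
  set r : ℝ := Real.log x / Real.log (x + 1) with hr
  have hr0 : 0 < r := by positivity
  have hlogr : Real.log r = Real.log (Real.log x) - Real.log (Real.log (x + 1)) :=
    Real.log_div h2.ne' (by linarith)
  have e : (Real.log (x + 1) - Real.log x) / Real.log (x + 1) = 1 - r := by
    rw [hr]; field_simp
  have hr1 : 1 - r ≤ 1 / x := by
    rw [← e]
    exact (div_le_self (by linarith) h1).trans h3
  have hr2 : 0 ≤ 1 - r := by rw [← e]; exact div_nonneg (by linarith) (by linarith)
  have hr3 : 1 / 2 ≤ r := by rw [hr, le_div_iff₀ (by linarith)]; linarith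
  have h6 := Real.log_le_sub_one_of_pos hr0
  have h7 := Real.one_sub_inv_le_log_of_pos hr0
  have h9 : (1 - r) ^ 2 / r ≤ 2 * (1 / x ^ 2) := by
    have : (1 - r) ^ 2 ≤ 1 / x ^ 2 := by
      rw [← one_div_pow]; exact pow_le_pow_left₀ hr2 hr1 2
    rw [div_le_iff₀ hr0]
    nlinarith [show 0 < 1 / x ^ 2 by positivity]
  have h10 : (1 - r) ^ 2 / r = r⁻¹ - 1 - (1 - r) := by
    field_simp
  rw [e, Real.norm_eq_abs, abs_le]
  constructor <;> nlinarith [show 0 < 1 / x ^ 2 by positivity]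

/-- If `∑_{n ≤ N} a n = κ log N + O(1)`, then `∑_{n ≤ N} a n / log n = κ log log N + c + o(1)`
for some `c`. -/
theorem exists_tendsto_sum_div_log_sub {a : ℕ → ℝ} {κ C : ℝ}
    (h : ∀ N : ℕ, 1 ≤ N → |∑ n ∈ Icc 1 N, a n - κ * Real.log N| ≤ C) :
    ∃ c : ℝ, Tendsto (fun N : ℕ => ∑ n ∈ Icc 1 N, a n / Real.log n - κ * Real.log (Real.log N))
      atTop (𝓝 c) := by
  set z : ℕ → ℝ := fun i =>
    a (i + 2) - κ * (Real.log ((i + 2 : ℕ) : ℝ) - Real.log ((i + 1 : ℕ) : ℝ)) with hz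
  set w : ℕ → ℝ := fun i => 1 / Real.log ((i + 2 : ℕ) : ℝ) with hw
  have hlogpos : ∀ i : ℕ, 0 < Real.log ((i + 2 : ℕ) : ℝ) := fun i =>
    Real.log_pos (by exact_mod_cast Nat.lt_of_lt_of_le one_lt_two (Nat.le_add_left 2 i))
  have hzsum : ∀ m : ℕ, ∑ i ∈ range m, z i
      = (∑ n ∈ Icc 1 (m + 1), a n - κ * Real.log ((m + 1 : ℕ) : ℝ)) - a 1 := by
    intro m
    induction m with
    | zero => simp
    | succ m ih =>
      rw [sum_range_succ, ih, sum_Icc_succ_top (show 1 ≤ m + 1 + 1 by omega)]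
      simp only [hz]
      ring
  have hzb : ∀ m : ℕ, ‖∑ i ∈ range m, z i‖ ≤ C + |a 1| := by
    intro m
    rw [hzsum, Real.norm_eq_abs]
    exact (abs_sub _ _).trans (by linarith [h (m + 1) (by omega)])
  have hanti : Antitone w := by
    intro i j hij
    refine one_div_le_one_div_of_le (hlogpos i) (Real.log_le_log (by positivity) ?_)
    exact_mod_cast Nat.add_le_add_right hij 2
  have hw0 : Tendsto w atTop (𝓝 0) := by
    refine Tendsto.div_atTop tendsto_const_nhds (Real.tendsto_log_atTop.comp ?_)
    exact tendsto_natCast_atTop_atTop.comp (tendsto_add_atTop_nat 2)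
  obtain ⟨l, hl⟩ := cauchySeq_tendsto_of_complete
    (hanti.cauchySeq_series_mul_of_tendsto_zero_of_bounded hw0 hzb)
  set t : ℕ → ℝ := fun i => (Real.log ((i + 3 : ℕ) : ℝ) - Real.log ((i + 2 : ℕ) : ℝ)) /
        Real.log ((i + 3 : ℕ) : ℝ) -
      (Real.log (Real.log ((i + 3 : ℕ) : ℝ)) - Real.log (Real.log ((i + 2 : ℕ) : ℝ))) with ht'
  have ht : Tendsto (fun m => ∑ i ∈ range m, t i) atTop (𝓝 (∑' i, t i)) :=
    summable_log_log_error.hasSum.tendsto_sum_nat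
  refine ⟨_, (tendsto_add_atTop_iff_nat 2).1 (Tendsto.congr ?_
    ((hl.comp (tendsto_add_atTop_nat 1)).add
      ((ht.const_add (1 - Real.log (Real.log 2))).const_mul κ)))⟩
  intro m
  simp only [Function.comp_apply, smul_eq_mul]
  induction m with
  | zero =>
    have := hlogpos 0
    rw [show Icc 1 (0 + 2) = {1, 2} by rfl]
    norm_num [hz, hw] at this ⊢
    field_simp
    ring
  | succ m ih =>
    have hstep : w (m + 1) * z (m + 1) + κ * t m = a (m + 3) / Real.log ((m + 3 : ℕ) : ℝ)
        - κ * (Real.log (Real.log ((m + 3 : ℕ) : ℝ)) - Real.log (Real.log ((m + 2 : ℕ) : ℝ))) := by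
      have := (hlogpos (m + 1)).ne'
      simp only [hz, hw, ht', show m + 1 + 2 = m + 3 by ring, show m + 1 + 1 = m + 2 by ring]
        at this ⊢
      field_simp
      ring
    rw [sum_range_succ _ (m + 1), sum_range_succ t, show m + 1 + 2 = (m + 2) + 1 by ring,
      sum_Icc_succ_top (show 1 ≤ m + 2 + 1 by omega)]
    linear_combination ih + hstep

section CharacterSums

variable {q : ℕ} [NeZero q] {χ : DirichletCharacter ℂ q}

/-- A sum over `range q` of a function of the residue is a sum over `ZMod q`. -/
theorem sum_range_natCast_zmod {M : Type*} [AddCommMonoid M] (g : ZMod q → M) :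
    ∑ j ∈ range q, g j = ∑ a : ZMod q, g a := by
  refine sum_bij (fun j _ => (j : ZMod q)) (fun _ _ => mem_univ _) ?_ ?_ (fun _ _ => rfl)
  · intro i hi j hj hij
    rw [mem_range] at hi hj
    have := congrArg ZMod.val hij
    rwa [ZMod.val_cast_of_lt hi, ZMod.val_cast_of_lt hj] at this
  · intro a _
    exact ⟨a.val, mem_range.2 (ZMod.val_lt a), ZMod.natCast_zmod_val a⟩

theorem sum_Icc_one_eq_sum_range {M : Type*} [AddCommMonoid M] (g : ℕ → M) (N : ℕ) :
    ∑ n ∈ Icc 1 N, g n = ∑ i ∈ range N, g (i + 1) := by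
  induction N with
  | zero => simp
  | succ N ih => rw [sum_Icc_succ_top (by omega), ih, sum_range_succ]

/-- The partial sums of a nontrivial Dirichlet character are bounded by its modulus. -/
theorem norm_sum_Icc_character_le (hχ : χ ≠ 1) (N : ℕ) : ‖∑ n ∈ Icc 1 N, χ n‖ ≤ q := by
  rw [sum_Icc_one_eq_sum_range]
  induction N using Nat.strong_induction_on with
  | _ N ih =>
    rcases lt_or_ge N q with h | h
    · refine (norm_sum_le_of_le _ fun i _ => χ.norm_le_one _).trans ?_
      simpa using h.le
    · obtain ⟨m, rfl⟩ := Nat.exists_eq_add_of_le' h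
      have hq : 0 < q := Nat.pos_of_ne_zero (NeZero.ne q)
      have hperiod : ∑ j ∈ range q, χ ((m + j + 1 : ℕ) : ZMod q) = 0 := by
        have h1 := sum_range_natCast_zmod (fun a : ZMod q => χ ((m + 1 : ZMod q) + a))
        have h2 : ∑ a : ZMod q, χ ((m + 1 : ZMod q) + a) = ∑ a, χ a :=
          Equiv.sum_comp (Equiv.addLeft (m + 1 : ZMod q)) (fun a => χ a)
        rw [← MulChar.sum_eq_zero_of_ne_one hχ, ← h2, ← h1]
        refine sum_congr rfl fun j _ => ?_
        congr 1
        push_cast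
        ring
      rw [sum_range_add, hperiod, add_zero]
      exact ih m (by omega)

/-- The series `∑ χ(k)/k` converges, with error `O(1/M)`. -/
theorem exists_norm_sum_character_div_sub_le (hχ : χ ≠ 1) :
    ∃ L : ℂ, ∀ M : ℕ, ‖∑ k ∈ Icc 1 M, χ k / k - L‖ ≤ 2 * q / (M + 1) := by
  set S : ℕ → ℂ := fun N => ∑ n ∈ Icc 1 N, χ n with hS
  set T : ℕ → ℂ := fun N => ∑ k ∈ Icc 1 N, χ k / k - S N / (N + 1) with hT
  have hSb : ∀ N, ‖S N‖ ≤ q := norm_sum_Icc_character_le hχ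
  have hstep : ∀ N : ℕ, ‖T (N + 1) - T N‖ ≤ q * (1 / (N + 1 : ℝ) - 1 / (N + 2 : ℝ)) := by
    intro N
    have hne1 : (N : ℂ) + 1 ≠ 0 := by exact_mod_cast Nat.succ_ne_zero N
    have hne2 : (N : ℂ) + 1 + 1 ≠ 0 := by exact_mod_cast Nat.succ_ne_zero (N + 1)
    have hSN : S (N + 1) = S N + χ ((N + 1 : ℕ) : ZMod q) := by
      simp only [hS]
      rw [sum_Icc_succ_top (by omega)]
    have e : T (N + 1) - T N = S (N + 1) * ((1 / (N + 1 : ℝ) - 1 / (N + 2 : ℝ) : ℝ) : ℂ) := by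
      simp only [hT]
      rw [sum_Icc_succ_top (by omega), hSN, show (N : ℝ) + 2 = N + 1 + 1 by ring]
      push_cast
      field_simp
      ring
    have hnn : (0 : ℝ) ≤ 1 / (N + 1 : ℝ) - 1 / (N + 2 : ℝ) :=
      sub_nonneg.2 (one_div_le_one_div_of_le (by positivity) (by linarith))
    rw [e, norm_mul, Complex.norm_real, Real.norm_eq_abs, abs_of_nonneg hnn]
    exact mul_le_mul_of_nonneg_right (hSb _) hnn
  have hdiff : ∀ M k : ℕ, ‖T (M + k) - T M‖ ≤ q * (1 / (M + 1 : ℝ) - 1 / (M + k + 1 : ℝ)) := by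
    intro M k
    induction k with
    | zero => simp
    | succ k ih =>
      have h1 := hstep (M + k)
      have h2 := norm_add_le (T (M + k + 1) - T (M + k)) (T (M + k) - T M)
      rw [sub_add_sub_cancel] at h2
      push_cast at h1 ⊢
      rw [show (M : ℝ) + (k + 1) + 1 = M + k + 2 by ring, ← add_assoc]
      nlinarith
  have hdiff' : ∀ M N : ℕ, M ≤ N → ‖T N - T M‖ ≤ q / (M + 1 : ℝ) := by
    intro M N hMN
    obtain ⟨k, rfl⟩ := Nat.exists_eq_add_of_le hMN
    refine (hdiff M k).trans ?_
    rw [div_eq_mul_one_div (q : ℝ)]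
    have : (0 : ℝ) ≤ 1 / (M + k + 1 : ℝ) := by positivity
    exact mul_le_mul_of_nonneg_left (by linarith) (by positivity)
  have hcauchy : CauchySeq T := by
    refine cauchySeq_of_le_tendsto_0' (fun M : ℕ => (q : ℝ) / (M + 1 : ℝ)) ?_ ?_
    · intro M N hMN
      rw [dist_comm, dist_eq_norm]
      exact hdiff' M N hMN
    · exact (tendsto_const_div_atTop_nhds_zero_nat (q : ℝ)).comp (tendsto_add_atTop_nat 1)
        |>.congr fun n => by simp
  obtain ⟨L, hL⟩ := cauchySeq_tendsto_of_complete hcauchy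
  refine ⟨L, fun M => ?_⟩
  have h1 : ‖L - T M‖ ≤ q / (M + 1 : ℝ) :=
    le_of_tendsto (hL.sub_const _).norm (eventually_atTop.2 ⟨M, fun N hN => hdiff' M N hN⟩)
  have h2 : ‖S M / (M + 1)‖ ≤ q / (M + 1 : ℝ) := by
    have : ‖(M : ℂ) + 1‖ = M + 1 := by
      exact_mod_cast Complex.norm_natCast (M + 1)
    rw [norm_div, this]
    exact div_le_div_of_nonneg_right (hSb M) (by positivity)
  have e : ∑ k ∈ Icc 1 M, χ k / k - L = S M / (M + 1) - (L - T M) := by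
    simp only [hT]
    ring
  rw [e]
  refine (norm_sub_le _ _).trans ?_
  rw [two_mul, add_div]
  exact add_le_add h2 h1

/-- The partial sums of `∑ χ(k)/k` approximate `L(1, χ)` with error `O(1/M)`. -/
theorem norm_sum_character_div_sub_LFunction_le (hχ : χ ≠ 1) (M : ℕ) :
    ‖∑ k ∈ Icc 1 M, χ k / k - χ.LFunction 1‖ ≤ 2 * q / (M + 1) := by
  obtain ⟨L, hL⟩ := exists_norm_sum_character_div_sub_le hχ
  have hterm : ∀ (δ : ℝ), LSeries.term (fun k : ℕ => χ k / (k : ℂ)) δ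
      = LSeries.term (fun k : ℕ => χ k) (1 + δ : ℝ) := by
    intro δ
    ext n
    rcases eq_or_ne n 0 with rfl | hn
    · simp
    · have hn' : (n : ℂ) ≠ 0 := by exact_mod_cast hn
      rw [LSeries.term_of_ne_zero hn, LSeries.term_of_ne_zero hn]
      push_cast
      rw [Complex.cpow_add _ _ hn', Complex.cpow_one, div_div]
  have hlim : Tendsto (fun M : ℕ => ∑ k ∈ Icc 1 M, χ k / (k : ℂ)) atTop (𝓝 L) := by
    rw [tendsto_iff_norm_sub_tendsto_zero]
    refine squeeze_zero (fun _ => norm_nonneg _) hL ?_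
    exact (tendsto_const_div_atTop_nhds_zero_nat (2 * q : ℝ)).comp (tendsto_add_atTop_nat 1)
      |>.congr fun n => by simp
  have h1 : Tendsto (fun δ : ℝ => LSeries (fun k : ℕ => χ k / (k : ℂ)) δ) (𝓝[>] 0) (𝓝 L) := by
    have h := tendsto_LSeries_add_log (f := fun k : ℕ => χ k / (k : ℂ)) (κ := 0) (c := L) ?_ ?_
    · simpa using h
    · intro δ hδ
      rw [LSeriesSummable, hterm]
      exact DirichletCharacter.LSeriesSummable_of_one_lt_re χ (by simpa using hδ)
    · simpa using hlim
  have h2 : Tendsto (fun δ : ℝ => LSeries (fun k : ℕ => χ k / (k : ℂ)) δ) (𝓝[>] 0)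
      (𝓝 (χ.LFunction 1)) := by
    have hc : Continuous fun δ : ℝ => χ.LFunction ((1 + δ : ℝ) : ℂ) :=
      (DirichletCharacter.differentiable_LFunction hχ).continuous.comp (by fun_prop)
    have h3 := (hc.tendsto 0).mono_left (nhdsWithin_le_nhds (s := Set.Ioi (0 : ℝ)))
    simp only [add_zero, Complex.ofReal_one] at h3
    refine h3.congr' ?_
    filter_upwards [self_mem_nhdsWithin] with δ hδ
    have hδ' : (0 : ℝ) < δ := hδ
    rw [DirichletCharacter.LFunction_eq_LSeries χ (by simpa using hδ'), LSeries, LSeries, hterm]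
  rw [tendsto_nhds_unique h2 h1]
  exact hL M

/-- The partial sums of `∑ χ(n) log n / n` are bounded. -/
theorem exists_norm_sum_character_mul_log_div_le (hχ : χ ≠ 1) :
    ∃ C : ℝ, ∀ N : ℕ, ‖∑ n ∈ Icc 1 N, χ n * Real.log n / n‖ ≤ C := by
  set w : ℕ → ℝ := fun i => Real.log ((i + 3 : ℕ) : ℝ) / ((i + 3 : ℕ) : ℝ) with hw
  have hanti : Antitone w := by
    intro i j hij
    have h3 : ∀ k : ℕ, ((k + 3 : ℕ) : ℝ) ∈ {x : ℝ | Real.exp 1 ≤ x} := by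
      intro k
      have : (3 : ℝ) ≤ ((k + 3 : ℕ) : ℝ) := by exact_mod_cast Nat.le_add_left 3 k
      exact Real.exp_one_lt_d9.le.trans (by linarith)
    exact Real.log_div_self_antitoneOn (h3 i) (h3 j) (by exact_mod_cast Nat.add_le_add_right hij 3)
  have hw0 : Tendsto w atTop (𝓝 0) :=
    (Real.isLittleO_log_id_atTop.tendsto_div_nhds_zero).comp
      (tendsto_natCast_atTop_atTop.comp (tendsto_add_atTop_nat 3))
  have hsum : ∀ m : ℕ, ∑ i ∈ range m, χ ((i + 3 : ℕ) : ZMod q)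
      = ∑ n ∈ Icc 1 (m + 2), χ n - ∑ n ∈ Icc (1 : ℕ) 2, χ n := by
    intro m
    induction m with
    | zero => simp
    | succ m ih =>
      rw [sum_range_succ, ih, show m + 1 + 2 = m + 2 + 1 by ring,
        sum_Icc_succ_top (b := m + 2) (by omega)]
      ring
  have hzb : ∀ m : ℕ, ‖∑ i ∈ range m, χ ((i + 3 : ℕ) : ZMod q)‖ ≤ q + q := by
    intro m
    rw [hsum]
    exact (norm_sub_le _ _).trans
      (add_le_add (norm_sum_Icc_character_le hχ _) (norm_sum_Icc_character_le hχ _))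
  obtain ⟨l, hl⟩ := cauchySeq_tendsto_of_complete
    (hanti.cauchySeq_series_mul_of_tendsto_zero_of_bounded hw0 hzb)
  have hlim : Tendsto (fun N : ℕ => ∑ n ∈ Icc 1 N, χ n * Real.log n / n) atTop
      (𝓝 (∑ n ∈ Icc (1 : ℕ) 2, χ n * Real.log n / n + l)) := by
    refine (tendsto_add_atTop_iff_nat 2).1 ((hl.const_add _).congr fun m => ?_)
    induction m with
    | zero => simp
    | succ m ih =>
      rw [sum_range_succ, show m + 1 + 2 = m + 2 + 1 by ring,
        sum_Icc_succ_top (b := m + 2) (by omega), ← ih, ← add_assoc]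
      simp only [hw, Complex.real_smul]
      push_cast
      ring_nf
  obtain ⟨C, hC⟩ := hlim.norm.bddAbove_range
  exact ⟨C, fun N => hC ⟨N, rfl⟩⟩

theorem Icc_one_eq_Ioc_zero (N : ℕ) : Icc 1 N = Ioc 0 N := by
  ext n
  simp [Nat.succ_le_iff]

/-- **Mertens' estimate for characters**: the partial sums of `∑ χ(n) Λ(n) / n` are bounded. -/
theorem exists_norm_sum_character_mul_vonMangoldt_div_le (hχ : χ ≠ 1) :
    ∃ C : ℝ, ∀ N : ℕ, ‖∑ n ∈ Icc 1 N, χ n * ArithmeticFunction.vonMangoldt n / n‖ ≤ C := by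
  obtain ⟨C, hC⟩ := exists_norm_sum_character_mul_log_div_le hχ
  set L := χ.LFunction 1 with hL
  have hL0 : 0 < ‖L‖ := norm_pos_iff.2 (DirichletCharacter.LFunction_apply_one_ne_zero hχ)
  let F : ArithmeticFunction ℂ :=
    ⟨fun n => χ n * ArithmeticFunction.vonMangoldt n / n, by simp⟩
  let G : ArithmeticFunction ℂ := ⟨fun n => χ n / n, by simp⟩
  have hFG : ∀ n : ℕ, (F * G) n = χ n * Real.log n / n := by
    intro n
    rw [ArithmeticFunction.mul_apply, ← ArithmeticFunction.vonMangoldt_sum,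
      Nat.sum_divisorsAntidiagonal (f := fun a b => F a * G b)]
    push_cast
    rw [mul_sum, sum_div]
    refine sum_congr rfl fun d hd => ?_
    have hdn := Nat.dvd_of_mem_divisors hd
    have h1 : (d : ℂ) * ((n / d : ℕ) : ℂ) = n := by exact_mod_cast Nat.mul_div_cancel' hdn
    have h2 : χ d * χ ((n / d : ℕ) : ZMod q) = χ n := by
      rw [← map_mul]
      exact_mod_cast congrArg (fun k : ℕ => χ (k : ZMod q)) (Nat.mul_div_cancel' hdn)
    change χ d * ArithmeticFunction.vonMangoldt d / d * (χ ((n / d : ℕ) : ZMod q) / (n / d : ℕ)) = _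
    rw [← h2, ← h1, div_mul_div_comm]
    ring
  have hmain : ∀ N : ℕ, ∑ n ∈ Icc 1 N, χ n * Real.log n / n
      = ∑ n ∈ Icc 1 N, χ n * ArithmeticFunction.vonMangoldt n / n *
          ∑ k ∈ Icc 1 (N / n), χ k / k := by
    intro N
    have h := ArithmeticFunction.sum_Ioc_mul_eq_sum_sum F G N
    simp only [← Icc_one_eq_Ioc_zero, hFG] at h
    exact h
  have hC0 : 0 ≤ C := (norm_nonneg _).trans (hC 0)
  refine ⟨(C + 2 * q * (Real.log 4 + 4)) / ‖L‖, fun N => ?_⟩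
  rw [le_div_iff₀ hL0, ← norm_mul, sum_mul]
  have e : ∑ n ∈ Icc 1 N, χ n * ArithmeticFunction.vonMangoldt n / n * L
      = ∑ n ∈ Icc 1 N, χ n * Real.log n / n
        - ∑ n ∈ Icc 1 N, χ n * ArithmeticFunction.vonMangoldt n / n *
          (∑ k ∈ Icc 1 (N / n), χ k / k - L) := by
    rw [hmain, ← sum_sub_distrib]
    exact sum_congr rfl fun n _ => by ring
  rw [e]
  refine (norm_sub_le _ _).trans (add_le_add (hC N) ?_)
  rcases Nat.eq_zero_or_pos N with rfl | hN
  · simp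
    positivity
  have hNpos : (0 : ℝ) < N := by exact_mod_cast hN
  have hterm : ∀ n ∈ Icc 1 N, ‖χ n * ArithmeticFunction.vonMangoldt n / n *
      (∑ k ∈ Icc 1 (N / n), χ k / k - L)‖ ≤ 2 * q / N * ArithmeticFunction.vonMangoldt n := by
    intro n hn
    have hn1 : 1 ≤ n := (mem_Icc.1 hn).1
    have hnpos : (0 : ℝ) < n := by exact_mod_cast hn1
    have hΛ : 0 ≤ ArithmeticFunction.vonMangoldt n := ArithmeticFunction.vonMangoldt_nonneg
    have h1 : ‖χ n * ArithmeticFunction.vonMangoldt n / n‖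
        ≤ ArithmeticFunction.vonMangoldt n / n := by
      rw [norm_div, norm_mul, Complex.norm_real, Complex.norm_natCast, Real.norm_eq_abs,
        abs_of_nonneg hΛ]
      refine div_le_div_of_nonneg_right ?_ hnpos.le
      exact mul_le_of_le_one_left hΛ (χ.norm_le_one _)
    have h2 : (N : ℝ) / n ≤ ((N / n : ℕ) : ℝ) + 1 := by
      rw [div_le_iff₀ hnpos]
      have := Nat.lt_div_mul_add hn1 (a := N)
      have h3 : N ≤ (N / n + 1) * n := by linarith
      exact_mod_cast h3
    have h3 : 2 * q / (((N / n : ℕ) : ℝ) + 1) ≤ 2 * q / ((N : ℝ) / n) :=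
      div_le_div_of_nonneg_left (by positivity) (by positivity) h2
    rw [norm_mul]
    calc _ ≤ ArithmeticFunction.vonMangoldt n / n * (2 * q / ((N : ℝ) / n)) :=
          mul_le_mul h1 ((norm_sum_character_div_sub_LFunction_le hχ _).trans h3)
            (norm_nonneg _) (by positivity)
      _ = _ := by field_simp
  refine (norm_sum_le_of_le _ hterm).trans ?_
  rw [← mul_sum]
  have hpsi := Chebyshev.psi_le_const_mul_self hNpos.le
  rw [Chebyshev.psi, Nat.floor_natCast, ← Icc_one_eq_Ioc_zero] at hpsi
  calc _ ≤ 2 * q / (N : ℝ) * ((Real.log 4 + 4) * N) :=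
        mul_le_mul_of_nonneg_left hpsi (by positivity)
    _ = _ := by field_simp

end CharacterSums

/-- **Mertens' first estimate** in the form `∑_{n ≤ N} Λ(n)/n = log N + O(1)`. -/
theorem exists_abs_sum_vonMangoldt_div_sub_log_le :
    ∃ C : ℝ, ∀ N : ℕ, 1 ≤ N →
      |∑ n ∈ Icc 1 N, ArithmeticFunction.vonMangoldt n / n - Real.log N| ≤ C := by
  refine ⟨Real.log 4 + 4 + 1, fun N hN => ?_⟩
  have hNpos : (0 : ℝ) < N := by exact_mod_cast hN
  have hfact : ∑ n ∈ Icc 1 N, ArithmeticFunction.vonMangoldt n * ((N / n : ℕ) : ℝ)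
      = Real.log (N.factorial : ℝ) := by
    have h := ArithmeticFunction.sum_Ioc_mul_zeta_eq_sum ArithmeticFunction.vonMangoldt N
    rw [ArithmeticFunction.vonMangoldt_mul_zeta, ← Icc_one_eq_Ioc_zero] at h
    rw [← h, sum_Icc_one_eq_sum_range, ← Finset.prod_range_add_one_eq_factorial, Nat.cast_prod,
      Real.log_prod fun n _ => Nat.cast_ne_zero.2 n.succ_ne_zero]
    rfl
  have hup : Real.log (N.factorial : ℝ) ≤ N * Real.log N := by
    rw [← Real.log_pow]
    exact Real.log_le_log (by positivity) (by exact_mod_cast Nat.factorial_le_pow N)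
  have hlow : N * Real.log N - N ≤ Real.log (N.factorial : ℝ) := by
    have h := Real.pow_div_factorial_le_exp (N : ℝ) hNpos.le N
    have h2 := Real.log_le_log (by positivity) h
    rw [Real.log_exp, Real.log_div (by positivity) (by positivity), Real.log_pow] at h2
    linarith
  have hpsi := Chebyshev.psi_le_const_mul_self hNpos.le
  rw [Chebyshev.psi, Nat.floor_natCast, ← Icc_one_eq_Ioc_zero] at hpsi
  have hS1 : ∑ n ∈ Icc 1 N, ArithmeticFunction.vonMangoldt n * ((N / n : ℕ) : ℝ)
      ≤ N * ∑ n ∈ Icc 1 N, ArithmeticFunction.vonMangoldt n / n := by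
    rw [mul_sum]
    refine sum_le_sum fun n _ => ?_
    have h1 : ((N / n : ℕ) : ℝ) ≤ (N : ℝ) / n := Nat.cast_div_le
    calc _ ≤ ArithmeticFunction.vonMangoldt n * ((N : ℝ) / n) :=
          mul_le_mul_of_nonneg_left h1 ArithmeticFunction.vonMangoldt_nonneg
      _ = _ := by ring
  have hS2 : N * ∑ n ∈ Icc 1 N, ArithmeticFunction.vonMangoldt n / n
      ≤ ∑ n ∈ Icc 1 N, ArithmeticFunction.vonMangoldt n * ((N / n : ℕ) : ℝ)
        + ∑ n ∈ Icc 1 N, ArithmeticFunction.vonMangoldt n := by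
    rw [mul_sum, ← sum_add_distrib]
    refine sum_le_sum fun n hn => ?_
    have hn1 : 1 ≤ n := (mem_Icc.1 hn).1
    have hnpos : (0 : ℝ) < n := by exact_mod_cast hn1
    have h1 : (N : ℝ) / n ≤ ((N / n : ℕ) : ℝ) + 1 := by
      rw [div_le_iff₀ hnpos]
      have := Nat.lt_div_mul_add hn1 (a := N)
      have h3 : N ≤ (N / n + 1) * n := by linarith
      exact_mod_cast h3
    calc N * (ArithmeticFunction.vonMangoldt n / n)
        = ArithmeticFunction.vonMangoldt n * ((N : ℝ) / n) := by ring
      _ ≤ ArithmeticFunction.vonMangoldt n * (((N / n : ℕ) : ℝ) + 1) :=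
          mul_le_mul_of_nonneg_left h1 ArithmeticFunction.vonMangoldt_nonneg
      _ = _ := by ring
  have hlog4 : 0 ≤ Real.log 4 := Real.log_nonneg (by norm_num)
  rw [abs_le]
  constructor
  · refine le_of_mul_le_mul_left ?_ hNpos
    nlinarith
  · refine le_of_mul_le_mul_left ?_ hNpos
    nlinarith

section ResidueClass

variable {q : ℕ} [Fact q.Prime]

/-- The contribution to `∑ Λ(n)/n` of the multiples of a prime `q` converges. -/
theorem summable_residueClass_zero_div :
    Summable fun n : ℕ => ArithmeticFunction.vonMangoldt.residueClass (0 : ZMod q) n / n := by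
  have h1 := ArithmeticFunction.vonMangoldt.summable_residueClass_non_primes_div (0 : ZMod q)
  refine (summable_congr_cofinite ?_).1 h1
  have hfin : ({q} : Set ℕ).Finite := Set.finite_singleton q
  filter_upwards [hfin.compl_mem_cofinite] with n hn
  have hnq : n ≠ q := hn
  by_cases hp : n.Prime
  · have : (n : ZMod q) ≠ 0 := by
      rw [Ne, ZMod.natCast_eq_zero_iff]
      intro hd
      exact hnq ((Nat.prime_dvd_prime_iff_eq Fact.out hp).1 hd).symm
    simp [hp, ArithmeticFunction.vonMangoldt.residueClass, this]
  · simp [hp]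

theorem one_mul_vonMangoldt_eq (n : ℕ) :
    (1 : DirichletCharacter ℂ q) n * ArithmeticFunction.vonMangoldt n
      = ((ArithmeticFunction.vonMangoldt n
        - ArithmeticFunction.vonMangoldt.residueClass (0 : ZMod q) n : ℝ) : ℂ) := by
  by_cases h : (n : ZMod q) = 0
  · rw [h, MulChar.map_zero]
    simp [h, ArithmeticFunction.vonMangoldt.residueClass]
  · rw [MulChar.one_apply (isUnit_iff_ne_zero.2 h)]
    simp [h, ArithmeticFunction.vonMangoldt.residueClass]

theorem exists_norm_sum_one_mul_vonMangoldt_div_sub_log_le :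
    ∃ C : ℝ, ∀ N : ℕ, 1 ≤ N →
      ‖∑ n ∈ Icc 1 N, (1 : DirichletCharacter ℂ q) n * ArithmeticFunction.vonMangoldt n / n
        - (Real.log N : ℂ)‖ ≤ C := by
  obtain ⟨C, hC⟩ := exists_abs_sum_vonMangoldt_div_sub_log_le
  have hs := summable_residueClass_zero_div (q := q)
  refine ⟨C + ∑' n : ℕ, ArithmeticFunction.vonMangoldt.residueClass (0 : ZMod q) n / n,
    fun N hN => ?_⟩
  have e : ∑ n ∈ Icc 1 N, (1 : DirichletCharacter ℂ q) n * ArithmeticFunction.vonMangoldt n / n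
        - (Real.log N : ℂ)
      = ((∑ n ∈ Icc 1 N, ArithmeticFunction.vonMangoldt n / n - Real.log N
        - ∑ n ∈ Icc 1 N, ArithmeticFunction.vonMangoldt.residueClass (0 : ZMod q) n / n : ℝ) : ℂ) := by
    simp_rw [one_mul_vonMangoldt_eq]
    push_cast
    simp_rw [sub_div]
    rw [sum_sub_distrib]
    ring
  have hnn : ∀ n : ℕ, 0 ≤ ArithmeticFunction.vonMangoldt.residueClass (0 : ZMod q) n / n :=
    fun n => div_nonneg (ArithmeticFunction.vonMangoldt.residueClass_nonneg _ n) (by positivity)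
  rw [e, Complex.norm_real]
  refine (norm_sub_le _ _).trans (add_le_add (hC N hN) ?_)
  rw [Real.norm_eq_abs, abs_of_nonneg (sum_nonneg fun n _ => hnn n)]
  exact hs.sum_le_tsum _ fun n _ => hnn n

/-- **Mertens' first estimate in arithmetic progressions** to a prime modulus. -/
theorem exists_abs_sum_residueClass_div_sub_log_le {a : ZMod q} (ha : IsUnit a) :
    ∃ C : ℝ, ∀ N : ℕ, 1 ≤ N →
      |∑ n ∈ Icc 1 N, ArithmeticFunction.vonMangoldt.residueClass a n / n
        - (q.totient : ℝ)⁻¹ * Real.log N| ≤ C := by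
  have hχ : ∀ χ : DirichletCharacter ℂ q, ∃ C : ℝ, ∀ N : ℕ, 1 ≤ N →
      ‖∑ n ∈ Icc 1 N, χ n * ArithmeticFunction.vonMangoldt n / n
        - (if χ = 1 then (Real.log N : ℂ) else 0)‖ ≤ C := by
    intro χ
    by_cases h : χ = 1
    · subst h
      simpa using exists_norm_sum_one_mul_vonMangoldt_div_sub_log_le (q := q)
    · obtain ⟨C, hC⟩ := exists_norm_sum_character_mul_vonMangoldt_div_le h
      exact ⟨C, fun N _ => by simpa [h] using hC N⟩
  choose C hC using hχ
  refine ⟨(q.totient : ℝ)⁻¹ * ∑ χ : DirichletCharacter ℂ q, C χ, fun N hN => ?_⟩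
  have hone : (1 : DirichletCharacter ℂ q) a⁻¹ = 1 := by
    refine MulChar.one_apply (isUnit_iff_ne_zero.2 (inv_ne_zero ha.ne_zero))
  have e : ((∑ n ∈ Icc 1 N, ArithmeticFunction.vonMangoldt.residueClass a n / n
        - (q.totient : ℝ)⁻¹ * Real.log N : ℝ) : ℂ)
      = (q.totient : ℂ)⁻¹ * ∑ χ : DirichletCharacter ℂ q, χ a⁻¹ *
        (∑ n ∈ Icc 1 N, χ n * ArithmeticFunction.vonMangoldt n / n
        - (if χ = 1 then (Real.log N : ℂ) else 0)) := by
    simp only [mul_sub, sum_sub_distrib, mul_ite, mul_zero]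
    rw [Finset.sum_ite_eq' univ (1 : DirichletCharacter ℂ q), if_pos (mem_univ _), hone, one_mul]
    push_cast
    congr 1
    simp_rw [ArithmeticFunction.vonMangoldt.residueClass_apply ha, mul_sum]
    rw [sum_comm]
    refine sum_congr rfl fun n _ => ?_
    rw [sum_div]
    exact sum_congr rfl fun χ _ => by ring
  rw [← Real.norm_eq_abs, ← Complex.norm_real, e, norm_mul, norm_inv, Complex.norm_natCast]
  refine mul_le_mul_of_nonneg_left (norm_sum_le_of_le _ fun χ _ => ?_) (by positivity)
  rw [norm_mul]
  exact (mul_le_of_le_one_left (norm_nonneg _) (χ.norm_le_one _)).trans (hC χ N hN)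

end ResidueClass

section MertensConstant

variable {q : ℕ} [Fact q.Prime]

theorem norm_character_mul_vonMangoldt_div_log_le (χ : DirichletCharacter ℂ q) (n : ℕ) :
    ‖χ n * ArithmeticFunction.vonMangoldt n / Real.log n‖ ≤ 1 := by
  have hlog : 0 ≤ Real.log n := Real.log_natCast_nonneg n
  rw [norm_div, norm_mul, Complex.norm_real, Complex.norm_real, Real.norm_eq_abs,
    Real.norm_eq_abs, abs_of_nonneg ArithmeticFunction.vonMangoldt_nonneg, abs_of_nonneg hlog]
  refine div_le_one_of_le₀ ?_ hlog
  exact (mul_le_of_le_one_left ArithmeticFunction.vonMangoldt_nonneg (χ.norm_le_one _)).trans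
    ArithmeticFunction.vonMangoldt_le_log

theorem term_residueClass_one_div (δ : ℝ) :
    LSeries.term (fun n : ℕ => ((ArithmeticFunction.vonMangoldt.residueClass (1 : ZMod q) n / n
        / Real.log n : ℝ) : ℂ)) δ
      = LSeries.term ((q.totient : ℂ)⁻¹ • ∑ χ : DirichletCharacter ℂ q,
          fun n : ℕ => χ n * ArithmeticFunction.vonMangoldt n / Real.log n) (1 + δ : ℝ) := by
  ext n
  rcases eq_or_ne n 0 with rfl | hn
  · simp
  · have hn' : (n : ℂ) ≠ 0 := by exact_mod_cast hn
    rw [LSeries.term_of_ne_zero hn, LSeries.term_of_ne_zero hn]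
    push_cast
    rw [Complex.cpow_add _ _ hn', Complex.cpow_one,
      ArithmeticFunction.vonMangoldt.residueClass_apply isUnit_one]
    simp only [inv_one, map_one, one_mul, Pi.smul_apply, Finset.sum_apply, smul_eq_mul]
    rw [← sum_div]
    ring

theorem LSeriesSummable_residueClass_one_div {δ : ℝ} (hδ : 0 < δ) :
    LSeriesSummable (fun n : ℕ => ((ArithmeticFunction.vonMangoldt.residueClass (1 : ZMod q) n / n
        / Real.log n : ℝ) : ℂ)) δ := by
  rw [LSeriesSummable, term_residueClass_one_div]
  refine LSeriesSummable.smul _ (LSeriesSummable.sum fun χ _ => ?_)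
  exact LSeriesSummable_of_bounded_of_one_lt_re
    (fun n _ => norm_character_mul_vonMangoldt_div_log_le χ n) (by simpa using hδ)

theorem exp_totient_mul_LSeries_residueClass_one_div {δ : ℝ} (hδ : 0 < δ) :
    Complex.exp (q.totient * LSeries (fun n : ℕ =>
        ((ArithmeticFunction.vonMangoldt.residueClass (1 : ZMod q) n / n / Real.log n : ℝ) : ℂ)) δ)
      = ∏ χ : DirichletCharacter ℂ q, χ.LFunction (1 + δ : ℝ) := by
  have hre : 1 < ((1 + δ : ℝ) : ℂ).re := by simpa using hδ
  have hφ : (q.totient : ℂ) ≠ 0 :=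
    Nat.cast_ne_zero.2 (Nat.totient_pos.2 (Fact.out : q.Prime).pos).ne'
  have hs : ∀ χ ∈ (univ : Finset (DirichletCharacter ℂ q)), LSeriesSummable
      (fun n : ℕ => χ n * ArithmeticFunction.vonMangoldt n / Real.log n) (1 + δ : ℝ) := fun χ _ =>
    LSeriesSummable_of_bounded_of_one_lt_re
      (fun n _ => norm_character_mul_vonMangoldt_div_log_le χ n) hre
  rw [LSeries, term_residueClass_one_div, ← LSeries, LSeries_smul, LSeries_sum hs,
    mul_inv_cancel_left₀ hφ, Complex.exp_sum]
  refine prod_congr rfl fun χ _ => ?_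
  rw [DirichletCharacter.LSeries_eq_exp_LSeries χ hre, DirichletCharacter.LFunction_eq_LSeries χ hre]

/-- **Mertens' second theorem** for primes (and prime powers) congruent to `1` modulo a prime `q`,
with the constant expressed through the values `L(1, χ)`. -/
theorem exists_tendsto_sum_residueClass_one_div :
    ∃ c : ℝ, Tendsto (fun N : ℕ => ∑ n ∈ Icc 1 N,
        ArithmeticFunction.vonMangoldt.residueClass (1 : ZMod q) n / n / Real.log n
          - (q.totient : ℝ)⁻¹ * Real.log (Real.log N)) atTop (𝓝 c) ∧
      (Real.exp (q.totient * c - Real.eulerMascheroniConstant) : ℂ)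
        = (1 - (q : ℂ)⁻¹) *
          ∏ χ ∈ (univ : Finset (DirichletCharacter ℂ q)).erase 1, χ.LFunction 1 := by
  have hq : q.Prime := Fact.out
  have hφ : (q.totient : ℝ) ≠ 0 := Nat.cast_ne_zero.2 (Nat.totient_pos.2 hq.pos).ne'
  obtain ⟨C, hC⟩ := exists_abs_sum_residueClass_div_sub_log_le (isUnit_one (M := ZMod q))
  obtain ⟨c, hc⟩ := exists_tendsto_sum_div_log_sub hC
  refine ⟨c, hc, ?_⟩
  have h1 := tendsto_LSeries_add_log (f := fun n : ℕ =>
      ((ArithmeticFunction.vonMangoldt.residueClass (1 : ZMod q) n / n / Real.log n : ℝ) : ℂ))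
    (κ := (q.totient : ℝ)⁻¹) (c := c) (fun δ hδ => LSeriesSummable_residueClass_one_div hδ) (by
      refine ((Complex.continuous_ofReal.tendsto c).comp hc).congr fun N => ?_
      simp only [Function.comp_apply]
      push_cast
      rfl)
  have h2 := (Complex.continuous_exp.tendsto _).comp (h1.const_mul (q.totient : ℂ))
  have h3 : Tendsto (fun δ : ℝ => (δ : ℂ) * ∏ χ : DirichletCharacter ℂ q, χ.LFunction (1 + δ : ℝ))
      (𝓝[>] 0) (𝓝 (Complex.exp (q.totient *
        (c - (((q.totient : ℝ)⁻¹ * Real.eulerMascheroniConstant : ℝ) : ℂ))))) := by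
    refine h2.congr' ?_
    filter_upwards [self_mem_nhdsWithin] with δ hδ
    have hδ' : (0 : ℝ) < δ := hδ
    simp only [Function.comp_apply]
    rw [mul_add, Complex.exp_add, exp_totient_mul_LSeries_residueClass_one_div hδ', mul_comm]
    congr 1
    rw [← Complex.ofReal_natCast, ← Complex.ofReal_mul, mul_inv_cancel_left₀ hφ,
      ← Complex.ofReal_exp, Real.exp_log hδ']
  have h4 : Tendsto (fun δ : ℝ => (δ : ℂ) * ∏ χ : DirichletCharacter ℂ q, χ.LFunction (1 + δ : ℝ))
      (𝓝[>] 0) (𝓝 ((1 - (q : ℂ)⁻¹) *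
          ∏ χ ∈ (univ : Finset (DirichletCharacter ℂ q)).erase 1, χ.LFunction 1)) := by
    have hshift : Tendsto (fun δ : ℝ => ((1 + δ : ℝ) : ℂ)) (𝓝[>] 0) (𝓝[≠] 1) := by
      refine tendsto_nhdsWithin_iff.2 ⟨?_, ?_⟩
      · have hcont : Continuous fun δ : ℝ => ((1 + δ : ℝ) : ℂ) := by fun_prop
        simpa using (hcont.tendsto 0).mono_left nhdsWithin_le_nhds
      · filter_upwards [self_mem_nhdsWithin] with δ hδ
        have hδ' : (0 : ℝ) < δ := hδ
        simpa using hδ'.ne'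
    have hone := (DirichletCharacter.LFunctionTrivChar_residue_one (N := q)).comp hshift
    have hrest : Tendsto (fun δ : ℝ => ∏ χ ∈ (univ : Finset (DirichletCharacter ℂ q)).erase 1,
        χ.LFunction (1 + δ : ℝ)) (𝓝[>] 0)
        (𝓝 (∏ χ ∈ (univ : Finset (DirichletCharacter ℂ q)).erase 1, χ.LFunction 1)) := by
      refine tendsto_finsetProd _ fun χ hχ => ?_
      exact ((DirichletCharacter.differentiable_LFunction
        (Finset.ne_of_mem_erase hχ)).continuous.tendsto 1).comp
        (hshift.mono_right nhdsWithin_le_nhds)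
    rw [hq.primeFactors, prod_singleton] at hone
    refine (hone.mul hrest).congr fun δ => ?_
    simp only [Function.comp_apply]
    rw [← mul_prod_erase univ _ (mem_univ (1 : DirichletCharacter ℂ q)), ← mul_assoc,
      DirichletCharacter.LFunctionTrivChar]
    push_cast
    ring
  rw [← tendsto_nhds_unique h3 h4]
  push_cast
  congr 1
  rw [mul_sub, mul_inv_cancel_left₀ (by exact_mod_cast hφ)]

end MertensConstant

section LValues

/-- The cotangent series grouped by residue classes. -/
theorem tendsto_sum_inv_sub_inv_pi_mul_cot {x : ℂ} (hx : x ∈ Complex.integerComplement) :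
    Tendsto (fun m : ℕ => ∑ j ∈ range m, (1 / (j + x) - 1 / (j + 1 - x))) atTop
      (𝓝 (Real.pi * Complex.cot (Real.pi * x))) := by
  have h1 := tendsto_logDeriv_euler_cot_sub hx
  have h2 : Tendsto (fun m : ℕ => 1 / ((m : ℂ) + x)) atTop (𝓝 0) := by
    simp only [one_div]
    refine tendsto_inv₀_cobounded.comp ?_
    exact (tendsto_add_const_cobounded x).comp tendsto_natCast_atTop_cobounded
  have h3 := (h1.const_add (1 / x)).sub h2
  rw [sub_zero, add_sub_cancel] at h3
  refine h3.congr fun m => ?_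
  induction m with
  | zero => simp
  | succ m ih =>
    rw [sum_range_succ, sum_range_succ, ← ih, cotTerm]
    have e : 1 / ((m : ℂ) + 1 - x) = - (1 / (x - (m + 1))) := by
      rw [← neg_sub, one_div_neg_eq_neg_one_div]
    rw [e]
    push_cast
    ring

/-- A primitive of `(1 - t²)/(1 + t + t² + t³ + t⁴)`. -/
theorem hasDerivAt_log_sub_log_sqrt_five (t : ℝ) :
    HasDerivAt (fun t : ℝ => (Real.log (t ^ 2 + (1 + √5) / 2 * t + 1)
        - Real.log (t ^ 2 + (1 - √5) / 2 * t + 1)) / √5)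
      ((1 - t ^ 2) / (1 + t + t ^ 2 + t ^ 3 + t ^ 4)) t := by
  have hs : √5 ^ 2 = 5 := Real.sq_sqrt (by norm_num)
  have hs0 : 0 < √5 := by positivity
  have hpoly : ∀ b : ℝ, HasDerivAt (fun t : ℝ => t ^ 2 + b * t + 1) (2 * t + b) t := by
    intro b
    have := (((hasDerivAt_id t).pow 2).add ((hasDerivAt_id t).const_mul b)).add_const 1
    simpa using this
  have hA : 0 < t ^ 2 + (1 + √5) / 2 * t + 1 := by
    nlinarith [sq_nonneg (t + (1 + √5) / 4), sq_nonneg (√5 - 3)]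
  have hB : 0 < t ^ 2 + (1 - √5) / 2 * t + 1 := by
    nlinarith [sq_nonneg (t + (1 - √5) / 4)]
  have hAB : (t ^ 2 + (1 + √5) / 2 * t + 1) * (t ^ 2 + (1 - √5) / 2 * t + 1)
      = 1 + t + t ^ 2 + t ^ 3 + t ^ 4 := by
    linear_combination (- t ^ 2 / 4) * hs
  have h := (((hpoly ((1 + √5) / 2)).log hA.ne').sub ((hpoly ((1 - √5) / 2)).log hB.ne')).div_const √5
  refine h.congr_deriv ?_
  rw [← hAB, div_sub_div _ _ hA.ne' hB.ne', div_div, div_eq_div_iff (by positivity) (by positivity)]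
  ring

/-- `L(1, (·/5)) = 2 log((1 + √5)/2) / √5`. -/
theorem tendsto_sum_quadratic_mod_five :
    Tendsto (fun m : ℕ => ∑ j ∈ range m, (1 / (5 * j + 1) - 1 / (5 * j + 2) - 1 / (5 * j + 3)
        + 1 / (5 * j + 4) : ℝ)) atTop (𝓝 (2 * Real.log ((1 + √5) / 2) / √5)) := by
  set G : ℝ → ℝ := fun t => (Real.log (t ^ 2 + (1 + √5) / 2 * t + 1)
        - Real.log (t ^ 2 + (1 - √5) / 2 * t + 1)) / √5 with hG
  set P : ℕ → ℝ → ℝ := fun M t => ∑ j ∈ range M, (t ^ (5 * j + 1) / (5 * j + 1)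
    - t ^ (5 * j + 2) / (5 * j + 2) - t ^ (5 * j + 3) / (5 * j + 3)
    + t ^ (5 * j + 4) / (5 * j + 4)) with hP
  have hs : √5 ^ 2 = 5 := Real.sq_sqrt (by norm_num)
  have hs0 : 0 < √5 := by positivity
  have hs3 : √5 < 3 := by nlinarith
  have hG1 : G 1 = 2 * Real.log ((1 + √5) / 2) / √5 := by
    simp only [hG]
    congr 1
    have hpow : 2 * Real.log ((1 + √5) / 2) = Real.log (((1 + √5) / 2) ^ 2) := by
      rw [Real.log_pow, Nat.cast_two]
    rw [← Real.log_div (by positivity) (by nlinarith), hpow]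
    congr 1
    rw [div_eq_iff (by nlinarith)]
    linear_combination ((√5 - 3) / 8) * hs
  have hG0 : G 0 = 0 := by simp [hG]
  have hP0 : ∀ M, P M 0 = 0 := fun M => by simp [hP]
  have hmono : ∀ (k : ℕ) (t : ℝ), HasDerivAt (fun t : ℝ => t ^ (k + 1) / (k + 1 : ℝ)) (t ^ k) t := by
    intro k t
    have h := ((hasDerivAt_id t).pow (k + 1)).div_const (k + 1 : ℝ)
    refine h.congr_deriv ?_
    have : (k + 1 : ℝ) ≠ 0 := by positivity
    simp
    field_simp
  have hPd : ∀ (M : ℕ) (t : ℝ), HasDerivAt (P M)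
      ((1 - t ^ 2) / (1 + t + t ^ 2 + t ^ 3 + t ^ 4) * (1 - t ^ (5 * M))) t := by
    intro M t
    have hQ : 0 < 1 + t + t ^ 2 + t ^ 3 + t ^ 4 := by
      nlinarith [sq_nonneg (t ^ 2 + t / 2), sq_nonneg (t + 1), sq_nonneg t, sq_nonneg (t + 2 / 3)]
    have h : HasDerivAt (P M) (∑ j ∈ range M, (t ^ (5 * j) - t ^ (5 * j + 1) - t ^ (5 * j + 2)
        + t ^ (5 * j + 3))) t := by
      refine HasDerivAt.fun_sum fun j _ => ?_
      have h1 := hmono (5 * j) t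
      have h2 := hmono (5 * j + 1) t
      have h3 := hmono (5 * j + 2) t
      have h4 := hmono (5 * j + 3) t
      push_cast at h1 h2 h3 h4
      norm_num [add_assoc] at h1 h2 h3 h4
      exact ((h1.sub h2).sub h3).add h4
    refine h.congr_deriv ?_
    rw [div_mul_eq_mul_div, eq_div_iff hQ.ne']
    clear h
    induction M with
    | zero => simp
    | succ M ih =>
      rw [sum_range_succ, add_mul, ih]
      ring
  have hbound : ∀ M : ℕ, P M 1 ∈ Set.Icc (G 1 - 1 / (5 * M + 1)) (G 1) := by
    intro M
    have hD : ∀ t : ℝ, HasDerivAt (fun t => G t - P M t)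
        ((1 - t ^ 2) / (1 + t + t ^ 2 + t ^ 3 + t ^ 4) * t ^ (5 * M)) t := by
      intro t
      refine ((hasDerivAt_log_sub_log_sqrt_five t).sub (hPd M t)).congr_deriv ?_
      ring
    have hE : ∀ t : ℝ, HasDerivAt (fun t => t ^ (5 * M + 1) / (5 * M + 1 : ℝ) - (G t - P M t))
        (t ^ (5 * M) - (1 - t ^ 2) / (1 + t + t ^ 2 + t ^ 3 + t ^ 4) * t ^ (5 * M)) t := by
      intro t
      have h1 := hmono (5 * M) t
      push_cast at h1
      exact h1.sub (hD t)
    have m1 : MonotoneOn (fun t => G t - P M t) (Set.Icc 0 1) := by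
      refine monotoneOn_of_hasDerivWithinAt_nonneg (convex_Icc 0 1)
        (fun t _ => (hD t).continuousAt.continuousWithinAt)
        (fun t _ => (hD t).hasDerivWithinAt) fun t ht => ?_
      rw [interior_Icc] at ht
      have h0 := ht.1
      have h1 : 0 ≤ 1 - t ^ 2 := by nlinarith [ht.1, ht.2]
      positivity
    have m2 : MonotoneOn (fun t => t ^ (5 * M + 1) / (5 * M + 1 : ℝ) - (G t - P M t))
        (Set.Icc 0 1) := by
      refine monotoneOn_of_hasDerivWithinAt_nonneg (convex_Icc 0 1)
        (fun t _ => (hE t).continuousAt.continuousWithinAt)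
        (fun t _ => (hE t).hasDerivWithinAt) fun t ht => ?_
      rw [interior_Icc] at ht
      have h0 := ht.1
      have h1 : (1 - t ^ 2) / (1 + t + t ^ 2 + t ^ 3 + t ^ 4) ≤ 1 := by
        rw [div_le_one (by positivity)]
        have : 0 ≤ t + t ^ 2 + t ^ 3 + t ^ 4 + t ^ 2 := by positivity
        linarith
      have h2 : 0 ≤ t ^ (5 * M) := by positivity
      nlinarith
    have hl := m1 (Set.left_mem_Icc.2 zero_le_one) (Set.right_mem_Icc.2 zero_le_one) zero_le_one
    have hr := m2 (Set.left_mem_Icc.2 zero_le_one) (Set.right_mem_Icc.2 zero_le_one) zero_le_one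
    simp only [hG0, hP0] at hl hr
    simp at hl hr
    rw [Set.mem_Icc, one_div]
    constructor <;> linarith
  rw [← hG1]
  have hz : Tendsto (fun M : ℕ => G 1 - 1 / (5 * M + 1 : ℝ)) atTop (𝓝 (G 1)) := by
    have : Tendsto (fun M : ℕ => 1 / (5 * M + 1 : ℝ)) atTop (𝓝 0) := by
      refine squeeze_zero (fun M => by positivity) (fun M => ?_)
        tendsto_one_div_add_atTop_nhds_zero_nat
      exact one_div_le_one_div_of_le (by positivity) (by linarith [(Nat.cast_nonneg M : (0 : ℝ) ≤ M)])
    simpa using this.const_sub (G 1)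
  refine (tendsto_of_tendsto_of_tendsto_of_le_of_le hz tendsto_const_nhds
    (fun M => (hbound M).1) (fun M => (hbound M).2)).congr fun M => ?_
  simp [hP]

end LValues

section ModFive

theorem fact_prime_five : Fact (Nat.Prime 5) := ⟨by norm_num⟩

attribute [local instance] fact_prime_five

variable (χ : DirichletCharacter ℂ 5)

theorem character_five_three : χ 3 = χ 2 ^ 3 := by
  rw [← map_pow]
  congr 1

theorem character_five_four : χ 4 = χ 2 ^ 2 := by
  rw [← map_pow]
  congr 1

theorem character_five_two_pow_four : χ 2 ^ 4 = 1 := by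
  rw [← map_pow, show (2 : ZMod 5) ^ 4 = 1 from rfl, map_one]

theorem character_five_injective :
    Function.Injective fun χ : DirichletCharacter ℂ 5 => χ 2 := by
  intro χ ψ h
  have h' : χ 2 = ψ 2 := h
  refine MulChar.ext' fun a => ?_
  fin_cases a
  · exact (MulChar.map_zero χ).trans (MulChar.map_zero ψ).symm
  · exact (map_one χ).trans (map_one ψ).symm
  · exact h'
  · change χ 3 = ψ 3
    rw [character_five_three, character_five_three, h']
  · change χ 4 = ψ 4
    rw [character_five_four, character_five_four, h']

theorem eq_of_pow_four_eq_one {z : ℂ} (hz : z ^ 4 = 1) :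
    z = 1 ∨ z = -1 ∨ z = Complex.I ∨ z = -Complex.I := by
  have h : (z - 1) * ((z + 1) * ((z - Complex.I) * (z + Complex.I))) = 0 := by
    linear_combination hz + (1 - z ^ 2) * Complex.I_sq
  rcases mul_eq_zero.1 h with h | h
  · exact Or.inl (sub_eq_zero.1 h)
  rcases mul_eq_zero.1 h with h | h
  · exact Or.inr (Or.inl (eq_neg_of_add_eq_zero_left h))
  rcases mul_eq_zero.1 h with h | h
  · exact Or.inr (Or.inr (Or.inl (sub_eq_zero.1 h)))
  · exact Or.inr (Or.inr (Or.inr (eq_neg_of_add_eq_zero_left h)))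

theorem image_character_five :
    (univ : Finset (DirichletCharacter ℂ 5)).image (fun χ => χ 2)
      = {1, -1, Complex.I, -Complex.I} := by
  refine eq_of_subset_of_card_le ?_ ?_
  · intro z hz
    obtain ⟨χ, _, rfl⟩ := mem_image.1 hz
    simpa using eq_of_pow_four_eq_one (character_five_two_pow_four χ)
  · rw [card_image_of_injective _ character_five_injective, card_univ, ← Nat.card_eq_fintype_card,
      DirichletCharacter.card_eq_totient_of_hasEnoughRootsOfUnity,
      Nat.totient_prime (by norm_num)]
    exact card_le_four

theorem image_erase_one_character_five :
    ((univ : Finset (DirichletCharacter ℂ 5)).erase 1).image (fun χ => χ 2)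
      = {-1, Complex.I, -Complex.I} := by
  have h1 : (1 : DirichletCharacter ℂ 5) 2 = 1 :=
    MulChar.one_apply (isUnit_iff_ne_zero.2 (by decide))
  rw [image_erase character_five_injective, image_character_five, h1, erase_insert]
  have h2 : (1 : ℂ) ≠ -1 := by norm_num
  have h3 : (1 : ℂ) ≠ Complex.I := fun h => by simpa using congrArg Complex.im h
  have h4 : (1 : ℂ) ≠ -Complex.I := fun h => by simpa using congrArg Complex.im h
  simp [h2, h3, h4]

theorem sum_Icc_character_five_div (m : ℕ) :
    ∑ k ∈ Icc 1 (5 * m), χ k / k = ∑ j ∈ range m, (1 / (5 * j + 1) + χ 2 / (5 * j + 2)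
      + χ 2 ^ 3 / (5 * j + 3) + χ 2 ^ 2 / (5 * j + 4) : ℂ) := by
  induction m with
  | zero => simp
  | succ m ih =>
    have hmod : ∀ r : ℕ, ((5 * m + r : ℕ) : ZMod 5) = r := by
      intro r
      push_cast
      rw [show (5 : ZMod 5) = 0 from rfl, zero_mul, zero_add]
    rw [sum_range_succ, ← ih, show 5 * (m + 1) = 5 * m + 1 + 1 + 1 + 1 + 1 by ring,
      sum_Icc_succ_top (by omega), sum_Icc_succ_top (by omega), sum_Icc_succ_top (by omega),
      sum_Icc_succ_top (by omega), sum_Icc_succ_top (by omega)]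
    have e0 : χ ((5 * m + 5 : ℕ) : ZMod 5) = 0 := by
      rw [hmod]
      exact MulChar.map_zero χ
    have e1 : χ ((5 * m + 1 : ℕ) : ZMod 5) = 1 := by
      rw [hmod, Nat.cast_one, map_one]
    have e2 : χ ((5 * m + 2 : ℕ) : ZMod 5) = χ 2 := by rw [hmod]; rfl
    have e3 : χ ((5 * m + 3 : ℕ) : ZMod 5) = χ 2 ^ 3 := by
      rw [hmod, ← character_five_three]; rfl
    have e4 : χ ((5 * m + 4 : ℕ) : ZMod 5) = χ 2 ^ 2 := by
      rw [hmod, ← character_five_four]; rfl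
    simp only [add_assoc, Nat.reduceAdd]
    rw [e0, e1, e2, e3, e4]
    push_cast
    ring

variable {χ}

theorem tendsto_sum_Icc_character_five_div (hχ : χ ≠ 1) :
    Tendsto (fun m : ℕ => ∑ k ∈ Icc 1 (5 * m), χ k / k) atTop (𝓝 (χ.LFunction 1)) := by
  have h : Tendsto (fun M : ℕ => ∑ k ∈ Icc 1 M, χ k / (k : ℂ)) atTop (𝓝 (χ.LFunction 1)) := by
    rw [tendsto_iff_norm_sub_tendsto_zero]
    refine squeeze_zero (fun _ => norm_nonneg _)
      (norm_sum_character_div_sub_LFunction_le hχ) ?_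
    exact (tendsto_const_div_atTop_nhds_zero_nat (2 * (5 : ℕ) : ℝ)).comp (tendsto_add_atTop_nat 1)
      |>.congr fun n => by simp
  exact h.comp (tendsto_atTop_mono (fun m => by simp; omega) tendsto_id)

theorem LFunction_one_of_apply_two_eq_neg_one (h : χ 2 = -1) :
    χ.LFunction 1 = ((2 * Real.log ((1 + √5) / 2) / √5 : ℝ) : ℂ) := by
  have hχ : χ ≠ 1 := by
    rintro rfl
    rw [MulChar.one_apply (isUnit_iff_ne_zero.2 (by decide))] at h
    norm_num at h
  refine tendsto_nhds_unique (tendsto_sum_Icc_character_five_div hχ) ?_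
  refine ((Complex.continuous_ofReal.tendsto _).comp tendsto_sum_quadratic_mod_five).congr
    fun m => ?_
  rw [sum_Icc_character_five_div, h, Function.comp_apply]
  push_cast
  exact sum_congr rfl fun j _ => by ring

theorem tendsto_sum_one_div_sub_one_div_five {a : ℕ} (h0 : 0 < a) (h5 : a < 5) :
    Tendsto (fun m : ℕ => ∑ j ∈ range m, (1 / (5 * j + a) - 1 / (5 * j + (5 - a)) : ℂ)) atTop
      (𝓝 ((Real.pi / 5 * Real.cot (a * Real.pi / 5) : ℝ) : ℂ)) := by
  have hx : (a / 5 : ℂ) ∈ Complex.integerComplement := by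
    rw [Complex.mem_integerComplement_iff]
    rintro ⟨n, hn⟩
    rw [eq_div_iff (by norm_num)] at hn
    have : n * 5 = (a : ℤ) := by exact_mod_cast hn
    omega
  have h := (tendsto_sum_inv_sub_inv_pi_mul_cot hx).const_mul (1 / 5 : ℂ)
  have e : (1 / 5 : ℂ) * (Real.pi * Complex.cot (Real.pi * (a / 5)))
      = ((Real.pi / 5 * Real.cot (a * Real.pi / 5) : ℝ) : ℂ) := by
    push_cast
    rw [show (a : ℂ) * Real.pi / 5 = Real.pi * (a / 5) by ring]
    ring
  rw [e] at h
  refine h.congr fun m => ?_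
  rw [mul_sum]
  refine sum_congr rfl fun j _ => ?_
  rw [mul_sub, one_div_mul_one_div, one_div_mul_one_div]
  congr 2 <;> ring

theorem LFunction_one_of_apply_two_sq_eq_neg_one (h : χ 2 ^ 2 = -1) :
    χ.LFunction 1 = ((Real.pi / 5 * Real.cot (Real.pi / 5) : ℝ) : ℂ)
      + χ 2 * ((Real.pi / 5 * Real.cot (2 * Real.pi / 5) : ℝ) : ℂ) := by
  have hχ : χ ≠ 1 := by
    rintro rfl
    rw [MulChar.one_apply (isUnit_iff_ne_zero.2 (by decide))] at h
    norm_num at h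
  refine tendsto_nhds_unique (tendsto_sum_Icc_character_five_div hχ) ?_
  have h1 := tendsto_sum_one_div_sub_one_div_five (a := 1) (by norm_num) (by norm_num)
  have h2 := tendsto_sum_one_div_sub_one_div_five (a := 2) (by norm_num) (by norm_num)
  have h3 := h1.add (h2.const_mul (χ 2))
  norm_num at h3
  push_cast
  refine h3.congr fun m => ?_
  rw [sum_Icc_character_five_div, ← sum_sub_distrib, ← sum_sub_distrib, mul_sum,
    ← sum_add_distrib, show χ 2 ^ 3 = χ 2 * χ 2 ^ 2 by ring, h]
  exact sum_congr rfl fun j _ => by ring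

theorem cot_sq_add_cot_sq_pi_div_five :
    Real.cot (Real.pi / 5) ^ 2 + Real.cot (2 * Real.pi / 5) ^ 2 = 2 := by
  have hs : √5 ^ 2 = 5 := Real.sq_sqrt (by norm_num)
  have hs0 : 0 < √5 := by positivity
  have hs3 : √5 < 3 := by nlinarith
  have hc1 : Real.cos (Real.pi / 5) ^ 2 = (3 + √5) / 8 := by
    rw [Real.cos_pi_div_five]
    linear_combination hs / 16
  have hc2 : Real.cos (2 * Real.pi / 5) ^ 2 = (3 - √5) / 8 := by
    rw [show 2 * Real.pi / 5 = 2 * (Real.pi / 5) by ring, Real.cos_two_mul, hc1]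
    linear_combination hs / 16
  rw [Real.cot_eq_cos_div_sin, Real.cot_eq_cos_div_sin, div_pow, div_pow, Real.sin_sq, Real.sin_sq,
    hc1, hc2, div_add_div _ _ (by linarith) (by linarith), div_eq_iff (by nlinarith)]
  linear_combination (1 / 16) * hs

/-- The product of the values `L(1, χ)` over the nontrivial characters modulo `5`. -/
theorem prod_LFunction_one_mod_five :
    ∏ χ ∈ (univ : Finset (DirichletCharacter ℂ 5)).erase 1, χ.LFunction 1
      = ((2 * Real.log ((1 + √5) / 2) / √5 * (2 * Real.pi ^ 2 / 25) : ℝ) : ℂ) := by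
  set A : ℂ := ((Real.pi / 5 * Real.cot (Real.pi / 5) : ℝ) : ℂ) with hA
  set B : ℂ := ((Real.pi / 5 * Real.cot (2 * Real.pi / 5) : ℝ) : ℂ) with hB
  set E : ℂ := ((2 * Real.log ((1 + √5) / 2) / √5 : ℝ) : ℂ) with hE
  have hI1 : Complex.I ≠ -1 := fun h => by simpa using congrArg Complex.im h
  have hI2 : -Complex.I ≠ -1 := fun h => by simpa using congrArg Complex.im h
  have hI3 : Complex.I ≠ -Complex.I := fun h => by
    have := congrArg Complex.im h
    norm_num at this
  have key : ∀ χ ∈ (univ : Finset (DirichletCharacter ℂ 5)).erase 1,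
      χ.LFunction 1 = if χ 2 = -1 then E else A + χ 2 * B := by
    intro χ hχ
    split_ifs with h
    · exact LFunction_one_of_apply_two_eq_neg_one h
    · refine LFunction_one_of_apply_two_sq_eq_neg_one ?_
      have hmem : χ 2 ∈ ({-1, Complex.I, -Complex.I} : Finset ℂ) := by
        rw [← image_erase_one_character_five]
        exact mem_image_of_mem _ hχ
      simp only [mem_insert, mem_singleton] at hmem
      rcases hmem with h' | h' | h'
      · exact absurd h' h
      · rw [h', Complex.I_sq]
      · rw [h', neg_sq, Complex.I_sq]
  rw [prod_congr rfl key, ← prod_image (f := fun z : ℂ => if z = -1 then E else A + z * B)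
    (g := fun χ : DirichletCharacter ℂ 5 => χ 2) character_five_injective.injOn,
    image_erase_one_character_five, prod_insert (by simp [hI1.symm, hI2.symm]),
    prod_insert (by simpa using hI3), prod_singleton, if_pos rfl, if_neg hI1, if_neg hI2]
  have hAB : A ^ 2 + B ^ 2 = ((2 * Real.pi ^ 2 / 25 : ℝ) : ℂ) := by
    rw [hA, hB]
    norm_cast
    linear_combination (Real.pi ^ 2 / 25) * cot_sq_add_cot_sq_pi_div_five
  rw [Complex.ofReal_mul, ← hAB, hE]
  linear_combination (-E * B ^ 2) * Complex.I_sq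

end ModFive

section PrimePowers

/-- The logarithm series restricted to the multiples of `d`. -/
theorem hasSum_dvd_pow_div_log {x : ℝ} (h0 : 0 ≤ x) (h1 : x < 1) (d : ℕ) :
    HasSum (fun k : ℕ => if d ∣ k + 1 then x ^ (k + 1) / (k + 1 : ℝ) else 0)
      (-(d : ℝ)⁻¹ * Real.log (1 - x ^ d)) := by
  rcases Nat.eq_zero_or_pos d with rfl | hd
  · simp
  have hd0 : (d : ℝ) ≠ 0 := by positivity
  have hlog := (Real.hasSum_pow_div_log_of_abs_lt_one (x := x ^ d) (by
    rw [abs_of_nonneg (by positivity)]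
    exact pow_lt_one₀ h0 h1 hd.ne')).mul_left (d : ℝ)⁻¹
  have hinj : Function.Injective fun j : ℕ => d * (j + 1) - 1 := by
    intro i j hij
    have hi : 0 < d * (i + 1) := by positivity
    have hj : 0 < d * (j + 1) := by positivity
    have hij' : d * (i + 1) - 1 = d * (j + 1) - 1 := hij
    have := Nat.eq_of_mul_eq_mul_left hd (show d * (i + 1) = d * (j + 1) by omega)
    omega
  rw [neg_mul, ← mul_neg]
  refine (hinj.hasSum_iff fun k hk => if_neg ?_).1 ?_
  · rintro ⟨j, hj⟩
    have hj0 : j ≠ 0 := by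
      rintro rfl
      simp at hj
    refine hk ⟨j - 1, ?_⟩
    change d * (j - 1 + 1) - 1 = k
    rw [Nat.sub_add_cancel (Nat.one_le_iff_ne_zero.2 hj0), ← hj, Nat.add_sub_cancel]
  · refine hlog.congr_fun ?_
    intro j
    have hj : 0 < d * (j + 1) := by positivity
    have e : d * (j + 1) - 1 + 1 = d * (j + 1) := by omega
    have e' : ((d * (j + 1) - 1 : ℕ) : ℝ) + 1 = d * (j + 1) := by exact_mod_cast e
    simp only [Function.comp_apply]
    rw [e, if_pos (dvd_mul_right d _), e', pow_mul]
    field_simp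

theorem summable_residueClass_non_primes_div_log {q : ℕ} (a : ZMod q) :
    Summable fun n : ℕ => (if n.Prime then 0 else
      ArithmeticFunction.vonMangoldt.residueClass a n) / n / Real.log n := by
  have h := ArithmeticFunction.vonMangoldt.summable_residueClass_non_primes_div a
  have hnn : ∀ n : ℕ, 0 ≤ (if n.Prime then 0 else
      ArithmeticFunction.vonMangoldt.residueClass a n) / n := by
    intro n
    have := ArithmeticFunction.vonMangoldt.residueClass_nonneg a n
    split_ifs <;> positivity
  have hlog2 : 0 < Real.log 2 := Real.log_pos (by norm_num)
  refine Summable.of_nonneg_of_le (fun n => div_nonneg (hnn n) (Real.log_natCast_nonneg n))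
    (fun n => ?_) (h.mul_right (Real.log 2)⁻¹)
  rcases lt_or_ge n 2 with hn | hn
  · interval_cases n
    · simp
    · simpa using mul_nonneg (hnn 1) (inv_nonneg.2 hlog2.le)
  · rw [div_eq_mul_inv _ (Real.log n)]
    refine mul_le_mul_of_nonneg_left (inv_anti₀ hlog2 ?_) (hnn n)
    exact Real.log_le_log (by norm_num) (by exact_mod_cast hn)

variable {q : ℕ} [Fact q.Prime]

theorem residueClass_one_prime_pow_div {p : ℕ} (hp : p.Prime) (k : ℕ) :
    ArithmeticFunction.vonMangoldt.residueClass (1 : ZMod q) (p ^ (k + 1)) / (p ^ (k + 1) : ℕ)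
        / Real.log (p ^ (k + 1) : ℕ)
      = if orderOf (p : ZMod q) ∣ k + 1 then ((p : ℝ)⁻¹) ^ (k + 1) / (k + 1 : ℝ) else 0 := by
  have hlog : Real.log p ≠ 0 := (Real.log_pos (by exact_mod_cast hp.one_lt)).ne'
  have hp0 : (p : ℝ) ≠ 0 := by exact_mod_cast hp.ne_zero
  have hk : ((k : ℝ) + 1) ≠ 0 := by positivity
  by_cases h : orderOf (p : ZMod q) ∣ k + 1
  · have h1 : p ^ (k + 1) ∈ {n : ℕ | (n : ZMod q) = 1} := by
      rw [Set.mem_ofPred_eq, Nat.cast_pow]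
      exact orderOf_dvd_iff_pow_eq_one.1 h
    rw [if_pos h, ArithmeticFunction.vonMangoldt.residueClass, Set.indicator_of_mem h1,
      ArithmeticFunction.vonMangoldt_apply_pow k.succ_ne_zero,
      ArithmeticFunction.vonMangoldt_apply_prime hp]
    push_cast
    rw [Real.log_pow, inv_pow]
    push_cast
    field_simp
  · have h1 : p ^ (k + 1) ∉ {n : ℕ | (n : ZMod q) = 1} := by
      rw [Set.mem_ofPred_eq, Nat.cast_pow]
      exact fun h' => h (orderOf_dvd_iff_pow_eq_one.2 h')
    rw [if_neg h, ArithmeticFunction.vonMangoldt.residueClass, Set.indicator_of_notMem h1]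
    simp

theorem hasSum_residueClass_one_prime_pow_div {p : ℕ} (hp : p.Prime) :
    HasSum (fun k : ℕ => ArithmeticFunction.vonMangoldt.residueClass (1 : ZMod q) (p ^ (k + 1))
        / (p ^ (k + 1) : ℕ) / Real.log (p ^ (k + 1) : ℕ))
      (-(orderOf (p : ZMod q) : ℝ)⁻¹ * Real.log (1 - ((p : ℝ)⁻¹) ^ orderOf (p : ZMod q))) := by
  simp_rw [residueClass_one_prime_pow_div hp]
  exact hasSum_dvd_pow_div_log (by positivity)
    (inv_lt_one_of_one_lt₀ (by exact_mod_cast hp.one_lt)) _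

/-- Summing a function supported on proper prime powers prime by prime. -/
theorem hasSum_prime_tsum_residueClass :
    HasSum (fun n : ℕ => if n.Prime then
        -(orderOf (n : ZMod q) : ℝ)⁻¹ * Real.log (1 - ((n : ℝ)⁻¹) ^ orderOf (n : ZMod q))
          - ArithmeticFunction.vonMangoldt.residueClass (1 : ZMod q) n / n / Real.log n else 0)
      (∑' n : ℕ, (if n.Prime then 0 else
        ArithmeticFunction.vonMangoldt.residueClass (1 : ZMod q) n) / n / Real.log n) := by
  set f : ℕ → ℝ := fun n =>
    ArithmeticFunction.vonMangoldt.residueClass (1 : ZMod q) n / n / Real.log n with hf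
  set h : ℕ → ℝ := fun n => (if n.Prime then 0 else
    ArithmeticFunction.vonMangoldt.residueClass (1 : ZMod q) n) / n / Real.log n with hh
  have hs : Summable h := summable_residueClass_non_primes_div_log 1
  have hsupp : Function.support h ⊆ {n | IsPrimePow n} := by
    intro n hn
    by_contra hpp
    refine hn ?_
    have : ArithmeticFunction.vonMangoldt.residueClass (1 : ZMod q) n = 0 := by
      refine le_antisymm ?_ (ArithmeticFunction.vonMangoldt.residueClass_nonneg _ n)
      refine (ArithmeticFunction.vonMangoldt.residueClass_le _ n).trans_eq ?_
      exact ArithmeticFunction.vonMangoldt_eq_zero_iff.2 hpp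
    simp [hh, this]
  have hfib : ∀ p : Nat.Primes, HasSum (fun k : ℕ => h (p ^ (k + 1)))
      (-(orderOf ((p : ℕ) : ZMod q) : ℝ)⁻¹ *
        Real.log (1 - (((p : ℕ) : ℝ)⁻¹) ^ orderOf ((p : ℕ) : ZMod q)) - f p) := by
    intro p
    refine ((hasSum_residueClass_one_prime_pow_div (q := q) p.2).sub
      (hasSum_ite_eq 0 (f p))).congr_fun fun k => ?_
    rcases Nat.eq_zero_or_pos k with rfl | hk
    · simp [hh, hf, p.2]
    · have : ¬ (((p : ℕ) ^ (k + 1)).Prime) := Nat.Prime.not_prime_pow (by omega)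
      simp [hh, this, hk.ne']
  have hprod : HasSum (fun x : Nat.Primes × ℕ => h (x.1 ^ (x.2 + 1))) (∑' n, h n) := by
    have h1 := hasSum_subtype_iff_of_support_subset hsupp |>.2 hs.hasSum
    exact (Equiv.hasSum_iff Nat.Primes.prodNatEquiv).2 h1
  have hprimes := hprod.prod_fiberwise hfib
  have h2 := (hasSum_subtype_iff_indicator (s := {p : ℕ | p.Prime}) (f := fun n : ℕ =>
    -(orderOf (n : ZMod q) : ℝ)⁻¹ * Real.log (1 - ((n : ℝ)⁻¹) ^ orderOf (n : ZMod q)) - f n)).1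
    hprimes
  refine h2.congr_fun fun n => ?_
  simp only [Set.indicator_apply, Set.mem_ofPred_eq, hf]

theorem sum_Icc_one_ite_prime (g : ℕ → ℝ) (N : ℕ) :
    ∑ n ∈ Icc 1 N, (if n.Prime then g n else 0) = ∑ p ∈ (N + 1).primesBelow, g p := by
  rw [← sum_filter]
  refine sum_congr ?_ fun _ _ => rfl
  ext n
  simp only [mem_filter, mem_Icc, Nat.mem_primesBelow, Nat.lt_succ_iff]
  exact ⟨fun h => ⟨h.1.2, h.2⟩, fun h => ⟨⟨h.2.one_lt.le, h.1⟩, h.2⟩⟩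

theorem HasSum.tendsto_sum_Icc_one {g : ℕ → ℝ} {s : ℝ} (hg : HasSum g s) (h0 : g 0 = 0) :
    Tendsto (fun N : ℕ => ∑ n ∈ Icc 1 N, g n) atTop (𝓝 s) := by
  refine ((tendsto_add_atTop_iff_nat 1).2 hg.tendsto_sum_nat).congr fun N => ?_
  rw [sum_Icc_one_eq_sum_range, sum_range_succ', h0, add_zero]

/-- **Mertens' theorem** for the local factors of `∏_χ L(s, χ)` modulo a prime `q`. -/
theorem exists_tendsto_sum_primesBelow_log :
    ∃ c : ℝ, Tendsto (fun N : ℕ => ∑ p ∈ (N + 1).primesBelow,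
        -(orderOf (p : ZMod q) : ℝ)⁻¹ * Real.log (1 - ((p : ℝ)⁻¹) ^ orderOf (p : ZMod q))
          - (q.totient : ℝ)⁻¹ * Real.log (Real.log N)) atTop (𝓝 c) ∧
      (Real.exp (q.totient * c - Real.eulerMascheroniConstant) : ℂ)
        = (1 - (q : ℂ)⁻¹) *
          ∏ χ ∈ (univ : Finset (DirichletCharacter ℂ q)).erase 1, χ.LFunction 1 := by
  obtain ⟨c, hc, hexp⟩ := exists_tendsto_sum_residueClass_one_div (q := q)
  refine ⟨c, ?_, hexp⟩
  have h1 := (hasSum_prime_tsum_residueClass (q := q)).tendsto_sum_Icc_one (by simp)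
  have h2 := (summable_residueClass_non_primes_div_log (1 : ZMod q)).hasSum.tendsto_sum_Icc_one
    (by simp)
  have h3 := (hc.add h1).sub h2
  rw [add_sub_cancel_right] at h3
  refine h3.congr fun N => ?_
  rw [← sum_Icc_one_ite_prime, sub_add_eq_add_sub, sub_right_comm, ← sum_add_distrib,
    ← sum_sub_distrib]
  congr 1
  refine sum_congr rfl fun n _ => ?_
  split_ifs <;> simp

end PrimePowers

section PrimeProducts

theorem prod_range_mulIndicator_eq_prod_primesBelow_filter (P : ℕ → Prop) [DecidablePred P]
    (g : ℕ → ℝ) (N : ℕ) :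
    ∏ n ∈ range N, {p : ℕ | p.Prime ∧ P p}.mulIndicator g n
      = ∏ p ∈ N.primesBelow.filter P, g p := by
  classical
  simp only [Set.mulIndicator_apply, Set.mem_ofPred_eq]
  rw [← prod_filter, ← filter_filter, Nat.primesBelow]

/-- Partial products over the primes satisfying `P` converge to the infinite product. -/
theorem tendsto_prod_primesBelow_filter {P : ℕ → Prop} [DecidablePred P] {g : ℕ → ℝ}
    (hg : Multipliable fun p : {p : ℕ // p.Prime ∧ P p} => g p) :
    Tendsto (fun N : ℕ => ∏ p ∈ (N + 1).primesBelow.filter P, g p) atTop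
      (𝓝 (∏' p : {p : ℕ // p.Prime ∧ P p}, g p)) := by
  have h := (hasProd_subtype_iff_mulIndicator (s := {p : ℕ | p.Prime ∧ P p})).1 hg.hasProd
  refine ((tendsto_add_atTop_iff_nat 1).2 h.tendsto_prod_nat).congr fun N => ?_
  exact prod_range_mulIndicator_eq_prod_primesBelow_filter P g (N + 1)

theorem multipliable_one_sub_one_div_pow_four (P : ℕ → Prop) :
    Multipliable fun p : {p : ℕ // p.Prime ∧ P p} => 1 - 1 / ((p : ℕ) : ℝ) ^ 4 := by
  have hs : Summable fun p : {p : ℕ // p.Prime ∧ P p} => 1 / ((p : ℕ) : ℝ) ^ 4 :=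
    (Real.summable_one_div_nat_pow.2 (by norm_num)).comp_injective Subtype.val_injective
  simp only [sub_eq_add_neg]
  refine multipliable_one_add_of_summable ?_
  simpa using hs

theorem multipliable_one_add_div_one_sub (P : ℕ → Prop) :
    Multipliable fun p : {p : ℕ // p.Prime ∧ P p} =>
      (1 + 1 / ((p : ℕ) : ℝ) ^ 2) / (1 - 1 / ((p : ℕ) : ℝ) ^ 2) := by
  have hs : Summable fun p : {p : ℕ // p.Prime ∧ P p} => 1 / ((p : ℕ) : ℝ) ^ 2 :=
    (Real.summable_one_div_nat_pow.2 (by norm_num)).comp_injective Subtype.val_injective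
  have hle : ∀ p : {p : ℕ // p.Prime ∧ P p}, 1 / ((p : ℕ) : ℝ) ^ 2 ≤ 1 / 4 := by
    intro p
    have h2 : (2 : ℝ) ≤ ((p : ℕ) : ℝ) := by exact_mod_cast p.2.1.two_le
    exact one_div_le_one_div_of_le (by norm_num) (by nlinarith)
  have e : ∀ p : {p : ℕ // p.Prime ∧ P p},
      (1 + 1 / ((p : ℕ) : ℝ) ^ 2) / (1 - 1 / ((p : ℕ) : ℝ) ^ 2)
        = 1 + 2 * (1 / ((p : ℕ) : ℝ) ^ 2) / (1 - 1 / ((p : ℕ) : ℝ) ^ 2) := by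
    intro p
    have h1 : 1 - 1 / ((p : ℕ) : ℝ) ^ 2 ≠ 0 := by linarith [hle p]
    rw [div_eq_iff h1, add_mul, div_mul_cancel₀ _ h1]
    ring
  simp only [e]
  refine multipliable_one_add_of_summable ((hs.mul_left 4).of_nonneg_of_le
    (fun _ => norm_nonneg _) fun p => ?_)
  have h0 : 0 ≤ 1 / ((p : ℕ) : ℝ) ^ 2 := by positivity
  have h1 : 0 < 1 - 1 / ((p : ℕ) : ℝ) ^ 2 := by linarith [hle p]
  rw [Real.norm_eq_abs, abs_of_nonneg (by positivity), div_le_iff₀ h1]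
  nlinarith [hle p]

theorem tendsto_prod_primesBelow_inv_one_sub_pow_four :
    Tendsto (fun N : ℕ => ∏ p ∈ (N + 1).primesBelow, (1 - 1 / (p : ℝ) ^ 4)⁻¹) atTop
      (𝓝 (Real.pi ^ 4 / 90)) := by
  have h := riemannZeta_eulerProduct (s := 4) (by norm_num)
  rw [riemannZeta_four] at h
  have h2 := (Complex.continuous_re.tendsto _).comp ((tendsto_add_atTop_iff_nat 1).2 h)
  have e : ((Real.pi : ℂ) ^ 4 / 90).re = Real.pi ^ 4 / 90 := by
    rw [show (Real.pi : ℂ) ^ 4 / 90 = ((Real.pi ^ 4 / 90 : ℝ) : ℂ) by push_cast; rfl,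
      Complex.ofReal_re]
  rw [e] at h2
  refine h2.congr fun N => ?_
  rw [Function.comp_apply, ← Complex.ofReal_re (∏ p ∈ (N + 1).primesBelow, (1 - 1 / (p : ℝ) ^ 4)⁻¹)]
  congr 1
  push_cast
  refine prod_congr rfl fun p _ => ?_
  rw [Complex.cpow_neg, one_div, show (4 : ℂ) = ((4 : ℕ) : ℂ) by norm_num, Complex.cpow_natCast]

end PrimeProducts

section ModFive

attribute [local instance] fact_prime_five

theorem one_sub_one_div_pow_pos {p : ℕ} (hp : p.Prime) {k : ℕ} (hk : k ≠ 0) :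
    0 < 1 - 1 / (p : ℝ) ^ k := by
  have h1 : (1 : ℝ) < p := by exact_mod_cast hp.one_lt
  rw [sub_pos, div_lt_one (by positivity)]
  exact one_lt_pow₀ h1 hk

/-- The local factor of `∏_χ L(1, χ)` modulo `5`, compared with that of `ζ(4)`. -/
theorem local_factor_mod_five {p : ℕ} (hp : p.Prime) :
    Real.exp (-4 * (-(orderOf (p : ZMod 5) : ℝ)⁻¹ *
        Real.log (1 - ((p : ℝ)⁻¹) ^ orderOf (p : ZMod 5))))
      * (1 - 1 / (p : ℝ) ^ 4)⁻¹ * (if p = 5 then 624 / 625 else 1)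
      * (if p % 5 = 1 then 1 - 1 / (p : ℝ) ^ 4 else 1)
      * (if p % 5 = 4 then (1 + 1 / (p : ℝ) ^ 2) / (1 - 1 / (p : ℝ) ^ 2) else 1)
      = if p % 5 = 1 then (1 - 1 / (p : ℝ)) ^ 4 else 1 := by
  have h1 := one_sub_one_div_pow_pos hp one_ne_zero
  have h2 := one_sub_one_div_pow_pos hp two_ne_zero
  have h4 := one_sub_one_div_pow_pos hp four_ne_zero
  rw [pow_one] at h1
  have hlt : p % 5 < 5 := Nat.mod_lt _ (by norm_num)
  have hcast : ((p % 5 : ℕ) : ZMod 5) = p := ZMod.natCast_mod p 5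
  obtain ⟨r, hr⟩ : ∃ r, p % 5 = r := ⟨_, rfl⟩
  have hp5 : p = 5 ↔ r = 0 := by
    constructor
    · rintro rfl
      omega
    · intro h
      exact ((Nat.prime_dvd_prime_iff_eq (by norm_num) hp).1
        (Nat.dvd_of_mod_eq_zero (hr.trans h))).symm
  rw [← hcast]
  simp only [hr, hp5]
  rw [hr] at hlt
  have ho2 : orderOf (2 : ZMod 5) = 4 :=
    orderOf_eq_prime_pow (p := 2) (n := 1) (by decide) (by decide)
  have ho3 : orderOf (3 : ZMod 5) = 4 :=
    orderOf_eq_prime_pow (p := 2) (n := 1) (by decide) (by decide)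
  have ho4 : orderOf (4 : ZMod 5) = 2 := orderOf_eq_prime (by decide) (by decide)
  have hexp : ∀ d k : ℕ, d * k = 4 → 0 < 1 - 1 / (p : ℝ) ^ d →
      Real.exp (-4 * (-(d : ℝ)⁻¹ * Real.log (1 - ((p : ℝ)⁻¹) ^ d)))
        = (1 - 1 / (p : ℝ) ^ d) ^ k := by
    intro d k hdk hy
    have hd : (d : ℝ) ≠ 0 := by
      rintro h
      rw [Nat.cast_eq_zero.1 h, zero_mul] at hdk
      norm_num at hdk
    have hdk' : (d : ℝ) * k = 4 := by exact_mod_cast hdk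
    rw [inv_pow, ← one_div ((p : ℝ) ^ d), ← Real.exp_log (pow_pos hy k), Real.log_pow, ← hdk']
    congr 1
    field_simp
  interval_cases r
  · have h5 : p = 5 := hp5.2 rfl
    subst h5
    norm_num
  · rw [Nat.cast_one, orderOf_one, hexp 1 4 rfl (by simpa using h1), pow_one]
    simp only [one_ne_zero, if_false, if_true, mul_one, OfNat.one_ne_ofNat]
    rw [inv_mul_cancel_right₀ h4.ne']
  · rw [Nat.cast_ofNat, ho2, hexp 4 1 rfl h4]
    simp only [pow_one, mul_inv_cancel₀ h4.ne']
    norm_num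
  · rw [Nat.cast_ofNat, ho3, hexp 4 1 rfl h4]
    simp only [pow_one, mul_inv_cancel₀ h4.ne']
    norm_num
  · rw [Nat.cast_ofNat, ho4, hexp 2 2 rfl h2]
    have e : 1 - 1 / (p : ℝ) ^ 4 = (1 - 1 / (p : ℝ) ^ 2) * (1 + 1 / (p : ℝ) ^ 2) := by ring
    have h2' : 0 < 1 + 1 / (p : ℝ) ^ 2 := by positivity
    rw [e]
    generalize 1 - 1 / (p : ℝ) ^ 2 = a at *
    generalize 1 + 1 / (p : ℝ) ^ 2 = b at *
    norm_num
    field_simp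

/-- The finite form of the identity for `C(5, 1)⁴`. -/
theorem prod_one_sub_inv_pow_four_mod_five {N : ℕ} (hN : 5 ≤ N) :
    (∏ p ∈ (N + 1).primesBelow.filter (fun p => p % 5 = 1), (1 - 1 / (p : ℝ))) ^ 4
      = Real.exp (-4 * ∑ p ∈ (N + 1).primesBelow, -(orderOf (p : ZMod 5) : ℝ)⁻¹ *
          Real.log (1 - ((p : ℝ)⁻¹) ^ orderOf (p : ZMod 5)))
        * (∏ p ∈ (N + 1).primesBelow, (1 - 1 / (p : ℝ) ^ 4)⁻¹) * (624 / 625)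
        * (∏ p ∈ (N + 1).primesBelow.filter (fun p => p % 5 = 1), (1 - 1 / (p : ℝ) ^ 4))
        * (∏ p ∈ (N + 1).primesBelow.filter (fun p => p % 5 = 4),
            (1 + 1 / (p : ℝ) ^ 2) / (1 - 1 / (p : ℝ) ^ 2)) := by
  have h5 : 5 ∈ (N + 1).primesBelow := Nat.mem_primesBelow.2 ⟨by omega, by norm_num⟩
  have h := prod_congr (rfl : (N + 1).primesBelow = (N + 1).primesBelow) fun p hp =>
    local_factor_mod_five (Nat.prime_of_mem_primesBelow hp)
  simp only [prod_mul_distrib, ← Real.exp_sum, ← mul_sum, prod_ite_eq', h5, if_true,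
    ← prod_filter, prod_pow] at h
  exact h.symm

theorem log_goldenRatio_pos : 0 < Real.log ((1 + √5) / 2) := by
  apply Real.log_pos
  have : (1 : ℝ) < √5 := Real.lt_sqrt_of_sq_lt (by norm_num)
  linarith

theorem const_eq_of_exp_eq {c : ℝ} (hc : Real.exp (4 * c - Real.eulerMascheroniConstant)
      = (1 - 5⁻¹) * (2 * Real.log ((1 + √5) / 2) / √5 * (2 * Real.pi ^ 2 / 25))) :
    13 * √5 * Real.pi ^ 2 * Real.exp (-Real.eulerMascheroniConstant) /
        (150 * Real.log ((1 + √5) / 2))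
      = Real.exp (-4 * c) * (Real.pi ^ 4 / 90) * (624 / 625) := by
  have e : Real.exp (-4 * c) * Real.exp (4 * c - Real.eulerMascheroniConstant)
      = Real.exp (-Real.eulerMascheroniConstant) := by
    rw [← Real.exp_add]
    ring_nf
  have hl := log_goldenRatio_pos.ne'
  have hs0 : √5 ≠ (0 : ℝ) := by positivity
  rw [← e, hc]
  generalize Real.log ((1 + √5) / 2) = l at *
  generalize √5 = s at *
  generalize Real.exp (-4 * c) = E at *
  field_simp
  ring

theorem tendsto_log_mul_prod_pow_four_mod_five :
    Tendsto (fun N : ℕ => Real.log N *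
        (∏ p ∈ (N + 1).primesBelow.filter (fun p => p % 5 = 1), (1 - 1 / (p : ℝ))) ^ 4)
      atTop (𝓝 (13 * √5 * Real.pi ^ 2 * Real.exp (-Real.eulerMascheroniConstant) /
          (150 * Real.log ((1 + √5) / 2)) *
        (∏' p : {p : ℕ // p.Prime ∧ p % 5 = 1}, (1 - 1 / ((p : ℕ) : ℝ) ^ 4)) *
        (∏' p : {p : ℕ // p.Prime ∧ p % 5 = 4},
          (1 + 1 / ((p : ℕ) : ℝ) ^ 2) / (1 - 1 / ((p : ℕ) : ℝ) ^ 2)))) := by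
  obtain ⟨c, hc, hce⟩ := exists_tendsto_sum_primesBelow_log (q := 5)
  rw [prod_LFunction_one_mod_five] at hce
  have ht : Nat.totient 5 = 4 := Nat.totient_prime (by norm_num)
  rw [ht] at hc hce
  simp only [Nat.cast_ofNat] at hc hce
  have hce' : Real.exp (4 * c - Real.eulerMascheroniConstant)
      = (1 - 5⁻¹) * (2 * Real.log ((1 + √5) / 2) / √5 * (2 * Real.pi ^ 2 / 25)) := by
    apply Complex.ofReal_injective
    rw [Complex.ofReal_mul, Complex.ofReal_sub, Complex.ofReal_inv, Complex.ofReal_one,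
      Complex.ofReal_ofNat]
    exact hce
  have hlim := const_eq_of_exp_eq hce'
  rw [hlim]
  have hexp := (Real.continuous_exp.tendsto (-4 * c)).comp (hc.const_mul (-4))
  have h1 := tendsto_prod_primesBelow_filter (P := fun p => p % 5 = 1)
    (g := fun p => 1 - 1 / (p : ℝ) ^ 4) (multipliable_one_sub_one_div_pow_four _)
  have h4 := tendsto_prod_primesBelow_filter (P := fun p => p % 5 = 4)
    (g := fun p => (1 + 1 / (p : ℝ) ^ 2) / (1 - 1 / (p : ℝ) ^ 2))
    (multipliable_one_add_div_one_sub _)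
  have hall := (((hexp.mul tendsto_prod_primesBelow_inv_one_sub_pow_four).mul_const
    (624 / 625)).mul h1).mul h4
  refine hall.congr' ?_
  filter_upwards [eventually_ge_atTop 5] with N hN
  have hlog : 0 < Real.log N := Real.log_pos (by exact_mod_cast (by omega : 1 < N))
  rw [prod_one_sub_inv_pow_four_mod_five hN, Function.comp_apply,
    mul_sub, show ∀ a : ℝ, -4 * (4⁻¹ * a) = -a by intro a; ring, sub_neg_eq_add,
    Real.exp_add, Real.exp_log hlog]
  ring

end ModFive

/-- **The formula for `C(5,1)`:**
`log x · (∏_{p ≤ x, p ≡ 1 (5)} (1 - 1/p))⁴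
  → (13√5 π² e^{-γ} / (150 log((1+√5)/2))) ∏_{p ≡ 1 (5)} (1 - 1/p⁴)
      ∏_{p ≡ 4 (5)} (1 + p⁻²)/(1 - p⁻²)`,
both infinite products over primes being absolutely convergent. -/
theorem languasco_zaccagnini_C51 :
    Multipliable (fun p : {p : ℕ // p.Prime ∧ p % 5 = 1} =>
      1 - 1 / ((p : ℕ) : ℝ) ^ 4) ∧
    Multipliable (fun p : {p : ℕ // p.Prime ∧ p % 5 = 4} =>
      (1 + 1 / ((p : ℕ) : ℝ) ^ 2) / (1 - 1 / ((p : ℕ) : ℝ) ^ 2)) ∧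
    Tendsto (fun x : ℝ => Real.log x *
        (∏ p ∈ (Nat.floor x + 1).primesBelow.filter (fun p => p % 5 = 1),
          (1 - 1 / (p : ℝ))) ^ 4)
      atTop (𝓝 (13 * Real.sqrt 5 * Real.pi ^ 2 * Real.exp (-Real.eulerMascheroniConstant) /
          (150 * Real.log ((1 + Real.sqrt 5) / 2)) *
        (∏' p : {p : ℕ // p.Prime ∧ p % 5 = 1}, (1 - 1 / ((p : ℕ) : ℝ) ^ 4)) *
        (∏' p : {p : ℕ // p.Prime ∧ p % 5 = 4},
          (1 + 1 / ((p : ℕ) : ℝ) ^ 2) / (1 - 1 / ((p : ℕ) : ℝ) ^ 2)))) := by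
  refine ⟨multipliable_one_sub_one_div_pow_four _, multipliable_one_add_div_one_sub _, ?_⟩
  have h := (tendsto_log_mul_prod_pow_four_mod_five.comp (tendsto_nat_floor_atTop (α := ℝ))).mul
    (tendsto_log_natFloor_div_log.inv₀ one_ne_zero)
  rw [inv_one, mul_one] at h
  refine h.congr' ?_
  filter_upwards [eventually_ge_atTop 2] with x hx
  have hlog : Real.log ⌊x⌋₊ ≠ 0 :=
    (Real.log_pos (by exact_mod_cast (Nat.le_floor hx : 2 ≤ ⌊x⌋₊))).ne'
  rw [Function.comp_apply, inv_div]
  field_simp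
end

section
/- The product of the values at s = 1 of the Dirichlet L-functions of the three non-principal Dirichlet characters modulo 8 equals π² · log(3 + 2√2) / 32; equivalently, Π(8, 1) = ∏_{χ mod 8, χ ≠ χ₀} L(1, χ)^{−1} = 32 · π^{−2} · ( log(3 + 2√2) )^{−1}. -/
open Finset

section PeriodicLFunction

open Filter Topology

/-- A Lipschitz-type bound for `x ↦ x ^ (-s)` on `[1, ∞)`, uniform in `s ∈ [1, 2]`. -/
lemma abs_rpow_neg_sub_rpow_neg_le {x y s : ℝ} (hy : 1 ≤ y) (hyx : y ≤ x)
    (hs₁ : 1 ≤ s) (hs₂ : s ≤ 2) :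
    |x ^ (-s) - y ^ (-s)| ≤ 2 * (x - y) / y ^ 2 := by
  have hy₀ : 0 < y := by linarith
  have hx₀ : 0 < x := by linarith
  have hmono : x ^ (-s) ≤ y ^ (-s) := Real.rpow_le_rpow_of_nonpos hy₀ hyx (by linarith)
  have hfactor : x ^ (-s) = y ^ (-s) * (y / x) ^ s := by
    rw [Real.div_rpow hy₀.le hx₀.le, Real.rpow_neg hx₀.le, Real.rpow_neg hy₀.le]
    field_simp
  have hratio : (y / x) ^ 2 ≤ (y / x) ^ s := by
    rw [← Real.rpow_natCast]
    exact Real.rpow_le_rpow_of_exponent_ge (by positivity) ((div_le_one hx₀).2 hyx)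
      (by exact_mod_cast hs₂)
  have hy_inv : y ^ (-s) ≤ y⁻¹ := by
    rw [← Real.rpow_neg_one]
    exact Real.rpow_le_rpow_of_exponent_le hy (by linarith)
  have hgap : 1 - (y / x) ^ 2 ≤ 2 * (x - y) / y := by
    have h₁ : 1 - (y / x) ^ 2 ≤ 2 * (1 - y / x) := by nlinarith [sq_nonneg (1 - y / x)]
    have h₂ : 1 - y / x = (x - y) / x := by field_simp
    have h₃ : (x - y) / x ≤ (x - y) / y :=
      div_le_div_of_nonneg_left (by linarith) hy₀ hyx
    rw [mul_div_assoc]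
    linarith
  rw [abs_sub_comm, abs_of_nonneg (by linarith)]
  calc y ^ (-s) - x ^ (-s) = y ^ (-s) * (1 - (y / x) ^ s) := by rw [hfactor]; ring
    _ ≤ y ^ (-s) * (2 * (x - y) / y) := by gcongr; linarith
    _ ≤ y⁻¹ * (2 * (x - y) / y) := by
      have : 0 ≤ x - y := by linarith
      gcongr
    _ = 2 * (x - y) / y ^ 2 := by field_simp

variable {N : ℕ} [NeZero N]

/-- The sums of `Φ n * n ^ (-s)` over the blocks of length `N` are `O(m⁻²)`, uniformly for
`s ∈ [1, 2]`, when `Φ` has mean zero. -/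
lemma norm_sum_mul_rpow_neg_le {Φ : ZMod N → ℂ} (hΦ : ∑ j, Φ j = 0) {s : ℝ}
    (hs₁ : 1 ≤ s) (hs₂ : s ≤ 2) (m : ℕ) :
    ‖∑ j : ZMod N, Φ j * (((j.val + N * m : ℝ) ^ (-s) : ℝ) : ℂ)‖
      ≤ (∑ j : ZMod N, ‖Φ j‖) * 8 * (1 / ((m + 1 : ℕ) : ℝ) ^ 2) := by
  rw [mul_assoc, sum_mul]
  rcases Nat.eq_zero_or_pos m with rfl | hm
  · refine norm_sum_le_of_le _ fun j _ => ?_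
    rw [norm_mul, Complex.norm_real]
    gcongr
    simp only [Nat.cast_zero, mul_zero, add_zero, zero_add, Nat.cast_one, one_pow, div_one,
      mul_one]
    rcases Nat.eq_zero_or_pos j.val with hj | hj
    · rw [hj, Nat.cast_zero, Real.zero_rpow (by linarith)]
      norm_num
    · rw [Real.norm_of_nonneg (by positivity)]
      have := Real.rpow_le_one_of_one_le_of_nonpos (x := (j.val : ℝ)) (z := -s)
        (by exact_mod_cast hj) (by linarith)
      linarith
  · have hN : (1 : ℝ) ≤ N := by exact_mod_cast NeZero.pos N
    have hm' : (1 : ℝ) ≤ m := by exact_mod_cast hm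
    have hcenter : ∑ j : ZMod N, Φ j * (((j.val + N * m : ℝ) ^ (-s) : ℝ) : ℂ)
        = ∑ j : ZMod N, Φ j *
          (((j.val + N * m : ℝ) ^ (-s) - (N * m : ℝ) ^ (-s) : ℝ) : ℂ) := by
      simp only [Complex.ofReal_sub, mul_sub, sum_sub_distrib, ← sum_mul, hΦ, zero_mul, sub_zero]
    rw [hcenter]
    refine norm_sum_le_of_le _ fun j _ => ?_
    rw [norm_mul, Complex.norm_real, Real.norm_eq_abs]
    gcongr
    have hj : (j.val : ℝ) ≤ N := by exact_mod_cast (ZMod.val_lt j).le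
    refine (abs_rpow_neg_sub_rpow_neg_le (one_le_mul_of_one_le_of_one_le hN hm')
      (le_add_of_nonneg_left (Nat.cast_nonneg _)) hs₁ hs₂).trans ?_
    push_cast
    rw [mul_one_div, div_le_div_iff₀ (by positivity) (by positivity), add_sub_cancel_right]
    have h₁ : ((m : ℝ) + 1) ^ 2 ≤ (2 * m) ^ 2 := by gcongr; linarith
    have h₂ : (j.val : ℝ) ≤ N ^ 2 := by nlinarith
    calc 2 * (j.val : ℝ) * ((m : ℝ) + 1) ^ 2 ≤ 2 * N ^ 2 * (2 * m) ^ 2 := by gcongr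
      _ = 8 * (N * m : ℝ) ^ 2 := by ring

/-- If `Φ` has mean zero, then its `L`-function at `s = 1` is the sum of the series
`∑ Φ n / n`, grouped into blocks of length `N`. -/
theorem hasSum_LFunction_one {Φ : ZMod N → ℂ} (hΦ : ∑ j, Φ j = 0) :
    HasSum (fun m : ℕ => ∑ j : ZMod N, Φ j * (((j.val + N * m : ℝ)⁻¹ : ℝ) : ℂ))
      (ZMod.LFunction Φ 1) := by
  set block : ℝ → ℕ → ℂ := fun s m =>
    ∑ j : ZMod N, Φ j * (((j.val + N * m : ℝ) ^ (-s) : ℝ) : ℂ) with hblock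
  have hbound : Summable fun m : ℕ =>
      (∑ j : ZMod N, ‖Φ j‖) * 8 * (1 / ((m + 1 : ℕ) : ℝ) ^ 2) :=
    ((summable_nat_add_iff 1).2 (Real.summable_one_div_nat_pow.2 one_lt_two)).mul_left _
  have hseries : ∀ s : ℝ, 1 < s → ZMod.LFunction Φ s = ∑' m, block s m := by
    intro s hs
    have hs' : 1 < (s : ℂ).re := by simpa using hs
    have hterm : ∀ (j : ZMod N) (m : ℕ), LSeries.term (Φ ·) s (j.val + N * m)
        = Φ j * (((j.val + N * m : ℝ) ^ (-s) : ℝ) : ℂ) := by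
      intro j m
      rw [LSeries.term_of_ne_zero' (Complex.ne_zero_of_one_lt_re hs'),
        Complex.ofReal_cpow (by positivity), Complex.ofReal_neg, Complex.cpow_neg, div_eq_mul_inv]
      simp only [Nat.cast_add, Nat.cast_mul, ZMod.natCast_zmod_val, ZMod.natCast_self, zero_mul,
        add_zero, Complex.ofReal_add, Complex.ofReal_mul, Complex.ofReal_natCast]
    have hsum := ZMod.LSeriesSummable_of_one_lt_re Φ hs'
    rw [ZMod.LFunction_eq_LSeries Φ hs', LSeries, Nat.sumByResidueClasses hsum N]
    simp_rw [hterm]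
    refine (Summable.tsum_finsetSum fun j _ => ?_).symm
    have hinj : Function.Injective fun m : ℕ => j.val + N * m := fun a b hab => by
      simpa [NeZero.ne N] using hab
    exact (hsum.comp_injective hinj).congr fun m => hterm j m
  have hlim : Tendsto (fun s : ℝ => ∑' m, block s m) (𝓝[>] 1) (𝓝 (∑' m, block 1 m)) := by
    refine tendsto_tsum_of_dominated_convergence hbound (fun m => ?_) ?_
    · refine tendsto_finsetSum _ fun j _ => Tendsto.const_mul _ ?_
      refine (Complex.continuous_ofReal.tendsto _).comp ?_
      rcases eq_or_ne (j.val + N * m : ℝ) 0 with h | h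
      · rw [h, Real.zero_rpow (by norm_num)]
        refine tendsto_const_nhds.congr' ?_
        filter_upwards [self_mem_nhdsWithin] with s hs
        rw [Real.zero_rpow]
        have : (1 : ℝ) < s := hs
        linarith
      · exact ((Real.continuousAt_const_rpow h).tendsto.comp
          (continuous_neg.tendsto (1 : ℝ))).mono_left nhdsWithin_le_nhds
    · filter_upwards [Ioc_mem_nhdsGT (one_lt_two (α := ℝ))] with s hs m
      exact norm_sum_mul_rpow_neg_le hΦ hs.1.le hs.2 m
  have hcont : Tendsto (fun s : ℝ => ZMod.LFunction Φ s) (𝓝[>] 1) (𝓝 (ZMod.LFunction Φ 1)) := by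
    have h := ((ZMod.differentiable_LFunction_of_sum_zero hΦ).continuous.comp
      Complex.continuous_ofReal).tendsto 1
    simpa [Function.comp_def] using h.mono_left nhdsWithin_le_nhds
  have hvalue : ZMod.LFunction Φ 1 = ∑' m, block 1 m :=
    tendsto_nhds_unique_of_eventuallyEq hcont hlim
      (eventually_nhdsWithin_of_forall fun s hs => hseries s hs)
  have hsummable : Summable (block 1) :=
    .of_norm_bounded hbound fun m => norm_sum_mul_rpow_neg_le hΦ le_rfl one_le_two m
  rw [hvalue]
  simpa only [hblock, Real.rpow_neg_one] using hsummable.hasSum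

/-- If `F` is a primitive on `[0, 1]` of `f = (∑ c j x ^ (j - 1)) / (1 - x ^ N)`, where `c` is
periodic of mean zero, then the `L`-function of `c` at `s = 1` is `F 1 - F 0`. -/
theorem LFunction_one_eq_sub {c : ZMod N → ℝ} (hc₀ : c 0 = 0) (hc : ∑ j, c j = 0)
    {F f : ℝ → ℝ} (hF : ∀ x ∈ Set.Icc (0 : ℝ) 1, HasDerivAt F (f x) x)
    (hf : ContinuousOn f (Set.Icc 0 1))
    (hfc : ∀ x ∈ Set.Icc (0 : ℝ) 1, f x * (1 - x ^ N) = ∑ j, c j * x ^ (j.val - 1)) :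
    ZMod.LFunction (fun j => (c j : ℂ)) 1 = ((F 1 - F 0 : ℝ) : ℂ) := by
  set S : ℕ → ℝ → ℝ := fun n x =>
    ∑ m ∈ range n, ∑ j, c j * (x ^ (j.val + N * m) * (j.val + N * m : ℝ)⁻¹) with hS
  have hS_deriv : ∀ n, ∀ x ∈ Set.Icc (0 : ℝ) 1,
      HasDerivAt (S n) (f x * (1 - x ^ (N * n))) x := by
    intro n x hx
    have hsum : f x * (1 - x ^ (N * n))
        = ∑ m ∈ range n, ∑ j, c j * x ^ (j.val + N * m - 1) := by
      have hgeom : ∀ m, ∑ j, c j * x ^ (j.val + N * m - 1) = f x * (1 - x ^ N) * (x ^ N) ^ m := by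
        intro m
        rw [hfc x hx, sum_mul]
        refine sum_congr rfl fun j _ => ?_
        rcases eq_or_ne j 0 with rfl | hj
        · simp [hc₀]
        · have hj' : 0 < j.val := ZMod.val_pos.2 hj
          rw [mul_assoc, ← pow_mul, ← pow_add]
          congr 2
          omega
      simp_rw [hgeom]
      rw [← mul_sum, mul_assoc, mul_neg_geom_sum, pow_mul]
    rw [hsum]
    refine HasDerivAt.fun_sum fun m _ => HasDerivAt.fun_sum fun j _ => ?_
    rcases eq_or_ne j 0 with rfl | hj
    · simpa [hc₀] using hasDerivAt_const x (0 : ℝ)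
    · have hj' : 0 < j.val := ZMod.val_pos.2 hj
      have hne : (j.val + N * m : ℝ) ≠ 0 := by positivity
      refine HasDerivAt.const_mul _ ?_
      convert (hasDerivAt_pow (j.val + N * m) x).mul_const (j.val + N * m : ℝ)⁻¹ using 1
      push_cast
      field_simp
  have hS_zero : ∀ n, S n 0 = 0 := by
    intro n
    refine sum_eq_zero fun m _ => sum_eq_zero fun j _ => ?_
    rcases eq_or_ne j 0 with rfl | hj
    · simp [hc₀]
    · simp [hj]
  obtain ⟨C, hC⟩ := isCompact_Icc.exists_bound_of_continuousOn hf
  have herror : ∀ n : ℕ, ‖S n 1 - (F 1 - F 0)‖ ≤ C * (1 / ((N * n : ℕ) + 1 : ℝ)) := by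
    intro n
    have hint : ∫ x in (0 : ℝ)..1, f x * x ^ (N * n) = (F 1 - S n 1) - (F 0 - S n 0) := by
      refine intervalIntegral.integral_eq_sub_of_hasDerivAt (f := fun x => F x - S n x)
        (fun x hx => ?_) ?_
      · rw [Set.uIcc_of_le zero_le_one] at hx
        exact ((hF x hx).sub (hS_deriv n x hx)).congr_deriv (by ring)
      · refine ContinuousOn.intervalIntegrable ?_
        rw [Set.uIcc_of_le zero_le_one]
        exact hf.mul (by fun_prop)
    have hnorm : ‖∫ x in (0 : ℝ)..1, f x * x ^ (N * n)‖
        ≤ ∫ x in (0 : ℝ)..1, C * x ^ (N * n) := by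
      refine intervalIntegral.norm_integral_le_of_norm_le zero_le_one ?_
        (Continuous.intervalIntegrable (by fun_prop) _ _)
      filter_upwards with x hx
      rw [norm_mul, norm_pow, Real.norm_of_nonneg hx.1.le]
      have := hx.1.le
      gcongr
      exact hC x ⟨hx.1.le, hx.2⟩
    rw [intervalIntegral.integral_const_mul, integral_pow, hint, hS_zero] at hnorm
    rw [norm_sub_rev, sub_right_comm]
    simpa using hnorm
  have htendsto : Tendsto (fun n => S n 1) atTop (𝓝 (F 1 - F 0)) := by
    rw [tendsto_iff_norm_sub_tendsto_zero]
    refine squeeze_zero (fun _ => norm_nonneg _) herror ?_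
    have := (tendsto_one_div_add_atTop_nhds_zero_nat (𝕜 := ℝ)).comp
      (tendsto_id.const_mul_atTop' (NeZero.pos N))
    simpa using this.const_mul C
  have hL := (hasSum_LFunction_one (Φ := fun j => (c j : ℂ))
    (by exact_mod_cast hc)).tendsto_sum_nat
  refine tendsto_nhds_unique hL ?_
  convert (Complex.continuous_ofReal.tendsto _).comp htendsto using 1
  ext n
  simp [hS]

end PeriodicLFunction

section CharactersModEight

/-- The even primitive character modulo `8`. -/
noncomputable def evenCharEight : DirichletCharacter ℂ 8 :=
  ZMod.χ₈.ringHomComp (Int.castRingHom ℂ)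

/-- The odd primitive character modulo `8`. -/
noncomputable def oddCharEight : DirichletCharacter ℂ 8 :=
  ZMod.χ₈'.ringHomComp (Int.castRingHom ℂ)

/-- The character modulo `8` induced by the non-principal character modulo `4`. -/
noncomputable def imprimitiveCharEight : DirichletCharacter ℂ 8 :=
  (ZMod.χ₈ * ZMod.χ₈').ringHomComp (Int.castRingHom ℂ)

lemma LFunction_ringHomComp_one_eq_sub (χ : MulChar (ZMod 8) ℤ) (hχ : ∑ j, χ j = 0)
    {F f : ℝ → ℝ} (hF : ∀ x, HasDerivAt F (f x) x) (hf : Continuous f)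
    (hfχ : ∀ x, f x * (1 - x ^ 8) = χ 1 + χ 3 * x ^ 2 + χ 5 * x ^ 4 + χ 7 * x ^ 6) :
    DirichletCharacter.LFunction (χ.ringHomComp (Int.castRingHom ℂ) : DirichletCharacter ℂ 8) 1
      = ((F 1 - F 0 : ℝ) : ℂ) := by
  have hχ₀ : χ 0 = 0 := χ.map_nonunit (by decide)
  have hχ₂ : χ 2 = 0 := χ.map_nonunit (by decide)
  have hχ₄ : χ 4 = 0 := χ.map_nonunit (by decide)
  have hχ₆ : χ 6 = 0 := χ.map_nonunit (by decide)
  have hpoly : ∀ x : ℝ, f x * (1 - x ^ 8) = ∑ j, (χ j : ℝ) * x ^ (j.val - 1) := by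
    intro x
    have hsum : ∑ j, (χ j : ℝ) * x ^ (j.val - 1) = χ 0 * x ^ 0 + χ 1 * x ^ 0 + χ 2 * x ^ 1
        + χ 3 * x ^ 2 + χ 4 * x ^ 3 + χ 5 * x ^ 4 + χ 6 * x ^ 5 + χ 7 * x ^ 6 :=
      Fin.sum_univ_eight fun j : ZMod 8 => (χ j : ℝ) * x ^ (j.val - 1)
    rw [hsum, hfχ, hχ₀, hχ₂, hχ₄, hχ₆]
    push_cast
    ring
  exact LFunction_one_eq_sub (N := 8) (c := fun j => (χ j : ℝ)) (F := F) (f := f)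
    (by exact_mod_cast hχ₀) (by exact_mod_cast hχ) (fun x _ => hF x) hf.continuousOn
    (fun x _ => hpoly x)

lemma LFunction_imprimitiveCharEight_one :
    DirichletCharacter.LFunction imprimitiveCharEight 1 = ((Real.pi / 4 : ℝ) : ℂ) := by
  rw [imprimitiveCharEight, LFunction_ringHomComp_one_eq_sub (F := Real.arctan)
    (f := fun x => 1 / (1 + x ^ 2)) _ (by decide) (fun x => Real.hasDerivAt_arctan x)]
  · simp
  · exact continuous_const.div (by fun_prop) fun x => by positivity
  · intro x
    have h₁ : (ZMod.χ₈ * ZMod.χ₈') 1 = 1 := by decide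
    have h₃ : (ZMod.χ₈ * ZMod.χ₈') 3 = -1 := by decide
    have h₅ : (ZMod.χ₈ * ZMod.χ₈') 5 = 1 := by decide
    have h₇ : (ZMod.χ₈ * ZMod.χ₈') 7 = -1 := by decide
    rw [h₁, h₃, h₅, h₇]
    push_cast
    field_simp
    ring

lemma LFunction_oddCharEight_one :
    DirichletCharacter.LFunction oddCharEight 1 = ((Real.pi / (2 * √2) : ℝ) : ℂ) := by
  have hsq : √2 ^ 2 = (2 : ℝ) := Real.sq_sqrt zero_le_two
  rw [oddCharEight, LFunction_ringHomComp_one_eq_sub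
    (F := fun x => (Real.arctan (√2 * x + 1) + Real.arctan (√2 * x - 1)) / √2)
    (f := fun x => (1 + x ^ 2) / (1 + x ^ 4)) _ (by decide)]
  · have hinv : √2 - 1 = (√2 + 1)⁻¹ :=
      eq_inv_of_mul_eq_one_left (by linear_combination hsq)
    rw [mul_one, hinv, Real.arctan_inv_of_pos (by positivity)]
    congr 1
    simp only [mul_zero, zero_add, zero_sub, Real.arctan_neg, add_neg_cancel]
    field_simp
    ring
  · intro x
    have hplus : HasDerivAt (fun x : ℝ => √2 * x + 1) √2 x := by
      simpa using ((hasDerivAt_id x).const_mul √2).add_const 1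
    have hminus : HasDerivAt (fun x : ℝ => √2 * x - 1) √2 x := by
      simpa using ((hasDerivAt_id x).const_mul √2).sub_const 1
    refine ((hplus.arctan.add hminus.arctan).div_const √2).congr_deriv ?_
    have h₁ : 1 + (√2 * x + 1) ^ 2 ≠ 0 := by positivity
    have h₂ : 1 + (√2 * x - 1) ^ 2 ≠ 0 := by positivity
    have h₃ : 1 + x ^ 4 ≠ 0 := by positivity
    have hprod : (1 + (√2 * x + 1) ^ 2) * (1 + (√2 * x - 1) ^ 2) = 4 * (1 + x ^ 4) := by
      linear_combination (x ^ 4 * (√2 ^ 2 + 2)) * hsq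
    have hsum : (1 + (√2 * x + 1) ^ 2) + (1 + (√2 * x - 1) ^ 2) = 4 * (1 + x ^ 2) := by
      linear_combination 2 * x ^ 2 * hsq
    rw [← add_mul, mul_div_cancel_right₀ _ (by positivity), one_div_add_one_div h₁ h₂, hprod, hsum,
      mul_div_mul_left _ _ four_ne_zero]
  · exact Continuous.div (by fun_prop) (by fun_prop) fun x => by positivity
  · intro x
    have h₁ : ZMod.χ₈' 1 = 1 := by decide
    have h₃ : ZMod.χ₈' 3 = 1 := by decide
    have h₅ : ZMod.χ₈' 5 = -1 := by decide
    have h₇ : ZMod.χ₈' 7 = -1 := by decide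
    rw [h₁, h₃, h₅, h₇]
    push_cast
    field_simp
    ring

lemma LFunction_evenCharEight_one :
    DirichletCharacter.LFunction evenCharEight 1
      = ((Real.log (3 + 2 * √2) / (2 * √2) : ℝ) : ℂ) := by
  have hsq : √2 ^ 2 = (2 : ℝ) := Real.sq_sqrt zero_le_two
  have hpos_plus : ∀ x : ℝ, 0 < x ^ 2 + √2 * x + 1 := fun x => by
    nlinarith [sq_nonneg (√2 * x + 1)]
  have hpos_minus : ∀ x : ℝ, 0 < x ^ 2 - √2 * x + 1 := fun x => by
    nlinarith [sq_nonneg (√2 * x - 1)]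
  rw [evenCharEight, LFunction_ringHomComp_one_eq_sub
    (F := fun x => (Real.log (x ^ 2 + √2 * x + 1) - Real.log (x ^ 2 - √2 * x + 1)) / (2 * √2))
    (f := fun x => (1 - x ^ 2) / (1 + x ^ 4)) _ (by decide)]
  · rw [← Real.log_div (hpos_plus 1).ne' (hpos_minus 1).ne']
    have hratio : (1 ^ 2 + √2 * 1 + 1) / (1 ^ 2 - √2 * 1 + 1) = 3 + 2 * √2 := by
      rw [div_eq_iff (hpos_minus 1).ne']
      linear_combination 2 * hsq
    rw [hratio]
    simp
  · intro x
    have hplus : HasDerivAt (fun x : ℝ => x ^ 2 + √2 * x + 1) (2 * x + √2) x := by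
      simpa using ((hasDerivAt_pow 2 x).add ((hasDerivAt_id x).const_mul √2)).add_const 1
    have hminus : HasDerivAt (fun x : ℝ => x ^ 2 - √2 * x + 1) (2 * x - √2) x := by
      simpa using ((hasDerivAt_pow 2 x).sub ((hasDerivAt_id x).const_mul √2)).add_const 1
    refine (((hplus.log (hpos_plus x).ne').sub (hminus.log (hpos_minus x).ne')).div_const
      (2 * √2)).congr_deriv ?_
    have hprod : (x ^ 2 + √2 * x + 1) * (x ^ 2 - √2 * x + 1) = 1 + x ^ 4 := by
      linear_combination -x ^ 2 * hsq
    rw [div_sub_div _ _ (hpos_plus x).ne' (hpos_minus x).ne', hprod]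
    field_simp
    ring
  · exact Continuous.div (by fun_prop) (by fun_prop) fun x => by positivity
  · intro x
    have h₁ : ZMod.χ₈ 1 = 1 := by decide
    have h₃ : ZMod.χ₈ 3 = -1 := by decide
    have h₅ : ZMod.χ₈ 5 = -1 := by decide
    have h₇ : ZMod.χ₈ 7 = 1 := by decide
    rw [h₁, h₃, h₅, h₇]
    push_cast
    field_simp
    ring

lemma ringHomComp_intCast_ne {χ ψ : MulChar (ZMod 8) ℤ} (a : ZMod 8) (h : χ a ≠ ψ a) :
    χ.ringHomComp (Int.castRingHom ℂ) ≠ ψ.ringHomComp (Int.castRingHom ℂ) :=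
  fun he => h (by rw [MulChar.injective_ringHomComp (RingHom.injective_int _) he])

lemma ringHomComp_intCast_ne_one {χ : MulChar (ZMod 8) ℤ} (a : (ZMod 8)ˣ) (h : χ a ≠ 1) :
    χ.ringHomComp (Int.castRingHom ℂ) ≠ 1 :=
  (MulChar.ringHomComp_ne_one_iff (RingHom.injective_int _)).2
    fun he => h (by rw [he, MulChar.one_apply_coe])

lemma evenCharEight_ne_oddCharEight : evenCharEight ≠ oddCharEight :=
  ringHomComp_intCast_ne 3 (by decide)

lemma evenCharEight_ne_imprimitiveCharEight : evenCharEight ≠ imprimitiveCharEight :=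
  ringHomComp_intCast_ne 5 (by decide)

lemma oddCharEight_ne_imprimitiveCharEight : oddCharEight ≠ imprimitiveCharEight :=
  ringHomComp_intCast_ne 3 (by decide)

open scoped Classical in
lemma filter_ne_one_eq_charactersEight :
    Finset.univ.filter (fun χ : DirichletCharacter ℂ 8 => χ ≠ 1)
      = {evenCharEight, oddCharEight, imprimitiveCharEight} := by
  have hcard : #(Finset.univ.filter (fun χ : DirichletCharacter ℂ 8 => χ ≠ 1)) = 3 := by
    rw [filter_ne', card_erase_of_mem (mem_univ _), card_univ, ← Nat.card_eq_fintype_card,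
      DirichletCharacter.card_eq_totient_of_hasEnoughRootsOfUnity]
    decide
  symm
  refine eq_of_subset_of_card_le ?_ ?_
  · simp only [insert_subset_iff, singleton_subset_iff, mem_filter_univ]
    exact ⟨ringHomComp_intCast_ne_one ⟨3, 3, by decide, by decide⟩ (by decide),
      ringHomComp_intCast_ne_one (-1) (by decide), ringHomComp_intCast_ne_one (-1) (by decide)⟩
  · rw [hcard, card_eq_three.2 ⟨_, _, _, evenCharEight_ne_oddCharEight,
      evenCharEight_ne_imprimitiveCharEight, oddCharEight_ne_imprimitiveCharEight, rfl⟩]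

end CharactersModEight

open scoped Classical in
/-- **Evaluation of `Π(8,1)`:** the product of the values at `s = 1` of the Dirichlet
`L`-functions of the three non-principal characters modulo `8` equals
`π² log(3 + 2√2) / 32`; equivalently `Π(8,1) = 32 π⁻² (log(3 + 2√2))⁻¹`. -/
theorem prod_LFunction_eight :
    (∏ χ ∈ Finset.univ.filter (fun χ : DirichletCharacter ℂ 8 => χ ≠ 1),
        DirichletCharacter.LFunction χ 1)
      = ((Real.pi ^ 2 * Real.log (3 + 2 * Real.sqrt 2) / 32 : ℝ) : ℂ) := by
  rw [filter_ne_one_eq_charactersEight,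
    prod_insert (by simp [evenCharEight_ne_oddCharEight, evenCharEight_ne_imprimitiveCharEight]),
    prod_insert (by simp [oddCharEight_ne_imprimitiveCharEight]), prod_singleton,
    LFunction_evenCharEight_one, LFunction_oddCharEight_one, LFunction_imprimitiveCharEight_one]
  norm_cast
  have hsq : √2 ^ 2 = (2 : ℝ) := Real.sq_sqrt zero_le_two
  field_simp
  rw [hsq]
  ring
end

section
/- The limit c(5, 4) = lim_{x → ∞} ∏_{p ≤ x, p ≠ 5} (1 − 1/p)^{α(p; 5, 4)} exists, where α(p; 5, 4) = 3 if p ≡ 4 (mod 5) and α(p; 5, 4) = −1 otherwise, and c(5, 4) = Π(5, 4) · exp(4 · B(5, 4)) · ∏_{p ≡ 2 or 3 (mod 5)} ( (1 + p^{−2}) / (1 − p^{−2}) ) · ∏_{p ≡ 4 (mod 5)} ( (1 + 1/p) / (1 − 1/p) )² · e^{−4/p}, where B(5, 4) = ∑_{p ≡ 4 (mod 5)} ( 1/p + log(1 − 1/p) ) (an absolutely convergent series), Π(5, 4) = ∏_{χ mod 5, χ ≠ χ₀} L(1, χ)^{−χ̄(4)}, and the products over primes in the indicated residue classes are absolutely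 convergent. -/
open Filter Topology Finset

/-- **Abel's inequality**: weighting a series with bounded partial sums by a nonnegative antitone
sequence multiplies the bound by the first weight at most. -/
lemma norm_sum_range_smul_le_of_antitone {f : ℕ → ℝ} {z : ℕ → ℂ} {C : ℝ} (hf : Antitone f)
    (hf0 : ∀ n, 0 ≤ f n) (hz : ∀ n, ‖∑ i ∈ range n, z i‖ ≤ C) (n : ℕ) :
    ‖∑ i ∈ range n, f i • z i‖ ≤ f 0 * C := by
  have hC : 0 ≤ C := (norm_nonneg _).trans (hz 0)
  rw [Finset.sum_range_by_parts]
  have h1 : ‖f (n - 1) • ∑ i ∈ range n, z i‖ ≤ f (n - 1) * C := by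
    rw [norm_smul, Real.norm_of_nonneg (hf0 _)]
    exact mul_le_mul_of_nonneg_left (hz n) (hf0 _)
  have h2 : ‖∑ i ∈ range (n - 1), (f (i + 1) - f i) • ∑ j ∈ range (i + 1), z j‖
      ≤ ∑ i ∈ range (n - 1), (f i - f (i + 1)) * C := by
    refine norm_sum_le_of_le _ fun i _ => ?_
    have := hf (Nat.le_succ i)
    rw [norm_smul, Real.norm_eq_abs, abs_sub_comm, abs_of_nonneg (sub_nonneg.2 this)]
    exact mul_le_mul_of_nonneg_left (hz _) (sub_nonneg.2 this)
  rw [← Finset.sum_mul, Finset.sum_range_sub'] at h2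
  calc _ ≤ _ := norm_sub_le _ _
    _ ≤ f (n - 1) * C + (f 0 - f (n - 1)) * C := add_le_add h1 h2
    _ = f 0 * C := by ring

/-- **Abel's limit theorem** for a general family of antitone weights. -/
lemma tendsto_tsum_smul_of_antitone {ι : Type*} {F : Filter ι} {w : ι → ℕ → ℝ} {z : ℕ → ℂ} {l : ℂ}
    (hw : ∀ᶠ i in F, Antitone (w i) ∧ (∀ n, 0 ≤ w i n) ∧ w i 0 ≤ 1)
    (hs : ∀ᶠ i in F, Summable fun n => w i n • z n)
    (hw1 : ∀ n, Tendsto (fun i => w i n) F (𝓝 1))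
    (hz : Tendsto (fun n => ∑ i ∈ range n, z i) atTop (𝓝 l)) :
    Tendsto (fun i => ∑' n, w i n • z n) F (𝓝 l) := by
  rw [Metric.tendsto_nhds]
  intro ε hε
  obtain ⟨N, hN⟩ := Metric.tendsto_atTop.1 hz (ε / 8) (by positivity)
  have hhead : Tendsto (fun i => ∑ n ∈ range N, w i n • z n) F (𝓝 (∑ n ∈ range N, z n)) := by
    simpa using tendsto_finsetSum (range N) fun n _ => (hw1 n).smul_const (z n)
  filter_upwards [hw, hs, Metric.tendsto_nhds.1 hhead (ε / 8) (by positivity)] with i hi hsi hhi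
  obtain ⟨hanti, hnn, hle⟩ := hi
  have hpart (M : ℕ) : ‖∑ j ∈ range M, z (j + N)‖ ≤ ε / 4 := by
    have h1 := hN (N + M) (by omega)
    have h2 := hN N le_rfl
    have h3 : ∑ j ∈ range M, z (j + N) = ∑ j ∈ range (N + M), z j - ∑ j ∈ range N, z j := by
      rw [Finset.sum_range_add]; simp [add_comm]
    rw [h3, ← dist_eq_norm]
    linarith [dist_triangle_right (∑ j ∈ range (N + M), z j) (∑ j ∈ range N, z j) l]
  have htail : ‖∑' n, w i (n + N) • z (n + N)‖ ≤ ε / 4 := by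
    have hsum := ((summable_nat_add_iff N).2 hsi).hasSum.tendsto_sum_nat.norm
    refine le_of_tendsto hsum (Eventually.of_forall fun M => ?_)
    have := norm_sum_range_smul_le_of_antitone (f := fun n => w i (n + N))
      (fun a b hab => hanti (by omega)) (fun n => hnn _) hpart M
    refine this.trans ?_
    have h4 : w i (0 + N) ≤ 1 := (hanti (Nat.zero_le _)).trans hle
    nlinarith
  have hsplit := hsi.sum_add_tsum_nat_add N
  have := hN N le_rfl
  rw [← hsplit]
  rw [← dist_zero_right] at htail
  have h5 := dist_add_add_le (∑ n ∈ range N, w i n • z n) (∑' n, w i (n + N) • z (n + N))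
    (∑ n ∈ range N, z n) 0
  rw [add_zero] at h5
  linarith [dist_triangle (∑ n ∈ range N, w i n • z n + ∑' n, w i (n + N) • z (n + N))
    (∑ n ∈ range N, z n) l]

/-- Abel's limit theorem for Dirichlet series with real argument tending to `1` from the right. -/
lemma tendsto_tsum_mul_rpow_nhdsGT_one {a : ℕ → ℂ} {l : ℂ} (ha0 : a 0 = 0)
    (hs : ∀ s : ℝ, 1 < s → Summable fun n : ℕ => a n * (n : ℂ) ^ (-s : ℂ))
    (hz : Tendsto (fun n => ∑ i ∈ range n, a i / i) atTop (𝓝 l)) :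
    Tendsto (fun s : ℝ => ∑' n : ℕ, a n * (n : ℂ) ^ (-s : ℂ)) (𝓝[>] 1) (𝓝 l) := by
  let w : ℝ → ℕ → ℝ := fun s n => ((max n 1 : ℕ) : ℝ) ^ (1 - s)
  have hterm (s : ℝ) (n : ℕ) : w s n • (a n / n) = a n * (n : ℂ) ^ (-s : ℂ) := by
    rcases Nat.eq_zero_or_pos n with rfl | hn
    · simp [ha0]
    · have hn' : (n : ℂ) ≠ 0 := by exact_mod_cast hn.ne'
      simp only [w, max_eq_left (show 1 ≤ n from hn), Complex.real_smul]
      rw [Complex.ofReal_cpow (by positivity)]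
      push_cast
      rw [Complex.cpow_sub _ _ hn', Complex.cpow_one, Complex.cpow_neg]
      field_simp
  have key := tendsto_tsum_smul_of_antitone (F := 𝓝[>] (1 : ℝ)) (w := w)
    (z := fun n => a n / n) (l := l) ?_ ?_ ?_ hz
  · simpa only [hterm] using key
  · filter_upwards [self_mem_nhdsWithin] with s hs
    refine ⟨fun m n hmn => ?_, fun n => by positivity, by simp [w]⟩
    refine Real.rpow_le_rpow_of_nonpos (by positivity) ?_ (by
      have : (1 : ℝ) < s := hs
      linarith)
    exact_mod_cast max_le_max_right 1 hmn
  · filter_upwards [self_mem_nhdsWithin] with s hs'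
    simpa only [hterm] using hs s hs'
  · intro n
    have : Continuous fun s : ℝ => w s n := by
      have : ((max n 1 : ℕ) : ℝ) ≠ 0 := by positivity
      exact (continuous_const).rpow (by fun_prop) fun _ => Or.inl this
    simpa [w] using (this.tendsto 1).mono_left nhdsWithin_le_nhds

namespace DirichletCharacter

variable {q : ℕ} [NeZero q] {χ : DirichletCharacter ℂ q}

lemma norm_sum_range_le (hχ : χ ≠ 1) (n : ℕ) : ‖∑ i ∈ range n, χ (i : ZMod q)‖ ≤ q := by
  have hper (m : ℕ) : ∑ i ∈ range q, χ ((m + i : ℕ) : ZMod q) = 0 := by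
    have h0 := MulChar.sum_eq_zero_of_ne_one hχ
    rw [← h0, ← Equiv.sum_comp (Equiv.addLeft (m : ZMod q))]
    refine Finset.sum_bij' (fun i _ => (i : ZMod q)) (fun a _ => a.val) ?_ ?_ ?_ ?_ ?_
    · simp
    · intro a _
      simpa using ZMod.val_lt a
    · intro i hi
      exact ZMod.val_cast_of_lt (by simpa using hi)
    · simp
    · simp
  induction n using Nat.strong_induction_on with
  | _ n ih =>
    rcases lt_or_ge n q with h | h
    · calc _ ≤ ∑ i ∈ range n, (1 : ℝ) := norm_sum_le_of_le _ fun i _ => χ.norm_le_one _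
        _ ≤ q := by simpa using h.le
    · obtain ⟨m, rfl⟩ := Nat.exists_eq_add_of_le' h
      rw [Finset.sum_range_add, hper, add_zero]
      exact ih m (by have := NeZero.pos q; omega)

lemma norm_sum_range_add_le (hχ : χ ≠ 1) (N n : ℕ) :
    ‖∑ i ∈ range n, χ ((i + N : ℕ) : ZMod q)‖ ≤ 2 * q := by
  have h3 : ∑ j ∈ range n, χ ((j + N : ℕ) : ZMod q)
      = ∑ j ∈ range (N + n), χ (j : ZMod q) - ∑ j ∈ range N, χ (j : ZMod q) := by
    rw [Finset.sum_range_add]; simp [add_comm]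
  rw [h3]
  linarith [norm_sub_le (∑ j ∈ range (N + n), χ (j : ZMod q)) (∑ j ∈ range N, χ (j : ZMod q)),
    norm_sum_range_le hχ N, norm_sum_range_le hχ (N + n)]

/-- The Dirichlet series of a nonprincipal character converges conditionally at `1`. -/
lemma tendsto_sum_range_div (hχ : χ ≠ 1) :
    Tendsto (fun n => ∑ i ∈ range n, χ (i : ZMod q) / (i : ℂ)) atTop (𝓝 (LFunction χ 1)) := by
  have hanti : Antitone fun n : ℕ => 1 / ((n + 1 : ℕ) : ℝ) := fun m n hmn => by
    dsimp only
    gcongr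
  have hcau := hanti.cauchySeq_series_mul_of_tendsto_zero_of_bounded
    (by simpa using tendsto_one_div_add_atTop_nhds_zero_nat (𝕜 := ℝ))
    (norm_sum_range_add_le hχ 1)
  obtain ⟨l, hl⟩ := cauchySeq_tendsto_of_complete hcau
  have hl' : Tendsto (fun n => ∑ i ∈ range n, χ (i : ZMod q) / (i : ℂ)) atTop (𝓝 l) := by
    rw [← tendsto_add_atTop_iff_nat 1]
    refine hl.congr fun n => ?_
    rw [Finset.sum_range_succ']
    simp only [Nat.cast_zero, div_zero, add_zero]
    refine Finset.sum_congr rfl fun i _ => ?_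
    rw [Complex.real_smul]
    push_cast
    ring
  suffices l = LFunction χ 1 from this ▸ hl'
  by_cases hq : q = 1
  · subst hq
    exact absurd (level_one χ) hχ
  have h0 : χ ((0 : ℕ) : ZMod q) = 0 := by
    have : Nontrivial (ZMod q) := ZMod.nontrivial_iff.2 hq
    simpa using MulChar.map_zero χ
  have hA := tendsto_tsum_mul_rpow_nhdsGT_one (a := fun n => χ (n : ZMod q)) h0 ?_ hl'
  · have hB : Tendsto (fun s : ℝ => LFunction χ s) (𝓝[>] 1) (𝓝 (LFunction χ 1)) := by
      have := ((differentiable_LFunction hχ).continuous.comp Complex.continuous_ofReal).tendsto 1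
      simpa [Function.comp_def] using this.mono_left nhdsWithin_le_nhds
    refine tendsto_nhds_unique hA (hB.congr' ?_)
    filter_upwards [self_mem_nhdsWithin] with s hs
    have hs' : 1 < (s : ℂ).re := by simpa using hs
    rw [LFunction_eq_LSeries χ hs', LSeries_def₀ h0]
    simp [Complex.cpow_neg, div_eq_mul_inv]
  · intro s hs
    have := LSeriesSummable_of_one_lt_re χ (s := s) (by simpa using hs)
    refine this.congr fun n => ?_
    rw [LSeries.term_def₀ h0]

lemma norm_sum_range_div_sub_le (hχ : χ ≠ 1) {N : ℕ} (hN : 0 < N) :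
    ‖∑ i ∈ range N, χ (i : ZMod q) / (i : ℂ) - LFunction χ 1‖ ≤ 2 * q / N := by
  have hlim := ((tendsto_sum_range_div hχ).comp (tendsto_add_atTop_nat N)).const_sub
    (∑ i ∈ range N, χ (i : ZMod q) / (i : ℂ))
  refine le_of_tendsto hlim.norm (Eventually.of_forall fun M => ?_)
  have := norm_sum_range_smul_le_of_antitone (f := fun n => 1 / ((n + N : ℕ) : ℝ))
    (fun a b hab => by
      dsimp only
      gcongr) (fun n => by positivity) (norm_sum_range_add_le hχ N) M
  rw [Function.comp_apply, add_comm M N, Finset.sum_range_add, sub_add_cancel_left, norm_neg]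
  have h2 : ∑ x ∈ range M, χ ((N + x : ℕ) : ZMod q) / ((N + x : ℕ) : ℂ)
      = ∑ i ∈ range M, (1 / ((i + N : ℕ) : ℝ)) • χ ((i + N : ℕ) : ZMod q) := by
    refine Finset.sum_congr rfl fun i _ => ?_
    rw [Complex.real_smul, add_comm]
    push_cast
    ring
  rw [h2]
  refine this.trans_eq ?_
  rw [zero_add]
  ring

lemma exists_norm_sum_range_mul_log_div_le (hχ : χ ≠ 1) :
    ∃ C, ∀ N, ‖∑ i ∈ range N, χ (i : ZMod q) * Real.log i / (i : ℂ)‖ ≤ C := by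
  refine ⟨‖∑ i ∈ range 3, χ (i : ZMod q) * Real.log i / (i : ℂ)‖ +
    ∑ i ∈ range 3, ‖χ (i : ZMod q) * Real.log i / (i : ℂ)‖ + Real.log 3 / 3 * (2 * q), fun N => ?_⟩
  have hpos : 0 ≤ Real.log 3 / 3 * (2 * q) := by positivity
  rcases le_or_gt N 3 with h | h
  · have : ‖∑ i ∈ range N, χ (i : ZMod q) * Real.log i / (i : ℂ)‖
        ≤ ∑ i ∈ range 3, ‖χ (i : ZMod q) * Real.log i / (i : ℂ)‖ :=
      (norm_sum_le _ _).trans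
        (Finset.sum_le_sum_of_subset_of_nonneg (by simpa using h) fun _ _ _ => norm_nonneg _)
    linarith [norm_nonneg (∑ i ∈ range 3, χ (i : ZMod q) * Real.log i / (i : ℂ))]
  · obtain ⟨M, rfl⟩ := Nat.exists_eq_add_of_le h.le
    rw [Finset.sum_range_add]
    have := norm_sum_range_smul_le_of_antitone
      (f := fun n : ℕ => Real.log ((n + 3 : ℕ) : ℝ) / ((n + 3 : ℕ) : ℝ))
      (fun a b hab => by
        have he (n : ℕ) : Real.exp 1 ≤ ((n + 3 : ℕ) : ℝ) := by
          push_cast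
          linarith [Real.exp_one_lt_d9, (n.cast_nonneg : (0 : ℝ) ≤ n)]
        exact Real.log_div_self_antitoneOn (he a) (he b) (by exact_mod_cast by omega))
      (fun n => by positivity) (norm_sum_range_add_le hχ 3) M
    have h2 : ∑ x ∈ range M, χ ((3 + x : ℕ) : ZMod q) * Real.log ((3 + x : ℕ) : ℝ) / ((3 + x : ℕ) : ℂ)
        = ∑ i ∈ range M, (Real.log ((i + 3 : ℕ) : ℝ) / ((i + 3 : ℕ) : ℝ)) • χ ((i + 3 : ℕ) : ZMod q) := by
      refine Finset.sum_congr rfl fun i _ => ?_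
      rw [Complex.real_smul, add_comm]
      push_cast
      ring
    rw [← h2] at this
    norm_num only [zero_add] at this
    have h3 : 0 ≤ ∑ i ∈ range 3, ‖χ (i : ZMod q) * Real.log i / (i : ℂ)‖ := by positivity
    refine (norm_add_le _ _).trans ?_
    linarith

open ArithmeticFunction in
lemma sum_Ioc_mul_log_div_eq {q : ℕ} (χ : DirichletCharacter ℂ q) (N : ℕ) :
    ∑ n ∈ Ioc 0 N, χ (n : ZMod q) * Real.log n / (n : ℂ) =
      ∑ d ∈ Ioc 0 N, χ (d : ZMod q) * vonMangoldt d / (d : ℂ) *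
        ∑ m ∈ Ioc 0 (N / d), χ (m : ZMod q) / (m : ℂ) := by
  let f : ArithmeticFunction ℂ := ⟨fun d => χ (d : ZMod q) * vonMangoldt d / (d : ℂ), by simp⟩
  let g : ArithmeticFunction ℂ := ⟨fun d => χ (d : ZMod q) / (d : ℂ), by simp⟩
  refine Eq.trans ?_ (ArithmeticFunction.sum_Ioc_mul_eq_sum_sum f g N)
  refine Finset.sum_congr rfl fun n hn => ?_
  have hn0 : n ≠ 0 := (Finset.mem_Ioc.1 hn).1.ne'
  rw [ArithmeticFunction.mul_apply, ← vonMangoldt_sum,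
    ← Nat.sum_divisorsAntidiagonal (fun d _ => vonMangoldt d)]
  push_cast
  rw [Finset.mul_sum, Finset.sum_div]
  refine Finset.sum_congr rfl fun x hx => ?_
  obtain ⟨hx, -⟩ := Nat.mem_divisorsAntidiagonal.1 hx
  subst hx
  simp only [f, g, ArithmeticFunction.coe_mk]
  push_cast
  rw [map_mul]
  field_simp

open ArithmeticFunction in
/-- Mertens' bound for the von Mangoldt function twisted by a nonprincipal character. -/
lemma exists_norm_sum_range_mul_vonMangoldt_div_le (hχ : χ ≠ 1) :
    ∃ C, ∀ N, ‖∑ i ∈ range N, χ (i : ZMod q) * vonMangoldt i / (i : ℂ)‖ ≤ C := by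
  obtain ⟨C, hC⟩ := exists_norm_sum_range_mul_log_div_le hχ
  have hL : 0 < ‖LFunction χ 1‖ := norm_pos_iff.2 (LFunction_apply_one_ne_zero hχ)
  have hIoc (f : ℕ → ℂ) (hf : f 0 = 0) (N : ℕ) : ∑ i ∈ Ioc 0 N, f i = ∑ i ∈ range (N + 1), f i := by
    rw [Finset.range_eq_Ico, Finset.sum_eq_sum_Ico_succ_bot (by omega), hf, zero_add]
    rfl
  have hbound (N : ℕ) (hN : 0 < N) :
      ‖(∑ d ∈ Ioc 0 N, χ (d : ZMod q) * vonMangoldt d / (d : ℂ)) * LFunction χ 1‖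
        ≤ C + 2 * q * (Real.log 4 + 4) := by
    have hN' : (0 : ℝ) < N := by exact_mod_cast hN
    have h1 : (∑ d ∈ Ioc 0 N, χ (d : ZMod q) * vonMangoldt d / (d : ℂ)) * LFunction χ 1
        = ∑ n ∈ Ioc 0 N, χ (n : ZMod q) * Real.log n / (n : ℂ)
          - ∑ d ∈ Ioc 0 N, χ (d : ZMod q) * vonMangoldt d / (d : ℂ) *
            (∑ m ∈ range (N / d + 1), χ (m : ZMod q) / (m : ℂ) - LFunction χ 1) := by
      rw [sum_Ioc_mul_log_div_eq, Finset.sum_mul, ← Finset.sum_sub_distrib]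
      refine Finset.sum_congr rfl fun d _ => ?_
      rw [hIoc _ (by simp)]
      ring
    have h2 : ‖∑ d ∈ Ioc 0 N, χ (d : ZMod q) * vonMangoldt d / (d : ℂ) *
            (∑ m ∈ range (N / d + 1), χ (m : ZMod q) / (m : ℂ) - LFunction χ 1)‖
          ≤ ∑ d ∈ Ioc 0 N, vonMangoldt d * (2 * q / N) := by
      refine norm_sum_le_of_le _ fun d hd => ?_
      have hd0 : (0 : ℝ) < d := by exact_mod_cast (Finset.mem_Ioc.1 hd).1
      have h3 : ‖χ (d : ZMod q) * vonMangoldt d / (d : ℂ)‖ ≤ vonMangoldt d / d := by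
        rw [norm_div, norm_mul, Complex.norm_natCast, Complex.norm_real,
          Real.norm_of_nonneg vonMangoldt_nonneg]
        gcongr
        exact mul_le_of_le_one_left vonMangoldt_nonneg (χ.norm_le_one _)
      have h4 := norm_sum_range_div_sub_le hχ (Nat.succ_pos (N / d))
      have h5 : (N : ℝ) / d ≤ ((N / d).succ : ℕ) := by
        push_cast
        exact (Nat.lt_floor_add_one ((N : ℝ) / d)).le.trans (by rw [Nat.floor_div_eq_div])
      rw [norm_mul]
      calc _ ≤ vonMangoldt d / d * (2 * q / ((N / d).succ : ℕ)) := by gcongr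
        _ ≤ vonMangoldt d / d * (2 * q / ((N : ℝ) / d)) := by gcongr
        _ = _ := by field_simp
    have h6 : ∑ d ∈ Ioc 0 N, vonMangoldt d * (2 * q / N) ≤ 2 * q * (Real.log 4 + 4) := by
      have := Chebyshev.psi_le_const_mul_self (x := N) (by positivity)
      rw [Chebyshev.psi, Nat.floor_natCast] at this
      rw [← Finset.sum_mul]
      calc _ ≤ ((Real.log 4 + 4) * N) * (2 * q / N) := by gcongr
        _ = _ := by field_simp
    rw [h1]
    refine (norm_sub_le _ _).trans (add_le_add ?_ (h2.trans h6))
    rw [hIoc _ (by simp)]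
    exact hC _
  refine ⟨max 0 ((C + 2 * q * (Real.log 4 + 4)) / ‖LFunction χ 1‖), fun N => ?_⟩
  rcases le_or_gt N 1 with h | h
  · refine le_max_of_le_left (le_of_eq ?_)
    interval_cases N <;> simp
  · obtain ⟨M, rfl⟩ := Nat.exists_eq_add_of_le' h.le
    refine le_max_of_le_right ?_
    rw [le_div_iff₀ hL, ← norm_mul, ← hIoc _ (by simp)]
    exact hbound M (by omega)

lemma exists_norm_sum_range_prime_mul_log_div_le (hχ : χ ≠ 1) :
    ∃ C, ∀ N, ‖∑ i ∈ range N, if i.Prime then χ (i : ZMod q) * Real.log i / (i : ℂ) else 0‖ ≤ C := by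
  obtain ⟨C, hC⟩ := exists_norm_sum_range_mul_vonMangoldt_div_le hχ
  have hs := ArithmeticFunction.vonMangoldt.summable_residueClass_non_primes_div (0 : ZMod 1)
  have hs0 (n : ℕ) : ArithmeticFunction.vonMangoldt.residueClass (0 : ZMod 1) n
      = ArithmeticFunction.vonMangoldt n := by
    simp [ArithmeticFunction.vonMangoldt.residueClass, Subsingleton.elim _ (0 : ZMod 1)]
  simp only [hs0] at hs
  set u : ℕ → ℝ := fun n => (if n.Prime then 0 else ArithmeticFunction.vonMangoldt n) / n with hu
  have hu0 (n : ℕ) : 0 ≤ u n := by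
    simp only [hu]
    split_ifs
    · simp
    · exact div_nonneg ArithmeticFunction.vonMangoldt_nonneg n.cast_nonneg
  refine ⟨C + ∑' n, u n, fun N => ?_⟩
  have heq : (∑ i ∈ range N, if i.Prime then χ (i : ZMod q) * Real.log i / (i : ℂ) else 0)
      = ∑ i ∈ range N, χ (i : ZMod q) * ArithmeticFunction.vonMangoldt i / (i : ℂ)
        - ∑ i ∈ range N, χ (i : ZMod q) * (u i : ℂ) := by
    rw [← Finset.sum_sub_distrib]
    refine Finset.sum_congr rfl fun i _ => ?_
    by_cases hi : i.Prime
    · simp [hu, hi, ArithmeticFunction.vonMangoldt_apply_prime hi]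
    · simp only [hu, hi, if_false]
      push_cast
      ring
  rw [heq]
  refine (norm_sub_le _ _).trans (add_le_add (hC N) ?_)
  refine (norm_sum_le_of_le (f := fun i : ℕ => χ (i : ZMod q) * (u i : ℂ)) _ fun i _ => ?_).trans
    (hs.sum_le_tsum (range N) fun i _ => hu0 i)
  rw [norm_mul, Complex.norm_real, Real.norm_of_nonneg (hu0 i)]
  exact mul_le_of_le_one_left (hu0 i) (χ.norm_le_one _)

lemma exists_tendsto_sum_range_prime_div (hχ : χ ≠ 1) :
    ∃ l, Tendsto (fun N => ∑ i ∈ range N, (if i.Prime then χ (i : ZMod q) else 0) / (i : ℂ))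
      atTop (𝓝 l) := by
  obtain ⟨C, hC⟩ := exists_norm_sum_range_prime_mul_log_div_le hχ
  let f : ℕ → ℝ := fun n => (Real.log (max n 2 : ℕ))⁻¹
  have hpos (n : ℕ) : 0 < Real.log (max n 2 : ℕ) := Real.log_pos (by
    have : 2 ≤ max n 2 := le_max_right _ _
    exact_mod_cast this)
  have hanti : Antitone f := fun m n hmn => by
    refine inv_anti₀ (hpos m) (Real.log_le_log (by positivity) ?_)
    exact_mod_cast max_le_max_right 2 hmn
  have h0 : Tendsto f atTop (𝓝 0) := by
    refine tendsto_inv_atTop_zero.comp (Real.tendsto_log_atTop.comp ?_)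
    refine tendsto_natCast_atTop_atTop.comp ?_
    exact tendsto_atTop_mono (fun n => le_max_left n 2) tendsto_id
  obtain ⟨l, hl⟩ := cauchySeq_tendsto_of_complete
    (hanti.cauchySeq_series_mul_of_tendsto_zero_of_bounded h0 hC)
  refine ⟨l, hl.congr fun N => Finset.sum_congr rfl fun i _ => ?_⟩
  by_cases hi : i.Prime
  · have h1 : f i = (Real.log i)⁻¹ := by simp only [f, max_eq_left hi.two_le]
    have h2 : (Real.log i : ℂ) ≠ 0 := by exact_mod_cast (Real.log_pos (by exact_mod_cast hi.one_lt)).ne'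
    simp only [hi, if_true, h1, Complex.real_smul]
    push_cast at h2 ⊢
    field_simp
  · simp [hi]

lemma norm_mul_cpow_neg_le {q : ℕ} (χ : DirichletCharacter ℂ q) {p : ℕ} (hp : p.Prime) {s : ℝ}
    (hs : 1 ≤ s) : ‖χ (p : ZMod q) * (p : ℂ) ^ (-s : ℂ)‖ ≤ (p : ℝ)⁻¹ := by
  rw [norm_mul, Complex.norm_natCast_cpow_of_pos hp.pos]
  have hp1 : (1 : ℝ) ≤ p := by exact_mod_cast hp.one_le
  calc _ ≤ 1 * (p : ℝ) ^ (-1 : ℝ) := by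
        gcongr
        · exact χ.norm_le_one _
        · simpa using hs
    _ = _ := by rw [one_mul, Real.rpow_neg_one]

lemma norm_neg_log_one_sub_sub_le {z : ℂ} (hz : ‖z‖ ≤ 1 / 2) :
    ‖-Complex.log (1 - z) - z‖ ≤ ‖z‖ ^ 2 := by
  have h := Complex.norm_log_one_add_sub_self_le (z := -z) (by rw [norm_neg]; linarith)
  rw [norm_neg] at h
  have h1 : (1 - ‖z‖)⁻¹ ≤ 2 := by
    rw [inv_le_comm₀ (by linarith) (by norm_num)]
    linarith
  have h2 : -Complex.log (1 - z) - z = -(Complex.log (1 + -z) - -z) := by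
    rw [← sub_eq_add_neg]
    ring
  rw [h2, norm_neg]
  nlinarith [sq_nonneg ‖z‖]

/-- The Euler product of a nonprincipal character converges conditionally at `1`, when the primes
are taken in increasing order. -/
theorem tendsto_prod_primesBelow_one_sub_div_inv (hχ : χ ≠ 1) :
    Tendsto (fun N : ℕ => ∏ p ∈ N.primesBelow, (1 - χ (p : ZMod q) / (p : ℂ))⁻¹) atTop
      (𝓝 (LFunction χ 1)) := by
  obtain ⟨l, hl⟩ := exists_tendsto_sum_range_prime_div hχ
  let a : ℕ → ℂ := fun n => if n.Prime then χ (n : ZMod q) else 0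
  let v : ℝ → ℕ → ℂ := fun s n => if n.Prime then
    -Complex.log (1 - χ (n : ZMod q) * (n : ℂ) ^ (-s : ℂ)) - χ (n : ZMod q) * (n : ℂ) ^ (-s : ℂ) else 0
  have hvle (s : ℝ) (hs : 1 ≤ s) (n : ℕ) : ‖v s n‖ ≤ ((n : ℝ) ^ 2)⁻¹ := by
    by_cases hn : n.Prime
    · simp only [v, hn, if_true]
      have h1 := norm_mul_cpow_neg_le χ hn hs
      have h2 : ((n : ℝ))⁻¹ ≤ 1 / 2 := by
        rw [one_div]
        exact inv_anti₀ two_pos (by exact_mod_cast hn.two_le)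
      refine (norm_neg_log_one_sub_sub_le (h1.trans h2)).trans ?_
      rw [← inv_pow]
      gcongr
    · simp only [v, hn, if_false, norm_zero]
      positivity
  have hsq : Summable fun n : ℕ => ((n : ℝ) ^ 2)⁻¹ := Real.summable_nat_pow_inv.2 one_lt_two
  have hvs (s : ℝ) (hs : 1 ≤ s) : Summable (v s) := Summable.of_norm_bounded hsq (hvle s hs)
  have has (s : ℝ) (hs : 1 < s) : Summable fun n : ℕ => a n * (n : ℂ) ^ (-s : ℂ) := by
    refine Summable.of_norm_bounded (Real.summable_nat_rpow.2 (neg_lt_neg hs)) fun n => ?_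
    by_cases hn : n.Prime
    · simp only [a, hn, if_true]
      rw [norm_mul, Complex.norm_natCast_cpow_of_pos hn.pos]
      exact mul_le_of_le_one_left (by positivity) (χ.norm_le_one _)
    · simp only [a, hn, if_false, zero_mul, norm_zero]
      positivity
  have hA := tendsto_tsum_mul_rpow_nhdsGT_one (a := a) (by simp [a, Nat.not_prime_zero]) has hl
  have hV : Tendsto (fun s : ℝ => ∑' n, v s n) (𝓝[>] 1) (𝓝 (∑' n, v 1 n)) := by
    refine tendsto_tsum_of_dominated_convergence hsq (fun n => ?_) ?_
    · by_cases hn : n.Prime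
      · simp only [v, hn, if_true]
        have hn0 : (n : ℂ) ≠ 0 := by exact_mod_cast hn.ne_zero
        have hc : Continuous fun s : ℝ => χ (n : ZMod q) * (n : ℂ) ^ (-s : ℂ) := by
          refine continuous_const.mul ?_
          exact Continuous.const_cpow (by fun_prop) (Or.inl hn0)
        have hslit : 1 - χ (n : ZMod q) * (n : ℂ) ^ (-((1 : ℝ) : ℂ)) ∈ Complex.slitPlane := by
          rw [sub_eq_add_neg]
          refine Complex.mem_slitPlane_of_norm_lt_one ?_
          rw [norm_neg]
          refine (norm_mul_cpow_neg_le χ hn le_rfl).trans_lt (inv_lt_one_of_one_lt₀ ?_)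
          exact_mod_cast hn.one_lt
        have hc1 := hc.tendsto 1
        exact ((((hc1.const_sub 1).clog hslit).neg).sub hc1).mono_left nhdsWithin_le_nhds
      · simp [v, hn]
    · filter_upwards [self_mem_nhdsWithin] with s hs n using hvle s (le_of_lt hs) n
  have hexp (s : ℝ) (hs : 1 < s) :
      Complex.exp (∑' n : ℕ, a n * (n : ℂ) ^ (-s : ℂ) + ∑' n, v s n) = LFunction χ s := by
    have hs' : 1 < (s : ℂ).re := by simpa using hs
    rw [LFunction_eq_LSeries χ hs', ← LSeries_eulerProduct_exp_log χ hs',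
      ← (has s hs).tsum_add (hvs s hs.le)]
    congr 1
    refine Eq.trans ?_ (tsum_subtype {p : ℕ | p.Prime}
      (fun p : ℕ => -Complex.log (1 - χ (p : ZMod q) * (p : ℂ) ^ (-s : ℂ)))).symm
    refine tsum_congr fun n => ?_
    by_cases hn : n.Prime
    · simp [a, v, hn]
    · simp [a, v, hn]
  have hlim : Complex.exp (l + ∑' n, v 1 n) = LFunction χ 1 := by
    have hB : Tendsto (fun s : ℝ => LFunction χ s) (𝓝[>] 1) (𝓝 (LFunction χ 1)) := by
      have := ((differentiable_LFunction hχ).continuous.comp Complex.continuous_ofReal).tendsto 1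
      simpa [Function.comp_def] using this.mono_left nhdsWithin_le_nhds
    refine tendsto_nhds_unique ((hA.add hV).cexp.congr' ?_) hB
    filter_upwards [self_mem_nhdsWithin] with s hs using hexp s hs
  rw [← hlim]
  refine (hl.add (hvs 1 le_rfl).hasSum.tendsto_sum_nat).cexp.congr fun N => ?_
  rw [← Finset.sum_add_distrib, Complex.exp_sum, Nat.primesBelow, Finset.prod_filter]
  refine Finset.prod_congr rfl fun n _ => ?_
  by_cases hn : n.Prime
  · have hlt : ‖χ (n : ZMod q) / (n : ℂ)‖ < 1 := by
      have := norm_mul_cpow_neg_le χ hn le_rfl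
      simp only [Complex.ofReal_one, Complex.cpow_neg_one, ← div_eq_mul_inv] at this
      refine this.trans_lt (inv_lt_one_of_one_lt₀ ?_)
      exact_mod_cast hn.one_lt
    have hne : 1 - χ (n : ZMod q) / (n : ℂ) ≠ 0 := fun h => by
      rw [← sub_eq_zero.1 h, norm_one] at hlt
      exact lt_irrefl _ hlt
    simp only [v, hn, if_true, Complex.ofReal_one, Complex.cpow_neg_one, ← div_eq_mul_inv,
      add_sub_cancel]
    rw [Complex.exp_neg, Complex.exp_log hne]
  · simp [v, hn]

end DirichletCharacter

namespace DirichletCharacter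

lemma apply_natCast_five (χ : DirichletCharacter ℂ 5) (p : ℕ) :
    χ (p : ZMod 5) = if p % 5 = 1 then 1 else if p % 5 = 2 then χ 2 else
      if p % 5 = 3 then χ 2 ^ 3 else if p % 5 = 4 then χ 2 ^ 2 else 0 := by
  have hp : (p : ZMod 5) = ((p % 5 : ℕ) : ZMod 5) := (ZMod.natCast_mod p 5).symm
  have hlt : p % 5 < 5 := Nat.mod_lt _ (by norm_num)
  rw [hp, ← map_pow, ← map_pow, show (2 : ZMod 5) ^ 3 = 3 by decide,
    show (2 : ZMod 5) ^ 2 = 4 by decide]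
  generalize p % 5 = r at hlt
  interval_cases r
  · simpa using MulChar.map_nonunit χ (show ¬IsUnit (0 : ZMod 5) by decide)
  all_goals simp

lemma apply_two_five_mem {χ : DirichletCharacter ℂ 5} (hχ : χ ≠ 1) :
    χ 2 ∈ ({Complex.I, -1, -Complex.I} : Finset ℂ) := by
  have h4 : χ 2 ^ 4 = 1 := by
    rw [← map_pow, show (2 : ZMod 5) ^ 4 = 1 by decide, map_one]
  have h1 : χ 2 ≠ 1 := fun h => hχ <| MulChar.ext' fun a => by
    obtain ⟨n, rfl⟩ := ZMod.natCast_zmod_surjective a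
    rw [apply_natCast_five, apply_natCast_five, h]
    simp [MulChar.one_apply (show IsUnit (2 : ZMod 5) by decide)]
  have : (χ 2 - 1) * ((χ 2 - Complex.I) * (χ 2 + 1) * (χ 2 + Complex.I)) = 0 := by
    linear_combination h4 + (1 - χ 2 ^ 2) * Complex.I_sq
  simp only [Finset.mem_insert, Finset.mem_singleton]
  rcases mul_eq_zero.1 this with h | h
  · exact absurd (sub_eq_zero.1 h) h1
  · rcases mul_eq_zero.1 h with h | h
    · rcases mul_eq_zero.1 h with h | h
      · exact Or.inl (sub_eq_zero.1 h)
      · exact Or.inr (Or.inl (eq_neg_of_add_eq_zero_left h))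
    · exact Or.inr (Or.inr (eq_neg_of_add_eq_zero_left h))

open scoped Classical in
/-- A nonprincipal character mod `5` is determined by its value at `2`, which is an arbitrary
fourth root of unity other than `1`. -/
lemma prod_ne_one_five (F : ℂ → ℂ) :
    ∏ χ ∈ Finset.univ.filter (fun χ : DirichletCharacter ℂ 5 => χ ≠ 1), F (χ 2) =
      F Complex.I * F (-1) * F (-Complex.I) := by
  have hI1 : Complex.I ≠ -1 := fun h => by simpa using congrArg Complex.im h
  have hI2 : Complex.I ≠ -Complex.I := fun h => by
    have := congrArg Complex.im h
    norm_num at this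
  have hI3 : (-1 : ℂ) ≠ -Complex.I := fun h => by simpa using congrArg Complex.im h
  have hmaps : ∀ χ ∈ Finset.univ.filter (fun χ : DirichletCharacter ℂ 5 => χ ≠ 1),
      χ 2 ∈ ({Complex.I, -1, -Complex.I} : Finset ℂ) := fun χ hχ =>
    apply_two_five_mem (Finset.mem_filter.1 hχ).2
  have hinj : Set.InjOn (fun χ : DirichletCharacter ℂ 5 => χ 2)
      (Finset.univ.filter (fun χ : DirichletCharacter ℂ 5 => χ ≠ 1)) := fun χ _ ψ _ h =>
    MulChar.ext' fun a => by
      obtain ⟨n, rfl⟩ := ZMod.natCast_zmod_surjective a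
      rw [apply_natCast_five, apply_natCast_five, show χ 2 = ψ 2 from h]
  have hcard : (Finset.univ.filter (fun χ : DirichletCharacter ℂ 5 => χ ≠ 1)).card = 3 := by
    have h := card_eq_totient_of_hasEnoughRootsOfUnity ℂ 5
    rw [Nat.card_eq_fintype_card, Nat.totient_prime Nat.prime_five] at h
    rw [Finset.filter_ne', Finset.card_erase_of_mem (Finset.mem_univ _), Finset.card_univ, h]
  have hcard' : ({Complex.I, -1, -Complex.I} : Finset ℂ).card = 3 :=
    Finset.card_eq_three.2 ⟨_, _, _, hI1, hI2, hI3, rfl⟩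
  have hsurj := Finset.surjOn_of_injOn_of_card_le (fun χ : DirichletCharacter ℂ 5 => χ 2) hmaps hinj
    (by rw [hcard, hcard'])
  rw [Finset.prod_nbij (t := {Complex.I, -1, -Complex.I}) (g := F)
    (fun χ : DirichletCharacter ℂ 5 => χ 2) hmaps hinj hsurj fun _ _ => rfl]
  rw [Finset.prod_insert (by simp [hI1, hI2]), Finset.prod_insert (by simp [hI3]),
    Finset.prod_singleton, mul_assoc]

/-- For a nonprincipal character `χ` mod `5`, the value `-χ 4`, as a function of `χ 2`. -/
noncomputable def negApplyFour (z : ℂ) : ℤ :=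
  open scoped Classical in if z = -1 then -1 else 1

lemma neg_conj_apply_four {χ : DirichletCharacter ℂ 5} (hχ : χ ≠ 1) :
    -(starRingEnd ℂ) (χ (4 : ZMod 5)) = (negApplyFour (χ 2) : ℂ) := by
  have h4 : χ 4 = χ 2 ^ 2 := by rw [← map_pow, show (2 : ZMod 5) ^ 2 = 4 by decide]
  have hI1 : Complex.I ≠ -1 := fun h => by simpa using congrArg Complex.im h
  have hI3 : -Complex.I ≠ (-1 : ℂ) := fun h => by simpa using congrArg Complex.im h
  have h := apply_two_five_mem hχ
  simp only [Finset.mem_insert, Finset.mem_singleton] at h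
  rcases h with h | h | h <;> rw [h4, h] <;> simp [negApplyFour, hI1, hI3]

/-- The combined Euler factor at `p` of `∏ L(1, χ) ^ (-χ̄ 4)` over nonprincipal `χ` mod `5`. -/
noncomputable def eulerFactorFive (p : ℕ) : ℝ :=
  if p % 5 = 1 then (1 - 1 / (p : ℝ))⁻¹
  else if p % 5 = 2 ∨ p % 5 = 3 then (1 + 1 / (p : ℝ)) * (1 + 1 / (p : ℝ) ^ 2)⁻¹
  else if p % 5 = 4 then (1 - 1 / (p : ℝ)) * ((1 + 1 / (p : ℝ)) ^ 2)⁻¹ else 1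

open scoped Classical in
lemma prod_ne_one_five_euler_factor {p : ℕ} (hp : p.Prime) :
    ∏ χ ∈ Finset.univ.filter (fun χ : DirichletCharacter ℂ 5 => χ ≠ 1),
        (1 - χ (p : ZMod 5) / (p : ℂ))⁻¹ ^ negApplyFour (χ 2) =
      (eulerFactorFive p : ℂ) := by
  rw [eulerFactorFive]
  have hI1 : Complex.I ≠ -1 := fun h => by simpa using congrArg Complex.im h
  have hI3 : -Complex.I ≠ (-1 : ℂ) := fun h => by simpa using congrArg Complex.im h
  have hp1 : (1 : ℝ) < p := by exact_mod_cast hp.one_lt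
  have hp0 : (p : ℂ) ≠ 0 := by exact_mod_cast hp.ne_zero
  have hsq : (1 - Complex.I / p) * (1 + Complex.I / p) = (1 + 1 / (p : ℂ) ^ 2) := by
    field_simp
    linear_combination -Complex.I_sq
  have hI3' : Complex.I ^ 3 = -Complex.I := by rw [pow_succ, Complex.I_sq]; ring
  simp only [apply_natCast_five]
  rw [prod_ne_one_five (fun z => (1 - (if p % 5 = 1 then 1 else if p % 5 = 2 then z else
      if p % 5 = 3 then z ^ 3 else if p % 5 = 4 then z ^ 2 else 0) / (p : ℂ))⁻¹ ^ negApplyFour z)]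
  have e1 : negApplyFour Complex.I = 1 := if_neg hI1
  have e2 : negApplyFour (-1) = -1 := if_pos rfl
  have e3 : negApplyFour (-Complex.I) = 1 := if_neg hI3
  rw [e1, e2, e3]
  have hlt : p % 5 < 5 := Nat.mod_lt _ (by norm_num)
  have hne : (1 - 1 / (p : ℂ)) ≠ 0 := by
    have : (1 - 1 / (p : ℝ)) ≠ 0 := by
      have : 1 / (p : ℝ) < 1 := by rw [div_lt_one (by linarith)]; exact hp1
      linarith
    simpa using Complex.ofReal_ne_zero.2 this
  generalize p % 5 = r at hlt
  interval_cases r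
  · simp
  · simp only [zpow_one, zpow_neg, inv_inv]
    norm_num at hne ⊢
    field_simp
  · simp only [zpow_one, zpow_neg, inv_inv]
    norm_num
    rw [neg_div, sub_neg_eq_add]
    rw [show ((p : ℂ) ^ 2)⁻¹ = 1 / (p : ℂ) ^ 2 by ring, ← hsq, mul_inv, neg_div]
    ring
  · simp only [zpow_one, zpow_neg, inv_inv]
    norm_num
    rw [Odd.neg_pow (by decide), hI3', show ((p : ℂ) ^ 2)⁻¹ = 1 / (p : ℂ) ^ 2 by ring, ← hsq,
      mul_inv, neg_div, neg_neg, neg_div]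
    ring
  · simp only [zpow_one, zpow_neg, inv_inv]
    norm_num
    rw [neg_div, ← inv_pow]
    ring

open scoped Classical in
lemma tendsto_prod_primesBelow_eulerFactorFive :
    Tendsto (fun N : ℕ => ((∏ p ∈ N.primesBelow, eulerFactorFive p : ℝ) : ℂ)) atTop
      (𝓝 (∏ χ ∈ Finset.univ.filter (fun χ : DirichletCharacter ℂ 5 => χ ≠ 1),
        LFunction χ 1 ^ (-(starRingEnd ℂ) (χ (4 : ZMod 5))))) := by
  have hlim : Tendsto (fun N : ℕ =>
      ∏ χ ∈ Finset.univ.filter (fun χ : DirichletCharacter ℂ 5 => χ ≠ 1),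
        (∏ p ∈ N.primesBelow, (1 - χ (p : ZMod 5) / (p : ℂ))⁻¹) ^ negApplyFour (χ 2)) atTop
      (𝓝 (∏ χ ∈ Finset.univ.filter (fun χ : DirichletCharacter ℂ 5 => χ ≠ 1),
        LFunction χ 1 ^ negApplyFour (χ 2))) :=
    tendsto_finsetProd _ fun χ hχ =>
      (tendsto_prod_primesBelow_one_sub_div_inv (Finset.mem_filter.1 hχ).2).zpow₀ _
        (Or.inl (LFunction_apply_one_ne_zero (Finset.mem_filter.1 hχ).2))
  have hval : ∏ χ ∈ Finset.univ.filter (fun χ : DirichletCharacter ℂ 5 => χ ≠ 1),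
      LFunction χ 1 ^ (-(starRingEnd ℂ) (χ (4 : ZMod 5))) =
      ∏ χ ∈ Finset.univ.filter (fun χ : DirichletCharacter ℂ 5 => χ ≠ 1),
        LFunction χ 1 ^ negApplyFour (χ 2) :=
    Finset.prod_congr rfl fun χ hχ => by
      rw [neg_conj_apply_four (Finset.mem_filter.1 hχ).2, Complex.cpow_intCast]
  rw [hval]
  refine hlim.congr fun N => ?_
  simp only [← Finset.prod_zpow]
  rw [Finset.prod_comm, Complex.ofReal_prod]
  exact Finset.prod_congr rfl fun p hp =>
    prod_ne_one_five_euler_factor (Nat.prime_of_mem_primesBelow hp)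

end DirichletCharacter

lemma summable_subtype_one_div_sq (P : ℕ → Prop) :
    Summable fun p : {p : ℕ // P p} => 1 / ((p : ℕ) : ℝ) ^ 2 :=
  (Real.summable_one_div_nat_pow.2 one_lt_two).comp_injective Subtype.val_injective

lemma summable_one_div_add_log {P : ℕ → Prop} (hP : ∀ p, P p → 2 ≤ p) :
    Summable fun p : {p : ℕ // P p} => 1 / ((p : ℕ) : ℝ) + Real.log (1 - 1 / ((p : ℕ) : ℝ)) := by
  refine Summable.of_norm_bounded (summable_subtype_one_div_sq P) fun p => ?_
  have hp : (2 : ℝ) ≤ (p : ℕ) := by exact_mod_cast hP p p.2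
  have hz : 1 / ((p : ℕ) : ℝ) ≤ 1 / 2 := one_div_le_one_div_of_le two_pos hp
  have h0 : 0 ≤ 1 / ((p : ℕ) : ℝ) := by positivity
  have h := DirichletCharacter.norm_neg_log_one_sub_sub_le
    (z := ((1 / ((p : ℕ) : ℝ) : ℝ) : ℂ)) (by rwa [Complex.norm_real, Real.norm_of_nonneg h0])
  rw [Complex.norm_real, Real.norm_of_nonneg h0, ← Complex.ofReal_one, ← Complex.ofReal_sub,
    ← Complex.ofReal_log (by linarith), ← Complex.ofReal_neg, ← Complex.ofReal_sub,
    Complex.norm_real, ← norm_neg] at h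
  calc _ = ‖-(-Real.log (1 - 1 / ((p : ℕ) : ℝ)) - 1 / ((p : ℕ) : ℝ))‖ := by congr 1; ring
    _ ≤ _ := h
    _ = _ := by rw [div_pow, one_pow]

lemma multipliable_one_add_sq_div_one_sub_sq {P : ℕ → Prop} (hP : ∀ p, P p → 2 ≤ p) :
    Multipliable fun p : {p : ℕ // P p} =>
      (1 + 1 / ((p : ℕ) : ℝ) ^ 2) / (1 - 1 / ((p : ℕ) : ℝ) ^ 2) := by
  have hlt (p : {p : ℕ // P p}) : 1 / ((p : ℕ) : ℝ) ^ 2 ≤ 1 / 4 := by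
    have hp : (2 : ℝ) ≤ (p : ℕ) := by exact_mod_cast hP p p.2
    exact one_div_le_one_div_of_le (by norm_num) (by nlinarith)
  have hsum : Summable fun p : {p : ℕ // P p} =>
      2 * (1 / ((p : ℕ) : ℝ) ^ 2) / (1 - 1 / ((p : ℕ) : ℝ) ^ 2) := by
    refine Summable.of_norm_bounded ((summable_subtype_one_div_sq P).mul_left 4) fun p => ?_
    have h1 := hlt p
    have h0 : 0 ≤ 1 / ((p : ℕ) : ℝ) ^ 2 := by positivity
    rw [Real.norm_of_nonneg (div_nonneg (by positivity) (by linarith)), div_le_iff₀ (by linarith)]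
    nlinarith
  refine (Real.multipliable_one_add_of_summable hsum).congr fun p => ?_
  have : 1 - 1 / ((p : ℕ) : ℝ) ^ 2 ≠ 0 := by linarith [hlt p]
  rw [eq_div_iff this, add_mul, div_mul_cancel₀ _ this]
  ring

/-- The factor `(1 - 1/p)² (1 + 1/p)²`, split into two convergent factors. -/
lemma exp_mul_sq_mul_exp_eq {x : ℝ} (hx : x < 1) :
    Real.exp (4 * (x + Real.log (1 - x))) * (((1 + x) / (1 - x)) ^ 2 * Real.exp (-4 * x)) =
      (1 - x) ^ 2 * (1 + x) ^ 2 := by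
  have h1 : 0 < 1 - x := sub_pos.2 hx
  have h2 : Real.exp (4 * Real.log (1 - x)) = (1 - x) ^ 4 := by
    rw [show 4 * Real.log (1 - x) = ((4 : ℕ) : ℝ) * Real.log (1 - x) by norm_num,
      Real.exp_nat_mul, Real.exp_log h1]
  rw [mul_add, Real.exp_add, h2, neg_mul, Real.exp_neg]
  have := Real.exp_ne_zero (4 * x)
  field_simp

lemma multipliable_sq_mul_exp {P : ℕ → Prop} (hP : ∀ p, P p → 2 ≤ p) :
    Multipliable fun p : {p : ℕ // P p} =>
      ((1 + 1 / ((p : ℕ) : ℝ)) / (1 - 1 / ((p : ℕ) : ℝ))) ^ 2 * Real.exp (-4 / ((p : ℕ) : ℝ)) := by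
  have hsum : Summable fun p : {p : ℕ // P p} => -(1 / ((p : ℕ) : ℝ) ^ 2) :=
    (summable_subtype_one_div_sq P).neg
  have hm := Real.multipliable_one_add_of_summable hsum
  have he : Multipliable fun p : {p : ℕ // P p} =>
      Real.exp (-4 * (1 / ((p : ℕ) : ℝ) + Real.log (1 - 1 / ((p : ℕ) : ℝ)))) :=
    ((summable_one_div_add_log hP).mul_left (-4)).hasSum.rexp.multipliable
  refine ((hm.mul hm).mul he).congr fun p => ?_
  have hp : (2 : ℝ) ≤ (p : ℕ) := by exact_mod_cast hP p p.2
  have hz : 1 / ((p : ℕ) : ℝ) < 1 := by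
    rw [div_lt_one (by linarith)]
    linarith
  have := exp_mul_sq_mul_exp_eq hz
  rw [show -4 / ((p : ℕ) : ℝ) = -4 * (1 / ((p : ℕ) : ℝ)) by ring,
    show ∀ a : ℝ, -4 * a = -(4 * a) from fun a => by ring, Real.exp_neg,
    ← div_eq_mul_inv, div_eq_iff (Real.exp_ne_zero _)]
  linear_combination -this

lemma HasProd.tendsto_prod_range_mulIndicator {s : Set ℕ} {f : ℕ → ℝ} {a : ℝ}
    (h : HasProd (fun p : s => f p) a) :
    Tendsto (fun N => ∏ n ∈ range N, s.mulIndicator f n) atTop (𝓝 a) :=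
  (hasProd_subtype_iff_mulIndicator.1 h).tendsto_prod_nat

open DirichletCharacter in
/-- The factor `(1 - 1/p) ^ α(p; 5, 4)` as the product of the Euler factor of the `L`-values and
the correction factors. -/
lemma eulerFactorFive_mul_mulIndicator {p : ℕ} (hp : p.Prime) :
    eulerFactorFive p *
      ({p : ℕ | p.Prime ∧ p % 5 = 4}.mulIndicator
          (fun p => Real.exp (4 * (1 / (p : ℝ) + Real.log (1 - 1 / (p : ℝ))))) p *
        {p : ℕ | p.Prime ∧ (p % 5 = 2 ∨ p % 5 = 3)}.mulIndicator
          (fun p => (1 + 1 / (p : ℝ) ^ 2) / (1 - 1 / (p : ℝ) ^ 2)) p *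
        {p : ℕ | p.Prime ∧ p % 5 = 4}.mulIndicator
          (fun p => ((1 + 1 / (p : ℝ)) / (1 - 1 / (p : ℝ))) ^ 2 * Real.exp (-4 / (p : ℝ))) p) =
      if p ≠ 5 then (1 - 1 / (p : ℝ)) ^ (if p % 5 = 4 then (3 : ℤ) else -1) else 1 := by
  have hp1 : (1 : ℝ) < p := by exact_mod_cast hp.one_lt
  have hx0 : 0 < 1 / (p : ℝ) := by positivity
  have hx1 : 1 / (p : ℝ) < 1 := by rwa [div_lt_one (by linarith)]
  have hid := exp_mul_sq_mul_exp_eq hx1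
  rw [show -4 * (1 / (p : ℝ)) = -4 / (p : ℝ) by ring] at hid
  have hsq : 1 / (p : ℝ) ^ 2 = (1 / (p : ℝ)) ^ 2 := by rw [div_pow, one_pow]
  have hsub : 1 - 1 / (p : ℝ) ≠ 0 := by linarith
  have hadd : 1 + 1 / (p : ℝ) ≠ 0 := by linarith
  have hadd_sq : 1 + (1 / (p : ℝ)) ^ 2 ≠ 0 := by positivity
  have hfac : 1 - (1 / (p : ℝ)) ^ 2 = (1 - 1 / (p : ℝ)) * (1 + 1 / (p : ℝ)) := by ring
  have h5 : p = 5 ↔ p % 5 = 0 := by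
    rw [← Nat.dvd_iff_mod_eq_zero, Nat.prime_dvd_prime_iff_eq Nat.prime_five hp, eq_comm]
  simp only [Set.mulIndicator, Set.mem_ofPred_eq, hp, true_and, eulerFactorFive, ne_eq, h5, hsq,
    hfac]
  have hlt : p % 5 < 5 := Nat.mod_lt _ (by norm_num)
  generalize 1 / (p : ℝ) = x at *
  generalize p % 5 = r at hlt
  have hr : r = 0 ∨ r = 1 ∨ (r = 2 ∨ r = 3) ∨ r = 4 := by lia
  rcases hr with rfl | rfl | hr | rfl
  · simp
  · simp
  · have hr1 : r ≠ 1 := by lia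
    have hr4 : r ≠ 4 := by lia
    have hr0 : r ≠ 0 := by lia
    simp only [hr, hr1, hr4, hr0, if_true, if_false, not_false_eq_true, zpow_neg, zpow_one, one_mul,
      mul_one]
    field_simp
  · norm_num
    rw [hid]
    field_simp

open scoped Classical in
/-- **The explicit formula for `c(5,4)`:** the limit
`c(5,4) = lim_{x→∞} ∏_{p ≤ x, p ≠ 5} (1 - 1/p)^{α(p;5,4)}` (with `α(p;5,4) = 3` if
`p ≡ 4 (mod 5)` and `-1` otherwise) exists and equals
`Π(5,4) exp(4 B(5,4)) ∏_{p ≡ 2,3 (5)} (1 + p⁻²)/(1 - p⁻²)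
  ∏_{p ≡ 4 (5)} ((1 + 1/p)/(1 - 1/p))² e^{-4/p}`,
where `B(5,4) = ∑_{p ≡ 4 (5)} (1/p + log(1 - 1/p))` converges absolutely,
`Π(5,4) = ∏_{χ mod 5, χ ≠ χ₀} L(1,χ)^{-χ̄(4)}`, and the products over primes in the
indicated residue classes are absolutely convergent. -/
theorem mertens_constant_five_four :
    ∃ c : ℝ,
      Tendsto (fun x : ℝ =>
          ∏ p ∈ (Nat.floor x + 1).primesBelow.filter (fun p => p ≠ 5),
            (1 - 1 / (p : ℝ)) ^ (if p % 5 = 4 then (3 : ℤ) else -1))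
        atTop (𝓝 c) ∧
      Summable (fun p : {p : ℕ // p.Prime ∧ p % 5 = 4} =>
        1 / ((p : ℕ) : ℝ) + Real.log (1 - 1 / ((p : ℕ) : ℝ))) ∧
      Multipliable (fun p : {p : ℕ // p.Prime ∧ (p % 5 = 2 ∨ p % 5 = 3)} =>
        (1 + 1 / ((p : ℕ) : ℝ) ^ 2) / (1 - 1 / ((p : ℕ) : ℝ) ^ 2)) ∧
      Multipliable (fun p : {p : ℕ // p.Prime ∧ p % 5 = 4} =>
        ((1 + 1 / ((p : ℕ) : ℝ)) / (1 - 1 / ((p : ℕ) : ℝ))) ^ 2 *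
          Real.exp (-4 / ((p : ℕ) : ℝ))) ∧
      (c : ℂ) =
        (∏ χ ∈ Finset.univ.filter (fun χ : DirichletCharacter ℂ 5 => χ ≠ 1),
            DirichletCharacter.LFunction χ 1 ^ (-(starRingEnd ℂ) (χ (4 : ZMod 5)))) *
          ((Real.exp (4 * ∑' p : {p : ℕ // p.Prime ∧ p % 5 = 4},
              (1 / ((p : ℕ) : ℝ) + Real.log (1 - 1 / ((p : ℕ) : ℝ)))) *
            (∏' p : {p : ℕ // p.Prime ∧ (p % 5 = 2 ∨ p % 5 = 3)},
              (1 + 1 / ((p : ℕ) : ℝ) ^ 2) / (1 - 1 / ((p : ℕ) : ℝ) ^ 2)) *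
            (∏' p : {p : ℕ // p.Prime ∧ p % 5 = 4},
              ((1 + 1 / ((p : ℕ) : ℝ)) / (1 - 1 / ((p : ℕ) : ℝ))) ^ 2 *
                Real.exp (-4 / ((p : ℕ) : ℝ))) : ℝ) : ℂ) := by
  have h4 : ∀ p : ℕ, p.Prime ∧ p % 5 = 4 → 2 ≤ p := fun p hp => hp.1.two_le
  have h23 : ∀ p : ℕ, p.Prime ∧ (p % 5 = 2 ∨ p % 5 = 3) → 2 ≤ p := fun p hp => hp.1.two_le
  have hs := summable_one_div_add_log h4
  have hm23 := multipliable_one_add_sq_div_one_sub_sq h23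
  have hm4 := multipliable_sq_mul_exp h4
  have hexp := (hs.mul_left 4).hasSum.rexp
  rw [tsum_mul_left] at hexp
  have hcorr := ((HasProd.tendsto_prod_range_mulIndicator (s := {p : ℕ | p.Prime ∧ p % 5 = 4})
      (f := fun p => Real.exp (4 * (1 / (p : ℝ) + Real.log (1 - 1 / (p : ℝ))))) hexp).mul
    (HasProd.tendsto_prod_range_mulIndicator
      (s := {p : ℕ | p.Prime ∧ (p % 5 = 2 ∨ p % 5 = 3)})
      (f := fun p => (1 + 1 / (p : ℝ) ^ 2) / (1 - 1 / (p : ℝ) ^ 2)) hm23.hasProd)).mul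
    (HasProd.tendsto_prod_range_mulIndicator (s := {p : ℕ | p.Prime ∧ p % 5 = 4})
      (f := fun p => ((1 + 1 / (p : ℝ)) / (1 - 1 / (p : ℝ))) ^ 2 * Real.exp (-4 / (p : ℝ)))
      hm4.hasProd)
  have hlim := DirichletCharacter.tendsto_prod_primesBelow_eulerFactorFive.mul
    ((Complex.continuous_ofReal.tendsto _).comp hcorr)
  have htotal := hlim.congr (f₂ := fun N : ℕ =>
      ((∏ p ∈ N.primesBelow.filter (fun p => p ≠ 5),
        (1 - 1 / (p : ℝ)) ^ (if p % 5 = 4 then (3 : ℤ) else -1) : ℝ) : ℂ)) fun N => by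
    rw [Function.comp_apply, ← Complex.ofReal_mul, ← Finset.prod_mul_distrib,
      ← Finset.prod_mul_distrib, Finset.prod_filter, ← Finset.prod_subset (s₁ := N.primesBelow)
        (Finset.filter_subset _ _), ← Finset.prod_mul_distrib]
    · congr 1
      refine Finset.prod_congr rfl fun p hp => ?_
      rw [eulerFactorFive_mul_mulIndicator (Nat.prime_of_mem_primesBelow hp)]
    · intro p hpN hp
      have hp' : ¬ p.Prime := fun h => hp (Finset.mem_filter.2 ⟨hpN, h⟩)
      simp [Set.mulIndicator, hp']
  have hre := (Complex.continuous_re.tendsto _).comp htotal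
  exact ⟨_, hre.comp ((tendsto_add_atTop_nat 1).comp tendsto_nat_floor_atTop), hs, hm23, hm4,
    tendsto_nhds_unique ((Complex.continuous_ofReal.tendsto _).comp hre) htotal⟩
end
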